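/- 𝓑_{≥60} = {P, B_2, B_3, P∗P, P∗B_2, P∗B_2∗P}; that is, the maximal pentagonal fragments generated by the pasting operation that occur as subgraphs of fullerene graphs with at least 60 vertices are exactly the pentagon P, the fragments B_2 and B_3, two pentagons pasted together, a pentagon pasted to B_2, and two pentagons pasted to B_2 on both sides. -/

import Mathlib

namespace FG

/-- A combinatorial plane (spherically embedded) graph: a finite simple graph together with
its collection of faces, each face recorded as the finset of edges of its boundary cycle.
Every face boundary is a cycle, every edge lies on exactly two faces, and Euler's formula
holds (edges are counted via the face incidences). -/
structure PlaneGraph (V : Type) [Fintype V] [DecidableEq V] : Type where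
  graph : SimpleGraph V
  faces : Finset (Finset (Sym2 V))
  face_edges : ∀ f ∈ faces, ∀ e ∈ f, e ∈ graph.edgeSet
  face_cycle : ∀ f ∈ faces, ∃ (v : V) (c : graph.Walk v v), c.IsCycle ∧ c.edges.toFinset = f
  edge_faces : ∀ e ∈ graph.edgeSet, (faces.filter (fun f => e ∈ f)).card = 2
  euler : 2 * (Fintype.card V + faces.card) = (∑ f ∈ faces, f.card) + 4

variable {V : Type} [Fintype V] [DecidableEq V]

/-- The vertices incident with at least one edge of an edge set. -/
def edgeVerts (E : Finset (Sym2 V)) : Finset V :=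
  Finset.univ.filter fun v => ∃ e ∈ E, v ∈ e

/-- The degree of a vertex in the subgraph spanned by an edge set. -/
def deg (E : Finset (Sym2 V)) (v : V) : ℕ := (E.filter fun e => v ∈ e).card

/-- The vertices covered by a collection of faces. -/
def facesVerts (H : Finset (Finset (Sym2 V))) : Finset V := edgeVerts (H.sup id)

/-- An edge set is a matching: non-loop edges, pairwise vertex-disjoint. -/
def IsMatching (M : Finset (Sym2 V)) : Prop :=
  (∀ e ∈ M, ¬e.IsDiag) ∧ ∀ e ∈ M, ∀ e' ∈ M, e ≠ e' → ∀ v : V, v ∈ e → v ∉ e'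

/-- A fullerene graph: a cubic 3-connected plane graph with (exactly 12) pentagonal
faces and hexagonal faces. -/
structure IsFullerene (P : PlaneGraph V) : Prop where
  cubic : ∀ v : V, (P.graph.neighborSet v).ncard = 3
  threeConnected : ∀ s : Set V, s.ncard ≤ 2 → (SimpleGraph.induce sᶜ P.graph).Connected
  faceSize : ∀ f ∈ P.faces, f.card = 5 ∨ f.card = 6
  pentTwelve : (P.faces.filter fun f => f.card = 5).card = 12

/-- A fragment of a plane graph: a nonempty set of faces (a cycle together with its
interior) whose boundary — the set of edges lying on exactly one chosen face — is a
single cycle. -/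
structure Fragment (P : PlaneGraph V) : Type where
  inFaces : Finset (Finset (Sym2 V))
  nonempty : inFaces.Nonempty
  subFaces : inFaces ⊆ P.faces
  boundary_cycle : ∃ (v : V) (c : P.graph.Walk v v), c.IsCycle ∧
    c.edges.toFinset =
      (inFaces.sup id).filter fun e => (inFaces.filter fun f => e ∈ f).card = 1

/-- The edge set of a fragment. -/
def Fragment.edges {P : PlaneGraph V} (B : Fragment P) : Finset (Sym2 V) := B.inFaces.sup id

/-- The boundary edges of a fragment. -/
def Fragment.boundary {P : PlaneGraph V} (B : Fragment P) : Finset (Sym2 V) :=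
  B.edges.filter fun e => (B.inFaces.filter fun f => e ∈ f).card = 1

/-- A pentagonal fragment: all inner faces are pentagons. -/
def IsPentagonalFragment {P : PlaneGraph V} (B : Fragment P) : Prop :=
  ∀ f ∈ B.inFaces, f.card = 5

/-- The faces of `P` adjoining the subgraph with edge set `E`: not a face of the
subgraph, but sharing at least one edge with it. -/
def adjoiningFaces (P : PlaneGraph V) (E : Finset (Sym2 V)) : Finset (Finset (Sym2 V)) :=
  P.faces.filter fun f => ¬f ⊆ E ∧ (f ∩ E).Nonempty

/-- The territory `T[G]` of the subgraph with edge set `E`: the subgraph together with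
all adjoining faces. -/
def territoryEdges (P : PlaneGraph V) (E : Finset (Sym2 V)) : Finset (Sym2 V) :=
  E ∪ (adjoiningFaces P E).sup id

/-- `w(G)`: the number of 2-degree vertices of the subgraph spanned by `E`. -/
def wcount (E : Finset (Sym2 V)) : ℕ := ((edgeVerts E).filter fun v => deg E v = 2).card

/-- A subgraph is maximal in `P` when its hexagon extension is contained in `P`,
i.e. every adjoining face is a hexagon. -/
def IsMaximalIn (P : PlaneGraph V) (E : Finset (Sym2 V)) : Prop :=
  ∀ f ∈ adjoiningFaces P E, f.card = 6

/-- `H ∈ 𝒮(G)` for the subgraph `G` with edge set `E`: `H` is a set of mutually disjoint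
hexagons of the hexagon extension `H[G]` (hexagonal faces sharing at least one edge with
`G`) such that `G − H` has a matching covering all remaining 3-degree vertices of `G`. -/
def SextetAdm (P : PlaneGraph V) (E : Finset (Sym2 V)) (H : Finset (Finset (Sym2 V))) : Prop :=
  (∀ f ∈ H, f ∈ P.faces ∧ f.card = 6 ∧ (f ∩ E).Nonempty) ∧
  (∀ f ∈ H, ∀ g ∈ H, f ≠ g → Disjoint (edgeVerts f) (edgeVerts g)) ∧
  ∃ M : Finset (Sym2 V), M ⊆ E ∧ IsMatching M ∧
    (∀ e ∈ M, ∀ v : V, v ∈ e → v ∉ facesVerts H) ∧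
    ∀ v ∈ edgeVerts E, deg E v = 3 → v ∉ facesVerts H → ∃ e ∈ M, v ∈ e

/-- `U_H(G) = V(G) ∖ V(H)`. -/
def Uset (E : Finset (Sym2 V)) (H : Finset (Finset (Sym2 V))) : Finset V :=
  edgeVerts E \ facesVerts H

/-- A Clar set of `H[G]`: a member of `𝒮(G)` minimizing `|U_H(G)|`. -/
def IsClarSet (P : PlaneGraph V) (E : Finset (Sym2 V)) (H : Finset (Finset (Sym2 V))) : Prop :=
  SextetAdm P E H ∧ ∀ H', SextetAdm P E H' → (Uset E H).card ≤ (Uset E H').card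

/-- A normal Clar set: a Clar set such that `G − H` has a perfect matching. -/
def IsNormalClarSet (P : PlaneGraph V) (E : Finset (Sym2 V))
    (H : Finset (Finset (Sym2 V))) : Prop :=
  IsClarSet P E H ∧ ∃ M : Finset (Sym2 V), M ⊆ E ∧ IsMatching M ∧
    (∀ e ∈ M, ∀ v : V, v ∈ e → v ∉ facesVerts H) ∧
    ∀ v ∈ Uset E H, ∃ e ∈ M, v ∈ e

/-- The pentagonal faces of the subgraph with edge set `E`. -/
def pentFaces (P : PlaneGraph V) (E : Finset (Sym2 V)) : Finset (Finset (Sym2 V)) :=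
  P.faces.filter fun f => f.card = 5 ∧ f ⊆ E

/-- A subgraph with `k` pentagons is extremal if `|U_H(G)| = k` for a Clar set `H`. -/
def IsExtremalSub (P : PlaneGraph V) (E : Finset (Sym2 V)) : Prop :=
  ∃ H, IsClarSet P E H ∧ (Uset E H).card = (pentFaces P E).card

/-- A pentagonal ring `R_k`: `k` pentagonal faces `R 0, …, R (k-1)` such that
`R i` and `R j` intersect iff `|i − j| = 1 (mod k)`. -/
def IsPentRing (P : PlaneGraph V) (k : ℕ) (R : ZMod k → Finset (Sym2 V)) : Prop :=
  Function.Injective R ∧ (∀ i, R i ∈ P.faces ∧ (R i).card = 5) ∧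
  ∀ i j : ZMod k, i ≠ j →
    ((edgeVerts (R i) ∩ edgeVerts (R j)).Nonempty ↔ (j = i + 1 ∨ i = j + 1))

/-- The number of pentagons of the pentagonal fragment `B` adjoining (sharing an edge
with) the pentagon `p`. -/
def pentAdjCount {P : PlaneGraph V} (B : Fragment P) (p : Finset (Sym2 V)) : ℕ :=
  (B.inFaces.filter fun q => q ≠ p ∧ (q ∩ p).Nonempty).card

/-- The fragment consisting of a single pentagon `P`. -/
def IsPentagonFrag {P : PlaneGraph V} (B : Fragment P) : Prop :=
  IsPentagonalFragment B ∧ B.inFaces.card = 1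

/-- `B_2`: the extremal pentagonal fragment with 4 pentagons whose Clar extension is
normal. -/
def IsB2Frag {P : PlaneGraph V} (B : Fragment P) : Prop :=
  IsPentagonalFragment B ∧ B.inFaces.card = 4 ∧ IsExtremalSub P B.edges ∧
    ∃ H, IsNormalClarSet P B.edges H

/-- `B_3`: the extremal pentagonal fragment with 6 pentagons whose Clar extension is
normal. -/
def IsB3Frag {P : PlaneGraph V} (B : Fragment P) : Prop :=
  IsPentagonalFragment B ∧ B.inFaces.card = 6 ∧ IsExtremalSub P B.edges ∧
    ∃ H, IsNormalClarSet P B.edges H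

/-- A pasting edge of the subgraph with edge set `E`: an edge of `E` lying on the
boundary of the Clar extension `C[G]` (not an edge of a Clar hexagon) whose two
end-vertices belong to `V(H)` for a Clar set `H`. -/
def IsPastingEdge (P : PlaneGraph V) (E : Finset (Sym2 V)) (e : Sym2 V) : Prop :=
  e ∈ E ∧ ∃ H, IsClarSet P E H ∧ (∀ v : V, v ∈ e → v ∈ facesVerts H) ∧ e ∉ H.sup id

/-- `B` arises from pasting `A` and `C` along a common pasting edge:
`B = A ∪ C` and `A ∩ C` is a single pasting edge of both. -/
def IsPasting {P : PlaneGraph V} (B A C : Fragment P) : Prop :=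
  B.inFaces = A.inFaces ∪ C.inFaces ∧
  ∃ e : Sym2 V, A.edges ∩ C.edges = {e} ∧ IsPastingEdge P A.edges e ∧ IsPastingEdge P C.edges e

def IsBasicFrag {P : PlaneGraph V} (B : Fragment P) : Prop :=
  IsPentagonFrag B ∨ IsB2Frag B ∨ IsB3Frag B

/-- The pentagonal fragments generated from `P`, `B_2`, `B_3` by the pasting operation. -/
inductive Pasted (P : PlaneGraph V) : Fragment P → Prop
  | base (B : Fragment P) : IsBasicFrag B → Pasted P B
  | paste (B A C : Fragment P) : Pasted P A → IsBasicFrag C → IsPasting B A C → Pasted P B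

/-- `P ∗ P`. -/
def IsPPFrag {P : PlaneGraph V} (B : Fragment P) : Prop :=
  ∃ A C : Fragment P, IsPentagonFrag A ∧ IsPentagonFrag C ∧ IsPasting B A C

/-- `P ∗ B_2`. -/
def IsPB2Frag {P : PlaneGraph V} (B : Fragment P) : Prop :=
  ∃ A C : Fragment P, IsPentagonFrag A ∧ IsB2Frag C ∧ IsPasting B A C

/-- `P ∗ B_2 ∗ P`. -/
def IsPB2PFrag {P : PlaneGraph V} (B : Fragment P) : Prop :=
  ∃ B' A C D : Fragment P, IsPentagonFrag A ∧ IsB2Frag C ∧ IsPentagonFrag D ∧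
    IsPasting B' A C ∧ IsPasting B B' D

/-- The six members of `𝓑_{≥60}`. -/
def SixShapes {P : PlaneGraph V} (B : Fragment P) : Prop :=
  IsPentagonFrag B ∨ IsB2Frag B ∨ IsB3Frag B ∨ IsPPFrag B ∨ IsPB2Frag B ∨ IsPB2PFrag B

/-- `B_1`: two vertex-disjoint pentagons joined by an edge. -/
def IsB1 (P : PlaneGraph V) (E : Finset (Sym2 V)) : Prop :=
  ∃ (f g : Finset (Sym2 V)) (a b : V), f ∈ P.faces ∧ g ∈ P.faces ∧ f.card = 5 ∧ g.card = 5 ∧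
    Disjoint (edgeVerts f) (edgeVerts g) ∧ P.graph.Adj a b ∧
    a ∈ edgeVerts f ∧ b ∈ edgeVerts g ∧ E = f ∪ g ∪ {s(a, b)}

/-- `B_1^k`: `k` copies of `B_1` pasted together along pasting edges of their pentagons. -/
inductive B1Pow (P : PlaneGraph V) : ℕ → Finset (Sym2 V) → Prop
  | one (E : Finset (Sym2 V)) : IsB1 P E → B1Pow P 1 E
  | succ (k : ℕ) (E X : Finset (Sym2 V)) (e : Sym2 V) (f g : Finset (Sym2 V)) :
      B1Pow P k E → IsB1 P X → E ∩ X = {e} → f ∈ P.faces → g ∈ P.faces →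
      f.card = 5 → g.card = 5 → f ⊆ E → g ⊆ X → e ∈ f → e ∈ g →
      IsPastingEdge P f e → IsPastingEdge P g e → B1Pow P (k + 1) (E ∪ X)

/-- `F` contains `B_1^k` for some `2 ≤ k ≤ 4` as a subgraph. -/
def ContainsB1Pow (P : PlaneGraph V) : Prop :=
  ∃ (k : ℕ) (E : Finset (Sym2 V)), 2 ≤ k ∧ k ≤ 4 ∧ B1Pow P k E

/-- A perfect matching of the plane graph `P`. -/
def IsPerfectMatching (P : PlaneGraph V) (M : Finset (Sym2 V)) : Prop :=
  (∀ e ∈ M, e ∈ P.graph.edgeSet) ∧ IsMatching M ∧ ∀ v : V, ∃ e ∈ M, v ∈ e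

/-- A sextet pattern of `P`: mutually disjoint hexagonal faces, all alternating with
respect to a common perfect matching. -/
def IsSextetPattern (P : PlaneGraph V) (H : Finset (Finset (Sym2 V))) : Prop :=
  (∀ f ∈ H, f ∈ P.faces ∧ f.card = 6) ∧
  (∀ f ∈ H, ∀ g ∈ H, f ≠ g → Disjoint (edgeVerts f) (edgeVerts g)) ∧
  ∃ M : Finset (Sym2 V), IsPerfectMatching P M ∧ ∀ f ∈ H, (f ∩ M).card = 3

/-- A Clar formula: a maximum sextet pattern. -/
def IsClarFormula (P : PlaneGraph V) (H : Finset (Finset (Sym2 V))) : Prop :=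
  IsSextetPattern P H ∧ ∀ H', IsSextetPattern P H' → H'.card ≤ H.card

/-- An extremal fullerene graph: the Clar number equals `(n − 12)/6`. -/
def IsExtremalFullerene (P : PlaneGraph V) : Prop :=
  ∃ H, IsClarFormula P H ∧ 6 * H.card = Fintype.card V - 12

/-- The edges of the union of all maximal pentagonal fragments of `P`. -/
noncomputable def maxPentEdges (P : PlaneGraph V) : Finset (Sym2 V) :=
  @Finset.filter _
    (fun e => ∃ B : Fragment P, IsPentagonalFragment B ∧ IsMaximalIn P B.edges ∧ e ∈ B.edges)
    (Classical.decPred _) (P.faces.sup id)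

/-- The disjoint union of two copies of `K_2`. -/
def twoK2 : SimpleGraph (Fin 4) := SimpleGraph.fromEdgeSet {s(0, 1), s(2, 3)}

/-- The tree `T_0` on six vertices: two adjacent 3-degree vertices, each also adjacent
to two leaves. -/
def treeT0 : SimpleGraph (Fin 6) :=
  SimpleGraph.fromEdgeSet {s(0, 1), s(0, 2), s(0, 3), s(1, 4), s(1, 5)}

end FG

namespace FG
set_option linter.unusedSectionVars false
open Finset

section cyc
variable {W : Type} [DecidableEq W]

/-- Functional form of a cycle with edge set `f`. -/
structure Cyc (n : ℕ) (g : ℕ → W) (f : Finset (Sym2 W)) : Prop where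
  three : 3 ≤ n
  per : ∀ i, g (i + n) = g i
  inj : ∀ i < n, ∀ j < n, g i = g j → i = j
  mem : ∀ e, e ∈ f ↔ ∃ i < n, e = s(g i, g (i + 1))

theorem Cyc.mod {n : ℕ} {g : ℕ → W} {f} (h : Cyc n g f) (i : ℕ) : g (i % n) = g i := by
  have : Function.Periodic g n := h.per
  exact this.map_mod_nat i

theorem Cyc.eq_iff {n : ℕ} {g : ℕ → W} {f} (h : Cyc n g f) (i j : ℕ) :
    g i = g j ↔ i % n = j % n := by
  have h3 := h.three
  constructor
  · intro hh
    rw [← h.mod i, ← h.mod j] at hh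
    exact h.inj _ (Nat.mod_lt _ (by omega)) _ (Nat.mod_lt _ (by omega)) hh
  · intro hh
    rw [← h.mod i, ← h.mod j, hh]

theorem Cyc.ofB {n : ℕ} {g : ℕ → W} {f : Finset (Sym2 W)} (h3 : 3 ≤ n) (hn : g n = g 0)
    (inj : ∀ i < n, ∀ j < n, g i = g j → i = j)
    (mem : ∀ e, e ∈ f ↔ ∃ i < n, e = s(g i, g (i + 1))) :
    Cyc n (fun i => g (i % n)) f := by
  refine ⟨h3, fun i => by simp, ?_, ?_⟩
  · intro i hi j hj h
    simp only [Nat.mod_eq_of_lt hi, Nat.mod_eq_of_lt hj] at h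
    exact inj i hi j hj h
  · intro e
    rw [mem]
    refine exists_congr fun i => and_congr_right fun hi => ?_
    rw [Nat.mod_eq_of_lt hi]
    rcases Nat.lt_or_ge (i + 1) n with h | h
    · rw [Nat.mod_eq_of_lt h]
    · have : i + 1 = n := by omega
      rw [this, Nat.mod_self, hn]

theorem Cyc.rot {n : ℕ} {g : ℕ → W} {f} (h : Cyc n g f) (a : ℕ) :
    Cyc n (fun i => g (i + a)) f := by
  have h3 := h.three
  refine ⟨h3, fun i => ?_, ?_, ?_⟩
  · show g (i + n + a) = g (i + a)
    rw [show i + n + a = i + a + n by ring, h.per]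
  · intro i hi j hj hh
    have := (h.eq_iff _ _).1 hh
    have h2 : i ≡ j [MOD n] := Nat.ModEq.add_right_cancel' a this
    rw [Nat.ModEq, Nat.mod_eq_of_lt hi, Nat.mod_eq_of_lt hj] at h2
    exact h2
  · intro e
    rw [h.mem]
    have key : ∀ a i, ∃ j < n, g (j + a) = g i ∧ g (j + 1 + a) = g (i + 1) := by
      intro a i
      refine ⟨(i + (n - 1) * a) % n, Nat.mod_lt _ (by omega), ?_, ?_⟩
      · rw [h.eq_iff]
        obtain ⟨m, rfl⟩ : ∃ m, n = m + 1 := ⟨n - 1, by omega⟩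
        simp only [Nat.add_sub_cancel, Nat.mod_add_mod]
        rw [show i + m * a + a = i + a * (m + 1) by ring, Nat.add_mul_mod_self_right]
      · rw [h.eq_iff]
        obtain ⟨m, rfl⟩ : ∃ m, n = m + 1 := ⟨n - 1, by omega⟩
        simp only [Nat.add_sub_cancel, add_assoc, Nat.mod_add_mod]
        rw [show i + (m * a + (1 + a)) = i + 1 + a * (m + 1) by ring, Nat.add_mul_mod_self_right]
    constructor
    · rintro ⟨i, hi, rfl⟩
      obtain ⟨j, hj, h1, h2⟩ := key a i
      exact ⟨j, hj, by rw [h1, h2]⟩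
    · rintro ⟨i, hi, rfl⟩
      refine ⟨(i + a) % n, Nat.mod_lt _ (by omega), ?_⟩
      have e1 : g ((i + a) % n) = g (i + a) := h.mod _
      have e2 : g ((i + a) % n + 1) = g (i + 1 + a) := by
        rw [h.eq_iff]; simp only [Nat.mod_add_mod]; congr 1; ring
      rw [e1, e2]

theorem Cyc.rev {n : ℕ} {g : ℕ → W} {f} (h : Cyc n g f) :
    ∃ g', Cyc n g' f ∧ g' 0 = g 0 ∧ g' (n - 1) = g 1 := by
  have h3 := h.three
  refine ⟨_, Cyc.ofB (g := fun i => g (n - i)) h3 ?_ ?_ ?_, ?_, ?_⟩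
  · show g (n - n) = g (n - 0)
    have := h.per 0
    simp at this
    simp [this]
  · intro i hi j hj hh
    have hh := (h.eq_iff _ _).1 hh
    rcases Nat.eq_zero_or_pos i with rfl | h1 <;> rcases Nat.eq_zero_or_pos j with rfl | h2
    · rfl
    · rw [Nat.sub_zero, Nat.mod_self, Nat.mod_eq_of_lt (by omega)] at hh; omega
    · rw [Nat.sub_zero, Nat.mod_self, Nat.mod_eq_of_lt (by omega)] at hh; omega
    · rw [Nat.mod_eq_of_lt (by omega), Nat.mod_eq_of_lt (by omega)] at hh; omega
  · intro e
    rw [h.mem]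
    constructor
    · rintro ⟨i, hi, rfl⟩
      refine ⟨n - 1 - i, by omega, ?_⟩
      show _ = s(g (n - (n - 1 - i)), g (n - (n - 1 - i + 1)))
      rw [show n - (n - 1 - i) = i + 1 by omega, show n - (n - 1 - i + 1) = i by omega, Sym2.eq_swap]
    · rintro ⟨i, hi, rfl⟩
      refine ⟨n - 1 - i, by omega, ?_⟩
      show s(g (n - i), g (n - (i + 1))) = _
      rw [show n - 1 - i + 1 = n - i by omega, show n - (i + 1) = n - 1 - i by omega, Sym2.eq_swap]
  · have := h.per 0
    simp at this
    simp [this]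
  · show g (n - (n - 1) % n) = g 1
    rw [Nat.mod_eq_of_lt (by omega)]; congr 1; omega

theorem Cyc.start {n : ℕ} {g : ℕ → W} {f} (h : Cyc n g f) {v w : W} (hf : s(v, w) ∈ f) :
    ∃ g', Cyc n g' f ∧ g' 0 = v ∧ g' 1 = w := by
  have h3 := h.three
  obtain ⟨i, hi, he⟩ := (h.mem _).1 hf
  rcases Sym2.eq_iff.1 he with ⟨rfl, rfl⟩ | ⟨rfl, rfl⟩
  · exact ⟨_, h.rot i, by simp, by simp [add_comm]⟩
  · obtain ⟨g', h', e0, e1⟩ := (h.rot i).rev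
    have p := h'.per 0
    refine ⟨_, h'.rot (n - 1), ?_, ?_⟩
    · simp [e1, add_comm]
    · show g' (1 + (n - 1)) = _
      rw [show 1 + (n - 1) = 0 + n by omega, p, e0]; simp

theorem Cyc.card {n : ℕ} {g : ℕ → W} {f} (h : Cyc n g f) : f.card = n := by
  have h3 := h.three
  have : f = (range n).image (fun i => s(g i, g (i + 1))) := by
    ext e; rw [h.mem]; simp [eq_comm]
  rw [this, card_image_of_injOn, card_range]
  intro i hi j hj hh
  simp only [coe_range, Set.mem_Iio] at hi hj
  rcases Sym2.eq_iff.1 hh with ⟨a, b⟩ | ⟨a, b⟩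
  · exact h.inj i hi j hj a
  · rw [h.eq_iff] at a b
    exfalso
    rw [Nat.mod_eq_of_lt hi] at a
    rw [Nat.mod_eq_of_lt hj] at b
    rcases Nat.lt_or_ge (i + 1) n with h1 | h1 <;> rcases Nat.lt_or_ge (j + 1) n with h2 | h2
    · rw [Nat.mod_eq_of_lt h1] at b; rw [Nat.mod_eq_of_lt h2] at a; omega
    · rw [Nat.mod_eq_of_lt h1] at b; rw [show j + 1 = n by omega, Nat.mod_self] at a; omega
    · rw [Nat.mod_eq_of_lt h2] at a; rw [show i + 1 = n by omega, Nat.mod_self] at b; omega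
    · rw [show j + 1 = n by omega, Nat.mod_self] at a; omega

/-- the two edges at `g (i+1)` -/
theorem Cyc.at {n : ℕ} {g : ℕ → W} {f} (h : Cyc n g f) (i : ℕ) (x : W) :
    s(g (i + 1), x) ∈ f ↔ x = g i ∨ x = g (i + 2) := by
  have h3 := h.three
  have hr := h.rot i
  rw [hr.mem]
  have hper := h.per i
  constructor
  · rintro ⟨j, hj, he⟩
    rcases Sym2.eq_iff.1 he with ⟨a, b⟩ | ⟨a, b⟩
    · have : j = 1 := by
        apply hr.inj j hj 1 (by omega); show g (j + i) = g (1 + i); rw [← a, add_comm]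
      subst this
      right; rw [b]; congr 1; omega
    · have : j = 0 := by
        have h1 : g (j + 1 + i) = g (i + 1) := a.symm
        rw [h.eq_iff] at h1
        have h2 : j + (i + 1) ≡ 0 + (i + 1) [MOD n] := by
          rw [Nat.ModEq]; rw [zero_add, ← h1]; congr 1; ring
        have h4 := Nat.ModEq.add_right_cancel' _ h2
        rwa [Nat.ModEq, Nat.mod_eq_of_lt hj, Nat.zero_mod] at h4
      subst this
      left; rw [b]; congr 1; omega
  · rintro (rfl | rfl)
    · exact ⟨0, by omega, by rw [Sym2.eq_swap]; simp [add_comm]⟩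
    · refine ⟨1, by omega, ?_⟩
      simp only [add_comm]

theorem Cyc.ne2 {n : ℕ} {g : ℕ → W} {f} (h : Cyc n g f) (i : ℕ) : g i ≠ g (i + 2) := by
  have h3 := h.three
  intro hh
  have hr := h.rot i
  have := hr.inj 0 (by omega) 2 (by omega) (by simpa [add_comm] using hh)
  omega

theorem Cyc.edge {n : ℕ} {g : ℕ → W} {f} (h : Cyc n g f) (i : ℕ) : s(g i, g (i + 1)) ∈ f := by
  rw [Sym2.eq_swap, h.at]; exact Or.inl rfl

theorem Cyc.mem_vert {n : ℕ} {g : ℕ → W} {f} (h : Cyc n g f) {v w : W} (hv : s(v, w) ∈ f) :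
    ∃ i < n, v = g i := by
  have h3 := h.three
  obtain ⟨i, hi, he⟩ := (h.mem _).1 hv
  rcases Sym2.eq_iff.1 he with ⟨rfl, rfl⟩ | ⟨rfl, rfl⟩
  · exact ⟨i, hi, rfl⟩
  · exact ⟨(i + 1) % n, Nat.mod_lt _ (by omega), (h.mod _).symm⟩

theorem walk_of {G : SimpleGraph W} (g : ℕ → W) (hadj : ∀ i, G.Adj (g i) (g (i + 1))) (k : ℕ) :
    ∃ p : G.Walk (g 0) (g k), p.support = (List.range (k + 1)).map g ∧
      p.edges = (List.range k).map (fun i => s(g i, g (i + 1))) := by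
  induction k with
  | zero => exact ⟨.nil, by simp, by simp⟩
  | succ k ih =>
    obtain ⟨p, h1, h2⟩ := ih
    refine ⟨p.concat (hadj k), ?_, ?_⟩
    · rw [SimpleGraph.Walk.support_concat, h1, List.range_succ (n := k + 1)]; simp
    · rw [SimpleGraph.Walk.edges_concat, h2, List.range_succ (n := k)]; simp

theorem Cyc.toWalk {G : SimpleGraph W} {n : ℕ} {g : ℕ → W} {f} (h : Cyc n g f)
    (hG : ∀ e ∈ f, e ∈ G.edgeSet) : ∃ (v : W) (c : G.Walk v v), c.IsCycle ∧ c.edges.toFinset = f := by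
  have h3 := h.three
  obtain ⟨p, h1, h2⟩ := walk_of (G := G) g (fun i => by simpa using hG _ (h.edge i)) n
  have hn : g n = g 0 := by simpa using h.per 0
  have hf : f = p.edges.toFinset := by
    ext e; rw [h.mem, h2]; simp [eq_comm]
  refine ⟨g 0, p.copy rfl hn, ?_, by simp [hf]⟩
  rw [SimpleGraph.Walk.isCycle_def]
  refine ⟨?_, ?_, ?_⟩
  · rw [SimpleGraph.Walk.isTrail_def]
    have hc := h.card
    rw [hf, ] at hc
    rw [SimpleGraph.Walk.edges_copy]
    rw [← Multiset.coe_nodup, ← Multiset.toFinset_card_eq_card_iff_nodup]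
    have : (Multiset.toFinset (p.edges : Multiset (Sym2 W))) = p.edges.toFinset := rfl
    rw [this, hc, h2]
    simp
  · intro hh
    have := congrArg SimpleGraph.Walk.edges hh
    rw [SimpleGraph.Walk.edges_copy, h2] at this
    simp at this; omega
  · rw [SimpleGraph.Walk.support_copy, h1, List.range_succ_eq_map]
    simp only [List.map_cons, List.tail_cons, List.map_map]
    rw [List.nodup_map_iff_inj_on List.nodup_range]
    intro i hi j hj hh
    have := (h.eq_iff _ _).1 hh
    have := Nat.ModEq.add_right_cancel' 1 this
    simp only [List.mem_range] at hi hj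
    rwa [Nat.ModEq, Nat.mod_eq_of_lt hi, Nat.mod_eq_of_lt hj] at this

theorem Cyc.ofWalk {G : SimpleGraph W} {v : W} {c : G.Walk v v} (hc : c.IsCycle) :
    ∃ n g, Cyc n g c.edges.toFinset := by
  refine ⟨c.length, _, Cyc.ofB (g := c.getVert) hc.three_le_length (by simp) ?_ ?_⟩
  · intro i hi j hj h
    exact hc.getVert_injOn' (by simp; omega) (by simp; omega) h
  · intro e
    simp only [List.mem_toFinset]
    constructor
    · intro h
      obtain ⟨i, hi, he⟩ := List.getElem_of_mem h
      rw [SimpleGraph.Walk.length_edges] at hi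
      refine ⟨i, hi, ?_⟩
      rw [← he]
      simp [SimpleGraph.Walk.edges, SimpleGraph.Walk.darts_getElem_eq_getVert]
    · rintro ⟨i, hi, rfl⟩
      exact (SimpleGraph.Walk.mk_mem_edges_iff_exists _).2 ⟨i, hi, rfl⟩
end cyc

end FG

namespace FG
open Finset

variable {V : Type} [Fintype V] [DecidableEq V]
set_option linter.unusedSectionVars false

theorem face_cyc (P : PlaneGraph V) {f} (hf : f ∈ P.faces) : ∃ n g, Cyc n g f := by
  obtain ⟨v, c, hc, rfl⟩ := P.face_cycle f hf
  exact Cyc.ofWalk hc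

/-- A flag: a vertex, an edge at it, and a face containing the edge. -/
@[ext] structure Flag (P : PlaneGraph V) where
  vt : V
  wt : V
  fc : Finset (Sym2 V)
  mf : fc ∈ P.faces
  me : s(vt, wt) ∈ fc

variable {P : PlaneGraph V}
namespace Flag

def ed (x : Flag P) : Sym2 V := s(x.vt, x.wt)

theorem me' (x : Flag P) : x.ed ∈ x.fc := x.me

theorem adj (x : Flag P) : P.graph.Adj x.vt x.wt := P.face_edges _ x.mf _ x.me

theorem ne (x : Flag P) : x.vt ≠ x.wt := x.adj.ne

def s0 (x : Flag P) : Flag P := ⟨x.wt, x.vt, x.fc, x.mf, by rw [Sym2.eq_swap]; exact x.me⟩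

theorem ex1 (x : Flag P) : ∃ w, w ≠ x.wt ∧ ∀ u, s(x.vt, u) ∈ x.fc ↔ u = x.wt ∨ u = w := by
  obtain ⟨n, g, h⟩ := face_cyc P x.mf
  obtain ⟨g, h, h0, h1⟩ := h.start (v := x.wt) (w := x.vt) (by rw [Sym2.eq_swap]; exact x.me)
  refine ⟨g 2, ?_, fun u => ?_⟩
  · rw [← h0]; exact (h.ne2 0).symm
  · rw [← h1, ← h0]; exact h.at 0 u

noncomputable def s1 (x : Flag P) : Flag P :=
  ⟨x.vt, x.ex1.choose, x.fc, x.mf, (x.ex1.choose_spec.2 _).2 (Or.inr rfl)⟩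

theorem ex2 (x : Flag P) : ∃ f, f ≠ x.fc ∧ ∀ g, (g ∈ P.faces ∧ x.ed ∈ g) ↔ g = x.fc ∨ g = f := by
  have h := P.edge_faces x.ed (P.face_edges _ x.mf _ x.me)
  obtain ⟨a, b, hab, h⟩ := card_eq_two.1 h
  have hx : x.fc ∈ P.faces.filter (fun f => x.ed ∈ f) := by simp [x.mf, x.me']
  have h' : ∀ g, (g ∈ P.faces ∧ x.ed ∈ g) ↔ g = a ∨ g = b := by
    intro g; rw [← mem_filter (s := P.faces) (p := fun f => x.ed ∈ f), h]; simp
  rw [h] at hx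
  simp only [mem_insert, mem_singleton] at hx
  rcases hx with hx | hx
  · exact ⟨b, by rw [hx]; exact hab.symm, by rw [hx]; exact h'⟩
  · exact ⟨a, by rw [hx]; exact hab, fun g => by rw [h', hx, or_comm]⟩

noncomputable def s2 (x : Flag P) : Flag P :=
  ⟨x.vt, x.wt, x.ex2.choose, ((x.ex2.choose_spec.2 _).2 (Or.inr rfl)).1,
    ((x.ex2.choose_spec.2 _).2 (Or.inr rfl)).2⟩

@[simp] theorem vt_s0 (x : Flag P) : x.s0.vt = x.wt := rfl
@[simp] theorem wt_s0 (x : Flag P) : x.s0.wt = x.vt := rfl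
@[simp] theorem fc_s0 (x : Flag P) : x.s0.fc = x.fc := rfl
@[simp] theorem vt_s1 (x : Flag P) : x.s1.vt = x.vt := rfl
@[simp] theorem fc_s1 (x : Flag P) : x.s1.fc = x.fc := rfl
@[simp] theorem vt_s2 (x : Flag P) : x.s2.vt = x.vt := rfl
@[simp] theorem wt_s2 (x : Flag P) : x.s2.wt = x.wt := rfl

theorem wt_s1_ne (x : Flag P) : x.s1.wt ≠ x.wt := x.ex1.choose_spec.1
theorem s1_mem (x : Flag P) (u : V) : s(x.vt, u) ∈ x.fc ↔ u = x.wt ∨ u = x.s1.wt :=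
  x.ex1.choose_spec.2 u
theorem fc_s2_ne (x : Flag P) : x.s2.fc ≠ x.fc := x.ex2.choose_spec.1
theorem s2_mem (x : Flag P) (g) : (g ∈ P.faces ∧ x.ed ∈ g) ↔ g = x.fc ∨ g = x.s2.fc :=
  x.ex2.choose_spec.2 g

@[simp] theorem ed_s0 (x : Flag P) : x.s0.ed = x.ed := Sym2.eq_swap
@[simp] theorem ed_s2 (x : Flag P) : x.s2.ed = x.ed := rfl

/-- Flags with the same vertex and face. -/
theorem eq_vf {x y : Flag P} (h1 : y.vt = x.vt) (h2 : y.fc = x.fc) : y = x ∨ y = x.s1 := by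
  have := (x.s1_mem y.wt).1 (by rw [← h1, ← h2]; exact y.me)
  rcases this with h | h
  · left; ext1 <;> assumption
  · right; ext1 <;> assumption

/-- Flags with the same vertex and edge. -/
theorem eq_ve {x y : Flag P} (h1 : y.vt = x.vt) (h2 : y.wt = x.wt) : y = x ∨ y = x.s2 := by
  have := (x.s2_mem y.fc).1 ⟨y.mf, by have := y.me; rw [h1, h2] at this; exact this⟩
  rcases this with h | h
  · left; ext1 <;> assumption
  · right; ext1 <;> assumption

@[simp] theorem s0_s0 (x : Flag P) : x.s0.s0 = x := rfl
@[simp] theorem s1_s1 (x : Flag P) : x.s1.s1 = x := by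
  rcases eq_vf (x := x) (y := x.s1.s1) rfl rfl with h | h
  · exact h
  · exact absurd (congrArg wt h) (x.s1.wt_s1_ne)
@[simp] theorem s2_s2 (x : Flag P) : x.s2.s2 = x := by
  rcases eq_ve (x := x) (y := x.s2.s2) rfl rfl with h | h
  · exact h
  · exact absurd (congrArg fc h) (x.s2.fc_s2_ne)
theorem s0_s2 (x : Flag P) : x.s0.s2 = x.s2.s0 := by
  rcases eq_ve (x := x.s0) (y := x.s2.s0) rfl rfl with h | h
  · exact absurd (congrArg fc h) (x.fc_s2_ne)
  · exact h.symm

noncomputable def rv (x : Flag P) : Flag P := x.s2.s0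
noncomputable def rt (x : Flag P) : Flag P := x.s2.s1
noncomputable def nx (x : Flag P) : Flag P := x.s0.s1

@[simp] theorem rv_rv (x : Flag P) : x.rv.rv = x := by simp [rv, s0_s2]
@[simp] theorem vt_rv (x : Flag P) : x.rv.vt = x.wt := rfl
@[simp] theorem wt_rv (x : Flag P) : x.rv.wt = x.vt := rfl
@[simp] theorem ed_rv (x : Flag P) : x.rv.ed = x.ed := Sym2.eq_swap
@[simp] theorem vt_rt (x : Flag P) : x.rt.vt = x.vt := rfl
theorem fc_rt (x : Flag P) : x.rt.fc = x.rv.fc := rfl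
@[simp] theorem fc_nx (x : Flag P) : x.nx.fc = x.fc := rfl
@[simp] theorem vt_nx (x : Flag P) : x.nx.vt = x.wt := rfl
theorem fc_rv_ne (x : Flag P) : x.rv.fc ≠ x.fc := x.fc_s2_ne
theorem nx_eq (x : Flag P) : x.nx = x.rv.rt := by
  simp [nx, rv, rt, s0_s2]
theorem rt_eq (x : Flag P) : x.rt = x.rv.nx := by rw [nx_eq, rv_rv]
theorem s0_nx (x : Flag P) : x.nx.s0.nx = x.s0 := by simp [nx]

/-- flags with the same edge and face -/
theorem eq_ef {x y : Flag P} (h1 : y.ed = x.ed) (h2 : y.fc = x.fc) : y = x ∨ y = x.s0 := by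
  rcases Sym2.eq_iff.1 h1 with ⟨a, b⟩ | ⟨a, b⟩
  · left; ext1 <;> assumption
  · right; ext1 <;> assumption

theorem eq_e {x y : Flag P} (h1 : y.ed = x.ed) : y = x ∨ y = x.s0 ∨ y = x.s2 ∨ y = x.rv := by
  rcases Sym2.eq_iff.1 h1 with ⟨a, b⟩ | ⟨a, b⟩
  · rcases eq_ve a b with h | h <;> tauto
  · rcases eq_ve (x := x.s0) a b with h | h
    · tauto
    · rw [s0_s2] at h; tauto

/-- a vertex has three flags up to `s1`. -/
theorem nbr (hP : IsFullerene P) (v : V) (a b c : V) (hab : a ≠ b) (hbc : b ≠ c) (hac : a ≠ c)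
    (ha : P.graph.Adj v a) (hb : P.graph.Adj v b) (hc : P.graph.Adj v c) (d : V) :
    P.graph.Adj v d ↔ d = a ∨ d = b ∨ d = c := by
  have h3 := hP.cubic v
  have hsub : ({a, b, c} : Set V) ⊆ P.graph.neighborSet v := by
    rintro x (rfl | rfl | rfl) <;> assumption
  have hc3 : ({a, b, c} : Set V).ncard = 3 := by
    rw [Set.ncard_eq_three]; exact ⟨a, b, c, hab, hac, hbc, rfl⟩
  have := Set.eq_of_subset_of_ncard_le hsub (by rw [h3, hc3]) (Set.toFinite _)
  constructor
  · intro h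
    have : d ∈ ({a, b, c} : Set V) := by rw [this]; exact h
    simpa using this
  · rintro (rfl | rfl | rfl) <;> assumption

theorem exists_flag (P : PlaneGraph V) {v w : V} (h : P.graph.Adj v w) :
    ∃ x : Flag P, x.vt = v ∧ x.wt = w := by
  have := P.edge_faces s(v, w) h
  obtain ⟨f, hf⟩ : (P.faces.filter (fun f => s(v, w) ∈ f)).Nonempty := by
    rw [← card_pos, this]; norm_num
  rw [mem_filter] at hf
  exact ⟨⟨v, w, f, hf.1, hf.2⟩, rfl, rfl⟩

theorem wt_rt_ne_s1 (hP : IsFullerene P) (x : Flag P) : x.rt.wt ≠ x.s1.wt := by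
  intro h
  have h0 := x.wt_s1_ne
  have h1 : ∃ d, P.graph.Adj x.vt d ∧ d ≠ x.wt ∧ d ≠ x.s1.wt := by
    by_contra hcon
    push Not at hcon
    have h3 := hP.cubic x.vt
    have hsub : P.graph.neighborSet x.vt ⊆ ({x.wt, x.s1.wt} : Set V) := by
      intro d hd
      by_cases hh : d = x.wt
      · left; exact hh
      · right; exact hcon d hd hh
    have := Set.ncard_le_ncard hsub (Set.toFinite _)
    have := Set.ncard_insert_le x.wt {x.s1.wt}
    rw [Set.ncard_singleton] at this
    omega
  obtain ⟨d, hd, d1, d2⟩ := h1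
  obtain ⟨y, hy1, hy2⟩ := exists_flag P hd
  have hy := y.s1.adj
  have hyne := y.wt_s1_ne
  have hbr := nbr hP x.vt x.wt x.s1.wt d h0.symm d2.symm d1.symm x.adj x.s1.adj hd y.s1.wt
  rw [vt_s1, hy1] at hy
  rcases hbr.1 hy with h4 | h4 | h4
  · rcases eq_ve (x := x) (y := y.s1) hy1 h4 with h5 | h5
    · have : y = x.s1 := by rw [← h5, s1_s1]
      rw [this] at hy2; exact d2 hy2.symm
    · have : y = x.rt := by rw [rt, ← h5, s1_s1]
      rw [this, h] at hy2; exact d2 hy2.symm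
  · rcases eq_ve (x := x.s1) (y := y.s1) hy1 h4 with h5 | h5
    · have : y = x := by rw [← s1_s1 y, h5, s1_s1]
      rw [this] at hy2; exact d1 hy2.symm
    · have h6 : x.rt = x.s1.s2 := by
        rcases eq_ve (x := x.s1) (y := x.rt) rfl h with h | h
        · exact absurd (congrArg fc h) x.fc_s2_ne
        · exact h
      have : y = x.s2 := by rw [← s1_s1 y, h5, ← h6, rt, s1_s1]
      rw [this] at hy2; exact d1 hy2.symm
  · rw [hy2] at hyne; exact hyne h4

theorem rt3 (hP : IsFullerene P) (x : Flag P) : x.rt.rt.rt = x := by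
  -- wt of rt rt equals wt of s1
  have a1 : x.rt.wt ≠ x.wt := x.s2.wt_s1_ne
  have a2 := wt_rt_ne_s1 hP x
  have a3 := x.wt_s1_ne
  have b1 : x.rt.rt.wt ≠ x.rt.wt := x.rt.s2.wt_s1_ne
  have b2 : x.rt.rt.wt ≠ x.wt := by
    have := wt_rt_ne_s1 hP x.rt
    have e : x.rt.s1.wt = x.wt := by rw [rt, s1_s1]; rfl
    rwa [e] at this
  have hbr := nbr hP x.vt x.wt x.rt.wt x.s1.wt a1.symm a2 a3.symm x.adj x.rt.adj x.s1.adj x.rt.rt.wt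
  have h : x.rt.rt.wt = x.s1.wt := by
    rcases hbr.1 x.rt.rt.adj with h | h | h
    · exact absurd h b2
    · exact absurd h b1
    · exact h
  rcases eq_ve (x := x.s1) (y := x.rt.rt) rfl h with h5 | h5
  · have : x.rt.s2 = x := by
      have := congrArg s1 h5; rwa [s1_s1, rt, s1_s1] at this
    have := congrArg wt this
    exact absurd this a1
  · rw [rt, h5, s2_s2, s1_s1]

theorem rt_ne (x : Flag P) : x.rt.wt ≠ x.wt := x.s2.wt_s1_ne
theorem rt_rt_ne (hP : IsFullerene P) (x : Flag P) : x.rt.rt.wt ≠ x.wt := by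
  have := x.rt.rt.rt_ne
  rw [rt3 hP] at this
  exact this.symm

theorem eq_v (hP : IsFullerene P) {x y : Flag P} (h : y.vt = x.vt) :
    y = x ∨ y = x.rt ∨ y = x.rt.rt ∨ y = x.s2 ∨ y = x.rt.s2 ∨ y = x.rt.rt.s2 := by
  have hbr := nbr hP x.vt x.wt x.rt.wt x.rt.rt.wt x.rt_ne.symm x.rt.rt_ne.symm (rt_rt_ne hP x).symm
    x.adj x.rt.adj x.rt.rt.adj y.wt
  rcases hbr.1 (by rw [← h]; exact y.adj) with h1 | h1 | h1
  · rcases eq_ve h h1 with h2 | h2 <;> tauto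
  · rcases eq_ve (x := x.rt) h h1 with h2 | h2 <;> tauto
  · rcases eq_ve (x := x.rt.rt) h h1 with h2 | h2 <;> tauto

theorem fc_rt2_ne (hP : IsFullerene P) (x : Flag P) : x.rt.rt.fc ≠ x.fc := by
  have := x.rt.rt.fc_rv_ne
  rw [← fc_rt, rt3 hP] at this
  exact this.symm
theorem fc_rt_ne (x : Flag P) : x.rt.fc ≠ x.fc := x.fc_s2_ne

/-- faces at a vertex -/
theorem fc_v (hP : IsFullerene P) {x y : Flag P} (h : y.vt = x.vt) :
    y.fc = x.fc ∨ y.fc = x.rt.fc ∨ y.fc = x.rt.rt.fc := by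
  rcases eq_v hP h with h | h | h | h | h | h
  · rw [h]; tauto
  · rw [h]; tauto
  · rw [h]; tauto
  · rw [h]; right; left; rfl
  · rw [h]; right; right; rfl
  · rw [h]; left
    have := congrArg fc (rt3 hP x)
    exact this

theorem fc_s2 (x : Flag P) : x.s2.fc = x.rt.fc := rfl
theorem rv_def (x : Flag P) : x.rv = x.s2.s0 := rfl
theorem rt_def (x : Flag P) : x.rt = x.s2.s1 := rfl
theorem nx_def (x : Flag P) : x.nx = x.s0.s1 := rfl

noncomputable def it (x : Flag P) (i : ℕ) : Flag P := nx^[i] x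

theorem it_succ (x : Flag P) (i : ℕ) : x.it (i + 1) = (x.it i).nx := Function.iterate_succ_apply' _ _ _
theorem it_succ' (x : Flag P) (i : ℕ) : x.it (i + 1) = x.nx.it i := rfl
@[simp] theorem it_zero (x : Flag P) : x.it 0 = x := rfl
theorem it_add (x : Flag P) (i j : ℕ) : x.it (i + j) = (x.it j).it i := Function.iterate_add_apply _ _ _ _
@[simp] theorem fc_it (x : Flag P) (i : ℕ) : (x.it i).fc = x.fc := by
  induction i with
  | zero => rfl
  | succ i ih => rw [it_succ, fc_nx, ih]

theorem it_cyc (x : Flag P) : ∃ g, Cyc x.fc.card g x.fc ∧ ∀ i, (x.it i).vt = g i ∧ (x.it i).wt = g (i + 1) := by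
  obtain ⟨n, g, h⟩ := face_cyc P x.mf
  obtain ⟨g, h, h0, h1⟩ := h.start (v := x.vt) (w := x.wt) x.me
  refine ⟨g, by rw [h.card]; exact h, fun i => ?_⟩
  induction i with
  | zero => exact ⟨h0.symm, h1.symm⟩
  | succ i ih =>
    rw [it_succ]
    refine ⟨ih.2, ?_⟩
    have h2 := (x.it i).nx.me
    rw [fc_nx, fc_it, vt_nx, ih.2, h.at] at h2
    rcases h2 with h2 | h2
    · exfalso
      have := (x.it i).s0.wt_s1_ne
      apply this
      rw [wt_s0, ih.1, ← h2]; rfl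
    · exact h2

theorem it_card (x : Flag P) : x.it x.fc.card = x := by
  obtain ⟨g, h, h'⟩ := x.it_cyc
  have h0 := h' 0
  have h1 := h' x.fc.card
  have e : g (x.fc.card) = g 0 := by simpa using h.per 0
  have e' : g (x.fc.card + 1) = g 1 := by rw [add_comm]; exact h.per 1
  ext1
  · rw [h1.1, e, ← h0.1]; rfl
  · rw [h1.2, e', ← h0.2]; rfl
  · simp

theorem it_inj (x : Flag P) {i j : ℕ} (hi : i < x.fc.card) (hj : j < x.fc.card)
    (h : (x.it i).vt = (x.it j).vt) : i = j := by
  obtain ⟨g, h1, h'⟩ := x.it_cyc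
  rw [(h' i).1, (h' j).1] at h
  exact h1.inj i hi j hj h

theorem eq_f {x y : Flag P} (h : y.fc = x.fc) :
    ∃ i < x.fc.card, y = x.it i ∨ y = (x.it i).s0 := by
  obtain ⟨g, h1, h'⟩ := x.it_cyc
  have := y.me
  rw [h, h1.mem] at this
  obtain ⟨i, hi, he⟩ := this
  refine ⟨i, hi, eq_ef ?_ (by simp [h])⟩
  rw [ed, he, ed, (h' i).1, (h' i).2]

/-- vertices of a face -/
theorem mem_f {x y : Flag P} (h : y.fc = x.fc) : ∃ i < x.fc.card, y.vt = (x.it i).vt := by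
  obtain ⟨g, h1, h'⟩ := x.it_cyc
  have := y.me
  rw [h] at this
  obtain ⟨i, hi, he⟩ := h1.mem_vert this
  exact ⟨i, hi, by rw [he, (h' i).1]⟩

attribute [irreducible] s0 s1 s2 rv rt nx it

end Flag
end FG

namespace FG
open Finset

variable {V : Type} [Fintype V] [DecidableEq V]
set_option linter.unusedSectionVars false
variable {P : PlaneGraph V}

namespace Flag

/-- one of the faces at the vertex of `x` belongs to `S` -/
def cov (S : Finset (Finset (Sym2 V))) (x : Flag P) : Prop :=
  x.fc ∈ S ∨ x.rt.fc ∈ S ∨ x.rt.rt.fc ∈ S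

theorem cov_rt (hP : IsFullerene P) (S) (x : Flag P) : cov S x.rt ↔ cov S x := by
  simp only [cov, rt3 hP]; tauto

theorem cov_v' (hP : IsFullerene P) (S) {x y : Flag P} (h : y.vt = x.vt) (hc : cov S y) :
    cov S x := by
  have h0 := fc_v hP h
  have h4 := fc_v hP (x := x) (y := y.rt) (by rw [vt_rt, h])
  have h5 := fc_v hP (x := x) (y := y.rt.rt) (by rw [vt_rt, vt_rt, h])
  unfold cov at *
  rcases hc with h | h | h
  · rcases h0 with e | e | e <;> rw [e] at h <;> simp [h]
  · rcases h4 with e | e | e <;> rw [e] at h <;> simp [h]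
  · rcases h5 with e | e | e <;> rw [e] at h <;> simp [h]

theorem cov_v (hP : IsFullerene P) (S) {x y : Flag P} (h : y.vt = x.vt) : cov S y ↔ cov S x :=
  ⟨cov_v' hP S h, cov_v' hP S h.symm⟩

theorem mem_sup {A : Finset (Finset (Sym2 V))} {e : Sym2 V} : e ∈ A.sup id ↔ ∃ f ∈ A, e ∈ f := by
  simp [Finset.mem_sup]

theorem ed_mem {A : Finset (Finset (Sym2 V))} (hA : A ⊆ P.faces) (x : Flag P) :
    x.ed ∈ A.sup id ↔ x.fc ∈ A ∨ x.rt.fc ∈ A := by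
  rw [mem_sup]
  constructor
  · rintro ⟨f, hf, he⟩
    rcases (x.s2_mem f).1 ⟨hA hf, he⟩ with rfl | rfl
    · exact Or.inl hf
    · rw [fc_s2] at hf; exact Or.inr hf
  · rintro (h | h)
    · exact ⟨_, h, x.me'⟩
    · refine ⟨_, h, ?_⟩
      have := x.s2.me'
      rwa [fc_s2, ed_s2] at this

theorem ed_at (hP : IsFullerene P) (x : Flag P) {e : Sym2 V} (he : e ∈ P.graph.edgeSet)
    (hv : x.vt ∈ e) : e = x.ed ∨ e = x.rt.ed ∨ e = x.rt.rt.ed := by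
  obtain ⟨w, rfl⟩ := Sym2.mem_iff_exists.1 hv
  obtain ⟨y, h1, h2⟩ := exists_flag P he
  have : s(x.vt, w) = y.ed := by rw [ed, h1, h2]
  rw [this]
  rcases eq_v hP h1 with h | h | h | h | h | h <;> rw [h] <;> simp

theorem edges_sub {A : Finset (Finset (Sym2 V))} (hA : A ⊆ P.faces) {e : Sym2 V}
    (he : e ∈ A.sup id) : e ∈ P.graph.edgeSet := by
  obtain ⟨f, hf, he⟩ := mem_sup.1 he
  exact P.face_edges f (hA hf) e he

theorem flag_of_face {f : Finset (Sym2 V)} (hf : f ∈ P.faces) {e : Sym2 V} (he : e ∈ f) {v : V} (hv : v ∈ e) :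
    ∃ x : Flag P, x.fc = f ∧ x.ed = e ∧ x.vt = v := by
  obtain ⟨w, rfl⟩ := Sym2.mem_iff_exists.1 hv
  exact ⟨⟨v, w, f, hf, he⟩, rfl, rfl, rfl⟩

theorem mem_ev {A : Finset (Finset (Sym2 V))} {v : V} :
    v ∈ edgeVerts (A.sup id) ↔ ∃ f ∈ A, ∃ e ∈ f, v ∈ e := by
  simp only [edgeVerts, mem_filter, mem_univ, true_and, mem_sup]
  constructor
  · rintro ⟨e, ⟨f, hf, he⟩, hv⟩; exact ⟨f, hf, e, he, hv⟩
  · rintro ⟨f, hf, e, he, hv⟩; exact ⟨e, ⟨f, hf, he⟩, hv⟩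

theorem vme (x : Flag P) : x.vt ∈ x.ed := Sym2.mem_mk_left _ _
theorem vme1 (x : Flag P) : x.vt ∈ x.rt.ed := by rw [← vt_rt]; exact vme _
theorem vme2 (x : Flag P) : x.vt ∈ x.rt.rt.ed := by rw [← vt_rt]; exact vme1 _

theorem vt_mem (hP : IsFullerene P) {A : Finset (Finset (Sym2 V))} (hA : A ⊆ P.faces) (x : Flag P) :
    x.vt ∈ edgeVerts (A.sup id) ↔ cov A x := by
  rw [mem_ev]
  constructor
  · rintro ⟨f, hf, e, he, hv⟩
    obtain ⟨y, rfl, -, hy⟩ := flag_of_face (hA hf) he hv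
    rw [← cov_v hP A hy]; exact Or.inl hf
  · rintro (h | h | h)
    · exact ⟨_, h, _, x.me', Sym2.mem_mk_left _ _⟩
    · exact ⟨_, h, _, x.rt.me', vme1 _⟩
    · exact ⟨_, h, _, x.rt.rt.me', vme2 _⟩

theorem ev_flag {A : Finset (Finset (Sym2 V))} (hA : A ⊆ P.faces) {v : V}
    (hv : v ∈ edgeVerts (A.sup id)) : ∃ x : Flag P, x.vt = v ∧ x.fc ∈ A := by
  obtain ⟨f, hf, e, he, hv⟩ := mem_ev.1 hv
  obtain ⟨y, rfl, -, hy⟩ := flag_of_face (hA hf) he hv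
  exact ⟨y, hy, hf⟩

theorem ed_ne (x : Flag P) : x.rt.ed ≠ x.ed := by
  intro h
  rcases Sym2.eq_iff.1 h with ⟨a, b⟩ | ⟨a, b⟩
  · exact x.rt_ne b
  · exact x.ne (by rw [← a, vt_rt])

theorem ed_ne2 (hP : IsFullerene P) (x : Flag P) : x.rt.rt.ed ≠ x.ed := by
  have := x.rt.rt.ed_ne
  rw [rt3 hP] at this; exact this.symm

theorem deg_filter (hP : IsFullerene P) {A : Finset (Finset (Sym2 V))} (hA : A ⊆ P.faces) (x : Flag P) :
    ((A.sup id).filter fun e => x.vt ∈ e) ⊆ {x.ed, x.rt.ed, x.rt.rt.ed} := by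
  intro e he
  rw [mem_filter] at he
  have := ed_at hP x (edges_sub hA he.1) he.2
  simpa using this

theorem card3 (hP : IsFullerene P) (x : Flag P) : ({x.ed, x.rt.ed, x.rt.rt.ed} : Finset (Sym2 V)).card = 3 := by
  rw [card_eq_three]
  exact ⟨_, _, _, x.ed_ne.symm, (ed_ne2 hP x).symm, x.rt.ed_ne.symm, rfl⟩

theorem deg3 (hP : IsFullerene P) {A : Finset (Finset (Sym2 V))} (hA : A ⊆ P.faces) (x : Flag P)
    (h1 : x.fc ∈ A) (h2 : x.rt.fc ∈ A) : deg (A.sup id) x.vt = 3 := by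
  rw [deg, ← card3 hP x]
  congr 1
  apply subset_antisymm (deg_filter hP hA x)
  intro e he
  rw [mem_filter]
  simp only [mem_insert, mem_singleton] at he
  rcases he with rfl | rfl | rfl
  · exact ⟨(ed_mem hA x).2 (Or.inl h1), Sym2.mem_mk_left _ _⟩
  · exact ⟨(ed_mem hA _).2 (Or.inl h2), vme1 _⟩
  · exact ⟨(ed_mem hA _).2 (Or.inr (by rwa [rt3 hP])), vme2 _⟩

theorem deg3' (hP : IsFullerene P) {A : Finset (Finset (Sym2 V))} (hA : A ⊆ P.faces) (x : Flag P)
    (h : deg (A.sup id) x.vt = 3) : x.rt.fc ∈ A ∨ x.rt.rt.fc ∈ A := by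
  have := eq_of_subset_of_card_le (deg_filter hP hA x) (by rw [card3 hP x]; exact h.ge)
  have h2 : x.rt.ed ∈ ((A.sup id).filter fun e => x.vt ∈ e) := by rw [this]; simp
  exact (ed_mem hA _).1 (mem_filter.1 h2).1

theorem rt_rt_eq (hP : IsFullerene P) (x : Flag P) : x.rt.rt = x.s1.s2 := by
  have := congrArg s1 (rt3 hP x)
  rw [rt_def x.rt.rt, s1_s1] at this
  rw [← this, s2_s2]

theorem s2_eq (x : Flag P) : x.s2 = x.rt.s1 := by simp [rt_def]

end Flag
open FG.Flag

/-- Local rules satisfied by an admissible sextet set and its matching. -/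
structure Rules (P : PlaneGraph V) (A H : Finset (Finset (Sym2 V))) (M : Finset (Sym2 V)) : Prop where
  pent : ∀ x : Flag P, x.fc ∈ A → x.fc.card = 5
  hex : ∀ x : Flag P, x.fc ∈ H → x.fc.card = 6
  dis : ∀ x : Flag P, x.fc ∈ H → x.rt.fc ∉ H
  mA : ∀ x : Flag P, x.ed ∈ M → x.fc ∈ A ∨ x.rt.fc ∈ A
  mh : ∀ x : Flag P, x.ed ∈ M → ¬ cov H x
  mM : ∀ x : Flag P, x.ed ∈ M → x.rt.ed ∉ M
  m3 : ∀ x : Flag P, x.fc ∈ A → x.rt.fc ∈ A → ¬ cov H x → x.ed ∈ M ∨ x.rt.ed ∈ M ∨ x.rt.rt.ed ∈ M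

/-- `x.vt` charges the face of `x` -/
def chg (A H : Finset (Finset (Sym2 V))) (M : Finset (Sym2 V)) (x : Flag P) : Prop :=
  x.fc ∈ A ∧ ¬ cov H x ∧ x.ed ∉ M ∧ x.rt.rt.ed ∉ M

theorem chg_s1 (hP : IsFullerene P) {A H M} (x : Flag P) (h : chg A H M x) : chg A H M x.s1 := by
  obtain ⟨h1, h2, h3, h4⟩ := h
  refine ⟨by rwa [fc_s1], by rwa [cov_v hP H (x := x) (y := x.s1) (vt_s1 x)], ?_, ?_⟩
  · rw [rt_rt_eq hP] at h4; simpa using h4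
  · rw [rt_rt_eq hP, s1_s1]; simpa using h3

theorem chg_vf (hP : IsFullerene P) {A H M} {x y : Flag P} (h : chg A H M y) (h1 : y.vt = x.vt)
    (h2 : y.fc = x.fc) : chg A H M x := by
  rcases eq_vf h1 h2 with rfl | h3
  · exact h
  · have := chg_s1 hP y h
    rwa [h3, s1_s1] at this

structure Tight (P : PlaneGraph V) (A H : Finset (Finset (Sym2 V))) (M : Finset (Sym2 V)) : Prop
    extends Rules P A H M where
  T1 : ∀ x y : Flag P, chg A H M x → chg A H M y → y.fc = x.fc → y.vt = x.vt
  T2 : ∀ x : Flag P, x.fc ∈ A → ¬ cov H x → chg A H M x ∨ chg A H M x.rt ∨ chg A H M x.rt.rt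

theorem rules_of (hP : IsFullerene P) {A H M} (hA : A ⊆ P.faces) (hA5 : ∀ f ∈ A, f.card = 5)
    (h1 : ∀ f ∈ H, f ∈ P.faces ∧ f.card = 6)
    (h2 : ∀ f ∈ H, ∀ g ∈ H, f ≠ g → Disjoint (edgeVerts f) (edgeVerts g))
    (m1 : M ⊆ A.sup id) (m2 : IsMatching M) (m3 : ∀ e ∈ M, ∀ v : V, v ∈ e → v ∉ facesVerts H)
    (m4 : ∀ v ∈ edgeVerts (A.sup id), deg (A.sup id) v = 3 → v ∉ facesVerts H → ∃ e ∈ M, v ∈ e) :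
    Rules P A H M := by
  have hH : H ⊆ P.faces := fun f hf => (h1 f hf).1
  refine ⟨fun x hx => hA5 _ hx, fun x hx => (h1 _ hx).2, ?_, ?_, ?_, ?_, ?_⟩
  · intro x hx hx'
    have := h2 _ hx _ hx' (fc_rt_ne x).symm
    rw [disjoint_left] at this
    apply this (a := x.vt)
    · simp only [edgeVerts, mem_filter, mem_univ, true_and]
      exact ⟨_, x.me', Sym2.mem_mk_left _ _⟩
    · simp only [edgeVerts, mem_filter, mem_univ, true_and]
      exact ⟨_, x.rt.me', vme1 _⟩
  · intro x hx
    exact (ed_mem hA x).1 (m1 hx)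
  · intro x hx hc
    exact m3 _ hx x.vt (Sym2.mem_mk_left _ _) ((vt_mem hP hH x).2 hc)
  · intro x hx hx'
    exact m2.2 _ hx _ hx' x.ed_ne.symm x.vt (vme _) (vme1 _)
  · intro x a1 a2 hc
    obtain ⟨e, he, hv⟩ := m4 x.vt ((vt_mem hP hA x).2 (Or.inl a1)) (deg3 hP hA x a1 a2)
      (fun h => hc ((vt_mem hP hH x).1 h))
    rcases ed_at hP x (edges_sub hA (m1 he)) hv with h | h | h <;> rw [h] at he <;> tauto

/-- The five-cycle facts around a pentagon of `A`. -/
theorem prev (hP : IsFullerene P) (x : Flag P) : x.nx.rt.rt = x.rv := by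
  rw [nx_eq, rt3 hP]

theorem it5 {x : Flag P} (h : x.fc.card = 5) : x.it 5 = x := by
  have := x.it_card; rwa [h] at this

end FG

namespace FG
open Finset
open FG.Flag
variable {V : Type} [Fintype V] [DecidableEq V]
set_option linter.unusedSectionVars false
variable {P : PlaneGraph V} {A H : Finset (Finset (Sym2 V))} {M : Finset (Sym2 V)}

theorem Rules.hA (R : Rules P A H M) {x : Flag P} (h : x.fc ∈ A) : x.fc ∉ H := by
  intro h'
  have := R.pent x h
  have := R.hex x h'
  omega

theorem covN (hP : IsFullerene P) (R : Rules P A H M) {x : Flag P} (h : x.fc ∈ A) :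
    cov H x.nx ↔ x.nx.rt.fc ∈ H ∨ x.rt.fc ∈ H := by
  rw [cov, prev hP, fc_nx, ← fc_rt]
  have := R.hA h
  tauto

theorem chgN (hP : IsFullerene P) (R : Rules P A H M) {x : Flag P} (h : x.fc ∈ A) :
    chg A H M x.nx ↔ ¬ x.nx.rt.fc ∈ H ∧ ¬ x.rt.fc ∈ H ∧ ¬ x.nx.ed ∈ M ∧ ¬ x.ed ∈ M := by
  rw [chg, covN hP R h, prev hP, fc_nx, ed_rv]
  tauto

theorem dis2 (hP : IsFullerene P) (R : Rules P A H M) {x : Flag P} (h : x.fc ∈ H) : ¬ x.rt.rt.fc ∈ H := by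
  intro h'
  have := R.dis _ h'
  rw [rt3 hP] at this
  exact this h

theorem mM2 (hP : IsFullerene P) (R : Rules P A H M) {x : Flag P} (h : x.ed ∈ M) : ¬ x.rt.rt.ed ∈ M := by
  intro h'
  have := R.mM _ h'
  rw [rt3 hP] at this
  exact this h

theorem disN (hP : IsFullerene P) (R : Rules P A H M) {x : Flag P} (h : x.nx.rt.fc ∈ H) : ¬ x.rt.fc ∈ H := by
  have := R.dis _ h
  rwa [prev hP, ← fc_rt] at this

theorem mMN (hP : IsFullerene P) (R : Rules P A H M) {x : Flag P} (h : x.nx.ed ∈ M) : ¬ x.ed ∈ M := by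
  have := mM2 hP R h
  rwa [prev hP, ed_rv] at this

theorem mhN1 (hP : IsFullerene P) (R : Rules P A H M) {x : Flag P} (h : x.nx.ed ∈ M) : ¬ x.rt.fc ∈ H := by
  have := R.mh _ h
  rw [cov, prev hP, ← fc_rt] at this
  tauto

theorem mh0 (R : Rules P A H M) {x : Flag P} (h : x.ed ∈ M) : ¬ x.rt.fc ∈ H := by
  have := R.mh _ h
  rw [cov] at this; tauto

theorem mh' (R : Rules P A H M) (hP : IsFullerene P) {x : Flag P} (h : x.ed ∈ M) : ¬ cov H x.nx := by
  have := R.mh x.rv (by rwa [ed_rv])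
  rwa [cov_v hP H (x := x.rv) (y := x.nx) (by simp)]

theorem mhN2 (hP : IsFullerene P) (R : Rules P A H M) {x : Flag P} (h : x.ed ∈ M) : ¬ x.nx.rt.fc ∈ H := by
  have := mh' R hP h
  rw [cov] at this; tauto

/-- The propositional data around a pentagon `x` of `A`. -/
theorem five (hP : IsFullerene P) (R : Rules P A H M) {x : Flag P} (hx : x.fc ∈ A) :
    ∃ x1 x2 x3 x4 : Flag P, x1 = x.nx ∧ x2 = x1.nx ∧ x3 = x2.nx ∧ x4 = x3.nx ∧ x = x4.nx ∧
      x1.fc = x.fc ∧ x2.fc = x.fc ∧ x3.fc = x.fc ∧ x4.fc = x.fc := by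
  refine ⟨x.nx, x.nx.nx, x.nx.nx.nx, x.nx.nx.nx.nx, rfl, rfl, rfl, rfl, ?_, ?_⟩
  · have := it5 (R.pent x hx)
    rw [it_succ, it_succ, it_succ, it_succ, it_succ, it_zero] at this
    exact this.symm
  · simp

theorem T0 (hP : IsFullerene P) (R : Rules P A H M) {x : Flag P} (hx : x.fc ∈ A) :
    chg A H M x ∨ chg A H M x.nx ∨ chg A H M x.nx.nx ∨ chg A H M x.nx.nx.nx ∨ chg A H M x.nx.nx.nx.nx := by
  obtain ⟨x1, x2, x3, x4, e1, e2, e3, e4, e0, f1, f2, f3, f4⟩ := five hP R hx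
  rw [← e1, ← e2, ← e3, ← e4]
  have c0 := chgN hP R (x := x4) (by rwa [f4])
  have c1 := chgN hP R (x := x) hx
  have c2 := chgN hP R (x := x1) (by rwa [f1])
  have c3 := chgN hP R (x := x2) (by rwa [f2])
  have c4 := chgN hP R (x := x3) (by rwa [f3])
  have d0 := disN hP R (x := x4)
  have d1 := disN hP R (x := x)
  have d2 := disN hP R (x := x1)
  have d3 := disN hP R (x := x2)
  have d4 := disN hP R (x := x3)
  have m0 := mMN hP R (x := x4)
  have m1 := mMN hP R (x := x)
  have m2 := mMN hP R (x := x1)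
  have m3 := mMN hP R (x := x2)
  have m4 := mMN hP R (x := x3)
  have p0 := mhN1 hP R (x := x4)
  have p1 := mhN1 hP R (x := x)
  have p2 := mhN1 hP R (x := x1)
  have p3 := mhN1 hP R (x := x2)
  have p4 := mhN1 hP R (x := x3)
  have q0 := mhN2 hP R (x := x4)
  have q1 := mhN2 hP R (x := x)
  have q2 := mhN2 hP R (x := x1)
  have q3 := mhN2 hP R (x := x2)
  have q4 := mhN2 hP R (x := x3)
  have r0 := mh0 R (x := x)
  have r1 := mh0 R (x := x1)
  have r2 := mh0 R (x := x2)
  have r3 := mh0 R (x := x3)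
  have r4 := mh0 R (x := x4)
  rw [← e1] at *; rw [← e2] at *; rw [← e3] at *; rw [← e4] at *; rw [← e0] at *
  clear e0 e1 e2 e3 e4 f1 f2 f3 f4
  grind

theorem chg_unique (hP : IsFullerene P) (R : Rules P A H M) {x y : Flag P}
    (hx : chg A H M x) (hy : chg A H M y) (h : y.vt = x.vt) : y.fc = x.fc := by
  obtain ⟨a1, a2, a3, a4⟩ := hx
  rcases fc_v hP h with e | e | e
  · exact e
  · exfalso
    obtain ⟨b1, b2, b3, b4⟩ := chg_vf hP hy (x := x.rt) (by simp [h]) e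
    rw [rt3 hP] at b4
    rcases R.m3 x a1 b1 a2 with h | h | h <;> tauto
  · exfalso
    obtain ⟨b1, b2, b3, b4⟩ := chg_vf hP hy (x := x.rt.rt) (by simp [h]) e
    rw [rt3 hP] at b4
    have := R.m3 x.rt.rt b1 (by rwa [rt3 hP]) b2
    rw [rt3 hP] at this
    rcases this with h | h | h <;> tauto

theorem charge (hP : IsFullerene P) (R : Rules P A H M) (hA : A ⊆ P.faces) (hH : H ⊆ P.faces) :
    A.card ≤ (Uset (A.sup id) H).card ∧ ((Uset (A.sup id) H).card = A.card → Tight P A H M) := by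
  have ex : ∀ f ∈ A, ∃ x : Flag P, x.fc = f ∧ chg A H M x := by
    intro f hf
    obtain ⟨n, g, h⟩ := face_cyc P (hA hf)
    obtain ⟨x, h1, -, -⟩ := flag_of_face (P := P) (hA hf) (h.edge 0) (Sym2.mem_mk_left _ _)
    rcases T0 hP R (x := x) (by rwa [h1]) with h | h | h | h | h <;> exact ⟨_, by simp [h1], h⟩
  have memU : ∀ x : Flag P, x.vt ∈ Uset (A.sup id) H ↔ cov A x ∧ ¬ cov H x := by
    intro x
    rw [Uset, mem_sdiff, vt_mem hP hA, facesVerts, vt_mem hP hH]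
  rcases isEmpty_or_nonempty (Flag P) with hF | hF
  · have hA0 : A = ∅ := by
      by_contra h
      obtain ⟨f, hf⟩ := nonempty_iff_ne_empty.2 h
      obtain ⟨x, -⟩ := ex f hf
      exact hF.elim x
    refine ⟨by simp [hA0], fun _ => ⟨R, fun x => hF.elim x, fun x => hF.elim x⟩⟩
  choose! φ h1 h2 using ex
  have hU : ∀ f ∈ A, (φ f).vt ∈ Uset (A.sup id) H := by
    intro f hf
    rw [memU]
    exact ⟨Or.inl (by rw [h1 f hf]; exact hf), (h2 f hf).2.1⟩
  have hinj : Set.InjOn (fun f => (φ f).vt) A := by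
    intro f hf g hg h
    rw [← h1 f hf, ← h1 g hg]
    exact (chg_unique hP R (h2 f hf) (h2 g hg) h.symm).symm
  have hcard : (A.image (fun f => (φ f).vt)).card = A.card := card_image_of_injOn hinj
  have hsub : A.image (fun f => (φ f).vt) ⊆ Uset (A.sup id) H := by
    intro v hv
    obtain ⟨f, hf, rfl⟩ := mem_image.1 hv
    exact hU f hf
  refine ⟨by rw [← hcard]; exact card_le_card hsub, fun he => ?_⟩
  have heq := eq_of_subset_of_card_le hsub (by rw [hcard, he])
  have key : ∀ x : Flag P, chg A H M x → x.vt = (φ x.fc).vt := by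
    intro x hx
    have : x.vt ∈ Uset (A.sup id) H := (memU x).2 ⟨Or.inl hx.1, hx.2.1⟩
    rw [← heq, mem_image] at this
    obtain ⟨f, hf, hv⟩ := this
    have := chg_unique hP R hx (h2 f hf) hv
    rw [h1 f hf] at this
    rw [← this]; exact hv.symm
  refine ⟨R, ?_, ?_⟩
  · intro x y hx hy h
    rw [key x hx, key y hy, h]
  · intro x hx hc
    have : x.vt ∈ Uset (A.sup id) H := (memU x).2 ⟨Or.inl hx, hc⟩
    rw [← heq, mem_image] at this
    obtain ⟨f, hf, hv⟩ := this
    rcases fc_v hP hv with e | e | e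
    · left; exact chg_vf hP (h2 f hf) hv e
    · right; left; exact chg_vf hP (h2 f hf) (by rw [hv, vt_rt]) e
    · right; right; exact chg_vf hP (h2 f hf) (by rw [hv, vt_rt, vt_rt]) e
end FG

namespace FG
open Finset
open FG.Flag
variable {V : Type} [Fintype V] [DecidableEq V]
set_option linter.unusedSectionVars false
set_option linter.unusedVariables false
variable {P : PlaneGraph V}

theorem Cyc.eq_of_sub {n m : ℕ} {g k : ℕ → V} {C f : Finset (Sym2 V)} (hC : Cyc n g C)
    (hf : Cyc m k f) (h : f ⊆ C) : f = C := by
  apply subset_antisymm h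
  obtain ⟨g, hC, h0, h1⟩ := hC.start (h (hf.edge 0))
  have key : ∀ i, s(g i, g (i + 1)) ∈ f := by
    intro i
    induction i with
    | zero => rw [h0, zero_add, h1]; exact hf.edge 0
    | succ i ih =>
      obtain ⟨k', hk, k0, k1⟩ := hf.start ih
      have h2 := h (hk.edge 1)
      rw [k1, hC.at] at h2
      rcases h2 with h2 | h2
      · exact absurd (k0.trans h2.symm) (hk.ne2 0)
      · have := hk.edge 1
        rw [k1, h2] at this
        exact this
  intro e he
  obtain ⟨i, -, rfl⟩ := (hC.mem e).1 he
  exact key i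

theorem conn (hP : IsFullerene P) (Q : V → Prop) (hQ : ∀ v w, P.graph.Adj v w → Q v → Q w)
    {v : V} (hv : Q v) (w : V) : Q w := by
  have hc := (hP.threeConnected ∅ (by simp)).preconnected ⟨v, by simp⟩ ⟨w, by simp⟩
  have hc2 := hc.map (SimpleGraph.Embedding.induce _).toHom
  obtain ⟨p⟩ := hc2
  change P.graph.Walk v w at p
  clear hc
  induction p with
  | nil => exact hv
  | cons h p ih => exact ih (hQ _ _ h hv)

theorem closed_all (hP : IsFullerene P) {S : Finset (Finset (Sym2 V))}
    (hS : ∀ x : Flag P, x.fc ∈ S → x.rt.fc ∈ S) {x : Flag P} (hx : x.fc ∈ S) (y : Flag P) :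
    y.fc ∈ S := by
  have key : ∀ z : Flag P, z.fc ∈ S → ∀ w : Flag P, w.vt = z.vt → w.fc ∈ S := by
    intro z hz w hw
    rcases fc_v hP hw with h | h | h <;> rw [h]
    · exact hz
    · exact hS _ hz
    · exact hS _ (hS _ hz)
  refine conn hP (fun v => ∀ z : Flag P, z.vt = v → z.fc ∈ S) ?_ (v := x.vt) (key x hx) y.vt y rfl
  intro v w h hv z hz
  obtain ⟨a, rfl, rfl⟩ := exists_flag P h
  have h1 : a.rv.fc ∈ S := by rw [← fc_rt]; exact hS _ (hv a rfl)
  exact key a.rv h1 z (by rw [hz, vt_rv])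

theorem exists_flag_face {f : Finset (Sym2 V)} (hf : f ∈ P.faces) : ∃ x : Flag P, x.fc = f := by
  obtain ⟨n, g, h⟩ := face_cyc P hf
  obtain ⟨x, h1, -, -⟩ := flag_of_face (P := P) hf (h.edge 0) (Sym2.mem_mk_left _ _)
  exact ⟨x, h1⟩

theorem faces_card (hP : IsFullerene P) : 2 * P.faces.card = Fintype.card V + 4 := by
  have h1 := P.euler
  have h2 : ∑ f ∈ P.faces, f.card + 12 = 6 * P.faces.card := by
    have : ∀ f ∈ P.faces, f.card + (if f.card = 5 then 1 else 0) = 6 := by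
      intro f hf
      rcases hP.faceSize f hf with h | h <;> simp [h]
    have h3 := sum_congr rfl this
    rw [sum_add_distrib, ← card_filter, hP.pentTwelve] at h3
    simp at h3
    omega
  omega

theorem bd_mem (S : Finset (Finset (Sym2 V))) (hS : S ⊆ P.faces) (x : Flag P) :
    x.ed ∈ (S.sup id).filter (fun e => (S.filter fun f => e ∈ f).card = 1) ↔
      (x.fc ∈ S ∧ x.rt.fc ∉ S ∨ x.fc ∉ S ∧ x.rt.fc ∈ S) := by
  rw [mem_filter, ed_mem hS]
  have key : S.filter (fun f => x.ed ∈ f) = ({x.fc, x.rt.fc} : Finset _).filter (fun f => f ∈ S) := by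
    ext f
    simp only [mem_filter, mem_insert, mem_singleton]
    have := x.s2_mem f
    rw [fc_s2] at this
    constructor
    · rintro ⟨a, b⟩; exact ⟨this.1 ⟨hS a, b⟩, a⟩
    · rintro ⟨a, b⟩; exact ⟨b, (this.2 a).2⟩
  rw [key, filter_insert, filter_singleton]
  have := fc_rt_ne x
  by_cases h1 : x.fc ∈ S <;> by_cases h2 : x.rt.fc ∈ S <;> simp [h1, h2, this.symm]

theorem hole (hP : IsFullerene P) (hn : 60 ≤ Fintype.card V) (B : Fragment P)
    (hB : IsPentagonalFragment B) {f} (hf : f ∈ P.faces) (hfB : f ⊆ B.edges) : f ∈ B.inFaces := by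
  by_contra hno
  obtain ⟨v, c, hc, hce⟩ := B.boundary_cycle
  obtain ⟨n, g, hC⟩ := Cyc.ofWalk hc
  rw [hce] at hC
  obtain ⟨m, k, hF⟩ := face_cyc P hf
  have hsub : f ⊆ (B.inFaces.sup id).filter (fun e => (B.inFaces.filter fun f => e ∈ f).card = 1) := by
    intro e he
    obtain ⟨x, rfl, rfl, -⟩ := flag_of_face hf he (Sym2.out_fst_mem e)
    rw [bd_mem _ B.subFaces]
    have := (ed_mem B.subFaces x).1 (hfB he)
    tauto
  have heq := hC.eq_of_sub hF hsub
  obtain ⟨b, hb⟩ := B.nonempty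
  obtain ⟨x0, hx0⟩ := exists_flag_face (B.subFaces hb)
  have hall := closed_all hP (S := insert f B.inFaces) (fun x hx => by
    by_contra h
    rw [mem_insert] at h hx
    push Not at h
    have h2 := bd_mem B.inFaces B.subFaces x
    rw [← heq] at h2
    have hxf : x.ed ∈ f := by
      rcases hx with hx | hx
      · rw [← hx]; exact x.me'
      · exact h2.2 (Or.inl ⟨hx, h.2⟩)
    have h3 := (x.s2_mem f).1 ⟨hf, hxf⟩
    rw [fc_s2] at h3
    rcases h3 with h3 | h3
    · rw [h3] at hno
      rcases h2.1 hxf with h4 | h4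
      · exact hno h4.1
      · exact h.2 h4.2
    · exact h.1 h3.symm) (x := x0) (by rw [mem_insert, hx0]; exact Or.inr hb)
  have h1 : P.faces ⊆ insert f B.inFaces := by
    intro q hq
    obtain ⟨y, rfl⟩ := exists_flag_face hq
    exact hall y
  have h2 : B.inFaces ⊆ P.faces.filter fun f => f.card = 5 := by
    intro q hq
    rw [mem_filter]; exact ⟨B.subFaces hq, hB q hq⟩
  have h3 := card_le_card h1
  have h4 := card_le_card h2
  rw [hP.pentTwelve] at h4
  have h5 := card_insert_le f B.inFaces
  have h6 := faces_card hP
  omega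

theorem pentFaces_eq (hP : IsFullerene P) (hn : 60 ≤ Fintype.card V) (B : Fragment P)
    (hB : IsPentagonalFragment B) : pentFaces P B.edges = B.inFaces := by
  ext f
  rw [pentFaces, mem_filter]
  constructor
  · rintro ⟨h1, -, h3⟩; exact hole hP hn B hB h1 h3
  · intro h
    exact ⟨B.subFaces h, hB f h, fun e he => Flag.mem_sup.2 ⟨f, h, he⟩⟩

/-- admissible data as rules -/
theorem rules_of_adm (hP : IsFullerene P) {S H : Finset (Finset (Sym2 V))} (hS : S ⊆ P.faces)
    (h5 : ∀ f ∈ S, f.card = 5) (h : SextetAdm P (S.sup id) H) :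
    H ⊆ P.faces ∧ ∃ M, M ⊆ S.sup id ∧ IsMatching M ∧ Rules P S H M := by
  obtain ⟨h1, h2, M, m1, m2, m3, m4⟩ := h
  exact ⟨fun f hf => (h1 f hf).1, M, m1, m2, rules_of hP hS h5 (fun f hf => ⟨(h1 f hf).1, (h1 f hf).2.1⟩) h2 m1 m2 m3 m4⟩

/-- the extremal property -/
def Ext (P : PlaneGraph V) (S : Finset (Finset (Sym2 V))) : Prop :=
  ∃ H, SextetAdm P (S.sup id) H ∧ (Uset (S.sup id) H).card ≤ S.card

theorem adm_card (hP : IsFullerene P) {S H : Finset (Finset (Sym2 V))} (hS : S ⊆ P.faces)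
    (h5 : ∀ f ∈ S, f.card = 5) (h : SextetAdm P (S.sup id) H) : S.card ≤ (Uset (S.sup id) H).card := by
  obtain ⟨h1, M, -, -, h2⟩ := rules_of_adm hP hS h5 h
  exact (charge hP h2 hS h1).1

theorem clar_of (hP : IsFullerene P) {S H : Finset (Finset (Sym2 V))} (hS : S ⊆ P.faces)
    (h5 : ∀ f ∈ S, f.card = 5) (h : SextetAdm P (S.sup id) H)
    (hU : (Uset (S.sup id) H).card ≤ S.card) : IsClarSet P (S.sup id) H :=
  ⟨h, fun H' h' => hU.trans (adm_card hP hS h5 h')⟩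

theorem clar_tight (hP : IsFullerene P) {S H : Finset (Finset (Sym2 V))} (hS : S ⊆ P.faces)
    (h5 : ∀ f ∈ S, f.card = 5) (hE : Ext P S) (h : IsClarSet P (S.sup id) H) :
    (Uset (S.sup id) H).card = S.card ∧ H ⊆ P.faces ∧ ∃ M, M ⊆ S.sup id ∧ IsMatching M ∧ Tight P S H M := by
  obtain ⟨H', h1, h2⟩ := hE
  have h3 := (h.2 H' h1).trans h2
  have h4 := le_antisymm h3 (adm_card hP hS h5 h.1)
  obtain ⟨h6, M, m1, m2, h7⟩ := rules_of_adm hP hS h5 h.1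
  exact ⟨h4, h6, M, m1, m2, (charge hP h7 hS h6).2 h4⟩

/-- `A` with a pasting edge `e`. -/
structure PE (P : PlaneGraph V) (S H : Finset (Finset (Sym2 V))) (M : Finset (Sym2 V)) (e : Sym2 V) : Prop where
  T : Tight P S H M
  c : ∀ x : Flag P, x.vt ∈ e → cov H x
  n : ∀ f ∈ H, e ∉ f

theorem PE_of (hP : IsFullerene P) {S : Finset (Finset (Sym2 V))} (hS : S ⊆ P.faces)
    (h5 : ∀ f ∈ S, f.card = 5) (hE : Ext P S) {e : Sym2 V} (h : IsPastingEdge P (S.sup id) e) :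
    ∃ H M, PE P S H M e := by
  obtain ⟨he, H, h1, h2, h3⟩ := h
  obtain ⟨h4, h5, M, -, -, h6⟩ := clar_tight hP hS h5 hE h1
  refine ⟨H, M, h6, fun x hx => ?_, fun f hf hef => h3 (Flag.mem_sup.2 ⟨f, hf, hef⟩)⟩
  have := h2 _ hx
  rwa [facesVerts, vt_mem hP h5] at this

end FG

namespace FG
open Finset
open FG.Flag
variable {V : Type} [Fintype V] [DecidableEq V]
set_option linter.unusedSectionVars false
set_option linter.unusedVariables false
variable {P : PlaneGraph V}

theorem five' {x : Flag P} (h : x.fc.card = 5) : x.nx.nx.nx.nx.nx = x := by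
  have := it5 h
  rwa [it_succ, it_succ, it_succ, it_succ, it_succ, it_zero] at this

/-- vertices of a pentagon -/
theorem vert5 {x y : Flag P} (h : x.fc.card = 5) (hy : y.fc = x.fc) :
    y.vt = x.vt ∨ y.vt = x.nx.vt ∨ y.vt = x.nx.nx.vt ∨ y.vt = x.nx.nx.nx.vt ∨ y.vt = x.nx.nx.nx.nx.vt := by
  obtain ⟨i, hi, hv⟩ := mem_f hy
  rw [h] at hi
  interval_cases i <;> simp only [it_succ, it_zero] at hv <;> tauto

/-- edges of a pentagon -/
theorem edge5 {x : Flag P} (h : x.fc.card = 5) {e : Sym2 V} (he : e ∈ x.fc) :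
    e = x.ed ∨ e = x.nx.ed ∨ e = x.nx.nx.ed ∨ e = x.nx.nx.nx.ed ∨ e = x.nx.nx.nx.nx.ed := by
  obtain ⟨y, h1, rfl, -⟩ := flag_of_face x.mf he (Sym2.out_fst_mem e)
  obtain ⟨i, hi, hv⟩ := eq_f h1
  rw [h] at hi
  have : y.ed = (x.it i).ed := by
    rcases hv with rfl | rfl
    · rfl
    · rw [ed_s0]
  rw [this]
  interval_cases i <;> simp [it_succ, it_zero]

/-- the faces at the ends of a pasting edge -/
theorem third (hP : IsFullerene P) {H : Finset (Finset (Sym2 V))} {x : Flag P}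
    (hc : cov H x) (hc' : cov H x.nx) (hn : ∀ f ∈ H, x.ed ∉ f) : x.rt.rt.fc ∈ H ∧ x.nx.rt.fc ∈ H := by
  have h1 : x.fc ∉ H := fun h => hn _ h x.me'
  have h2 : x.rt.fc ∉ H := fun h => hn _ h (by have := x.s2.me'; rwa [fc_s2, ed_s2] at this)
  refine ⟨by unfold cov at hc; tauto, ?_⟩
  rw [cov, prev hP, fc_nx, ← fc_rt] at hc'
  tauto

theorem paste_adm (hP : IsFullerene P) {S H : Finset (Finset (Sym2 V))} (hS : S ⊆ P.faces)
    {x : Flag P} (hx5 : x.fc.card = 5) (hx : x.fc ∉ S) (hxS : x.rt.fc ∈ S)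
    (hone : ∀ y : Flag P, y.fc = x.fc → y.ed ∈ S.sup id → y.ed = x.ed)
    (hA : SextetAdm P (S.sup id) H)
    (hc : cov H x) (hc' : cov H x.nx) (hn : ∀ f ∈ H, x.ed ∉ f) :
    SextetAdm P ((insert x.fc S).sup id) H ∧
      (Uset ((insert x.fc S).sup id) H).card ≤ (Uset (S.sup id) H).card + 1 := by
  obtain ⟨t1, t2⟩ := third hP hc hc' hn
  have hH : H ⊆ P.faces := fun f hf => (hA.1 f hf).1
  have hI : insert x.fc S ⊆ P.faces := by
    intro f hf
    rcases mem_insert.1 hf with rfl | hf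
    · exact x.mf
    · exact hS hf
  have hsub : S.sup id ⊆ (insert x.fc S).sup id := Finset.sup_mono (subset_insert _ _)
  have hq : ∀ y : Flag P, y.fc = x.fc → y.rt.fc ∈ S → y.ed = x.ed := fun y h1 h2 =>
    hone y h1 ((ed_mem hS _).2 (Or.inr h2))
  have hq2 : ∀ y : Flag P, y.rt.fc = x.fc → y.fc ∈ S → y.ed = x.ed := fun y h1 h2 => by
    have := hone y.rv (by rw [← fc_rt, h1]) (by rw [ed_rv]; exact (ed_mem hS _).2 (Or.inl h2))
    rwa [ed_rv] at this
  have hend : ∀ y : Flag P, x.ed = y.ed → cov H y := by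
    intro y hy
    have : y.vt ∈ x.ed := by rw [hy]; exact vme y
    rcases Sym2.mem_iff.1 this with h | h
    · rwa [cov_v hP H h]
    · rwa [cov_v hP H (x := x.nx) (by rw [h, vt_nx])]
  constructor
  · obtain ⟨h1, h2, M, m1, m2, m3, m4⟩ := hA
    refine ⟨fun f hf => ⟨(h1 f hf).1, (h1 f hf).2.1, (h1 f hf).2.2.mono (inter_subset_inter_left hsub)⟩,
      h2, M, m1.trans hsub, m2, m3, ?_⟩
    intro v hv hd hvH
    have inS : ∀ y : Flag P, y.vt = v → y.fc ∈ S → ∃ e ∈ M, v ∈ e := by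
      rintro y rfl hy
      apply m4 _ ((vt_mem hP hS _).2 (Or.inl hy)) ?_ hvH
      rcases deg3' hP hI y hd with h | h
      · rcases mem_insert.1 h with h | h
        · exact absurd ((vt_mem hP hH _).2 (hend y (hq2 y h hy).symm)) hvH
        · exact deg3 hP hS y hy h
      · rcases mem_insert.1 h with h | h
        · have := hq y.rt.rt h (by rwa [rt3 hP])
          have := hend y.rt.rt this.symm
          rw [cov_rt hP, cov_rt hP] at this
          exact absurd ((vt_mem hP hH _).2 this) hvH
        · have := deg3 hP hS y.rt.rt h (by rwa [rt3 hP])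
          simpa using this
    obtain ⟨y, rfl, hy⟩ := ev_flag hI hv
    rcases mem_insert.1 hy with h | h
    · rcases deg3' hP hI y hd with h3 | h3
      · rcases mem_insert.1 h3 with h4 | h4
        · exact absurd (h4.trans h.symm) (fc_rt_ne y)
        · exact inS y.rt (by simp) h4
      · rcases mem_insert.1 h3 with h4 | h4
        · exact absurd (h4.trans h.symm) (fc_rt2_ne hP y)
        · exact inS y.rt.rt (by simp) h4
    · exact inS y rfl h
  · have : Uset ((insert x.fc S).sup id) H ⊆ insert x.nx.nx.nx.vt (Uset (S.sup id) H) := by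
      intro v hv
      rw [Uset, mem_sdiff] at hv
      obtain ⟨hv, hvH⟩ := hv
      obtain ⟨y, rfl, hy⟩ := ev_flag hI hv
      rw [facesVerts, vt_mem hP hH] at hvH
      rw [mem_insert]
      rcases mem_insert.1 hy with h | h
      · rcases vert5 hx5 h with h | h | h | h | h
        · rw [cov_v hP H h] at hvH; exact absurd hc hvH
        · rw [cov_v hP H h] at hvH; exact absurd hc' hvH
        · rw [cov_v hP H h] at hvH
          exfalso; apply hvH
          rw [cov, prev hP, ← fc_rt]; exact Or.inr (Or.inr t2)
        · left; exact h
        · rw [cov_v hP H h] at hvH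
          exfalso; apply hvH
          have := prev hP x.nx.nx.nx.nx
          rw [five' hx5] at this
          rw [this] at t1
          rw [cov, fc_rt]; exact Or.inr (Or.inl t1)
      · right
        rw [Uset, mem_sdiff, vt_mem hP hS, facesVerts, vt_mem hP hH]
        exact ⟨Or.inl h, hvH⟩
    exact (card_le_card this).trans (card_insert_le _ _)

theorem pent_ext (hP : IsFullerene P) {x : Flag P} (hx5 : x.fc.card = 5) {H : Finset (Finset (Sym2 V))}
    (hA : SextetAdm P (({x.fc} : Finset _).sup id) H)
    (hc : cov H x) (hc' : cov H x.nx) (hn : ∀ f ∈ H, x.ed ∉ f) :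
      (Uset (({x.fc} : Finset _).sup id) H).card ≤ 1 := by
  obtain ⟨t1, t2⟩ := third hP hc hc' hn
  have hH : H ⊆ P.faces := fun f hf => (hA.1 f hf).1
  have hI : {x.fc} ⊆ P.faces := by
    intro f hf
    rw [mem_singleton.1 hf]; exact x.mf
  have : Uset (({x.fc} : Finset _).sup id) H ⊆ {x.nx.nx.nx.vt} := by
    intro v hv
    rw [Uset, mem_sdiff] at hv
    obtain ⟨hv, hvH⟩ := hv
    obtain ⟨y, rfl, hy⟩ := ev_flag hI hv
    rw [facesVerts, vt_mem hP hH] at hvH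
    rw [mem_singleton]
    have h := mem_singleton.1 hy
    rcases vert5 hx5 h with h | h | h | h | h
    · rw [cov_v hP H h] at hvH; exact absurd hc hvH
    · rw [cov_v hP H h] at hvH; exact absurd hc' hvH
    · rw [cov_v hP H h] at hvH
      exfalso; apply hvH
      rw [cov, prev hP, ← fc_rt]; exact Or.inr (Or.inr t2)
    · exact h
    · rw [cov_v hP H h] at hvH
      exfalso; apply hvH
      have := prev hP x.nx.nx.nx.nx
      rw [five' hx5] at this
      rw [this] at t1
      rw [cov, fc_rt]; exact Or.inr (Or.inl t1)
  exact (card_le_card this).trans (by simp)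

end FG

namespace FG
open Finset
open FG.Flag
variable {V : Type} [Fintype V] [DecidableEq V]
set_option linter.unusedSectionVars false
set_option linter.unusedVariables false
variable {P : PlaneGraph V} {A H : Finset (Finset (Sym2 V))} {M : Finset (Sym2 V)}

/-- Rules at a vertex of a pentagon of `A`; `ai`, `aj` are the other two faces, `mi`, `mj` the edges
of the pentagon, and `o` the outer edge. -/
structure VR (ai aj hi hj mi mj o : Prop) : Prop where
  r1 : hi → ¬ hj
  r2 : ai → ¬ hi
  r3 : mi → ¬ mj
  r4 : mi → ¬ o
  r5 : o → ¬ mj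
  r6 : mi → ¬ hi
  r7 : mi → ¬ hj
  r8 : mj → ¬ hi
  r9 : mj → ¬ hj
  r10 : o → ¬ hi
  r11 : o → ¬ hj
  r12 : ai ∨ aj → ¬ hi → ¬ hj → mi ∨ o ∨ mj
  r13 : o → ai ∨ aj
  r14 : ¬ hi → ¬ hj → (¬ mi ∧ ¬ mj) ∨ (ai ∧ ¬ mi ∧ ¬ o) ∨ (aj ∧ ¬ o ∧ ¬ mj)

theorem vr (hP : IsFullerene P) (T : Tight P A H M) {x : Flag P} (hx : x.fc ∈ A) :
    VR (x.nx.rt.fc ∈ A) (x.rt.fc ∈ A) (x.nx.rt.fc ∈ H) (x.rt.fc ∈ H) (x.nx.ed ∈ M) (x.ed ∈ M) (x.nx.rt.ed ∈ M) := by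
  have R := T.toRules
  have e1 := prev hP x
  have e2 : x.nx.rt.rt.ed = x.ed := by rw [e1, ed_rv]
  have e3 : x.nx.rt.rt.fc = x.rt.fc := by rw [e1, fc_rt]
  have hx' : x.nx.fc ∈ A := by rwa [fc_nx]
  have hh : x.nx.fc ∉ H := R.hA hx'
  constructor
  · intro h; exact disN hP R h
  · intro h; exact R.hA h
  · intro h; exact mMN hP R h
  · intro h; exact R.mM _ h
  · intro h h'
    exact R.mM _ h (by rwa [e2])
  · intro h; exact mh0 R h
  · intro h; exact mhN1 hP R h
  · intro h; exact mhN2 hP R h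
  · intro h; exact mh0 R h
  · intro h h'
    have := R.mh _ h
    rw [cov_rt hP, cov] at this; tauto
  · intro h h'
    have := R.mh _ h
    rw [cov_rt hP, cov, e3] at this; tauto
  · intro h h1 h2
    have hc : ¬ cov H x.nx := by rw [cov, e3]; tauto
    rw [← e2, ← e3] at *
    rcases h with h | h
    · exact R.m3 _ hx' h hc
    · have := R.m3 x.nx.rt.rt h (by rwa [rt3 hP]) (by rwa [cov_rt hP, cov_rt hP])
      rw [rt3 hP] at this; tauto
  · intro h
    have := R.mA _ h
    rwa [e3] at this
  · intro h1 h2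
    have hc : ¬ cov H x.nx := by rw [cov, e3]; tauto
    rcases T.T2 _ hx' hc with h | h | h
    · obtain ⟨a, b, c, d⟩ := h; rw [e2] at d; tauto
    · obtain ⟨a, b, c, d⟩ := h; rw [rt3 hP] at d; tauto
    · obtain ⟨a, b, c, d⟩ := h; rw [rt3 hP] at d; rw [e2] at c; rw [e3] at a; tauto

/-- charging rule for the pentagon -/
theorem cp (hP : IsFullerene P) (T : Tight P A H M) {x y : Flag P} (hx : x.fc ∈ A) (hxy : y.fc = x.fc)
    (hv : y.nx.vt ≠ x.nx.vt)
    (h1 : x.nx.rt.fc ∉ H) (h2 : x.rt.fc ∉ H) (h3 : x.nx.ed ∉ M) (h4 : x.ed ∉ M)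
    (h5 : y.nx.rt.fc ∉ H) (h6 : y.rt.fc ∉ H) (h7 : y.nx.ed ∉ M) (h8 : y.ed ∉ M) : False := by
  apply hv
  apply T.T1 x.nx y.nx
  · rw [chgN hP T.toRules hx]; tauto
  · rw [chgN hP T.toRules (by rwa [hxy])]; tauto
  · simpa using hxy

/-- charging rule for a neighbouring face `q` of `x.nx` -/
theorem cq (hP : IsFullerene P) (T : Tight P A H M) {x : Flag P} (hx : x.fc ∈ A) (hq : x.nx.rt.fc ∈ A)
    (h1 : x.rt.fc ∉ H) (h2 : x.nx.rt.fc ∉ H) (h3 : x.nx.nx.rt.fc ∉ H)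
    (h4 : x.nx.ed ∉ M) (h5 : x.nx.rt.ed ∉ M) (h6 : x.nx.nx.rt.ed ∉ M) : False := by
  have R := T.toRules
  have hx' : x.nx.fc ∈ A := by rwa [fc_nx]
  have hh := R.hA hx'
  have e1 := prev hP x
  have e1' := prev hP x.nx
  have := T.T1 x.nx.rt x.nx.rv ?_ ?_ (by rw [fc_rt])
  · rw [vt_rt, vt_rv] at this; exact x.nx.ne this.symm
  · refine ⟨hq, ?_, h5, by rwa [rt3 hP]⟩
    rw [cov_rt hP, cov, e1, ← fc_rt]; tauto
  · refine ⟨by rwa [← fc_rt], ?_, by rwa [ed_rv], ?_⟩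
    · rw [← e1', cov_rt hP, cov_rt hP, cov, e1', ← fc_rt, fc_nx]; tauto
    · rw [← nx_eq]; exact h6

theorem PLne {x : Flag P} (h : x.fc.card = 5) : x.vt ≠ x.nx.vt ∧ x.vt ≠ x.nx.nx.vt ∧ x.vt ≠ x.nx.nx.nx.vt
    ∧ x.vt ≠ x.nx.nx.nx.nx.vt := by
  have key : ∀ j, j ≠ 0 → j < 5 → x.vt ≠ (x.it j).vt := by
    intro j hj hj5 hh
    exact hj (x.it_inj (i := 0) (j := j) (by omega) (by omega) (by rwa [it_zero])).symm
  have k1 := key 1 (by omega) (by omega)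
  have k2 := key 2 (by omega) (by omega)
  have k3 := key 3 (by omega) (by omega)
  have k4 := key 4 (by omega) (by omega)
  simp only [it_succ, it_zero] at k1 k2 k3 k4
  exact ⟨k1, k2, k3, k4⟩

/-- all the rules around a pentagon -/
structure PLS (A H : Finset (Finset (Sym2 V))) (M : Finset (Sym2 V)) (x0 x1 x2 x3 x4 : Flag P) : Prop where
  v0 : VR (x0.rt.fc ∈ A) (x4.rt.fc ∈ A) (x0.rt.fc ∈ H) (x4.rt.fc ∈ H) (x0.ed ∈ M) (x4.ed ∈ M) (x0.rt.ed ∈ M)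
  v1 : VR (x1.rt.fc ∈ A) (x0.rt.fc ∈ A) (x1.rt.fc ∈ H) (x0.rt.fc ∈ H) (x1.ed ∈ M) (x0.ed ∈ M) (x1.rt.ed ∈ M)
  v2 : VR (x2.rt.fc ∈ A) (x1.rt.fc ∈ A) (x2.rt.fc ∈ H) (x1.rt.fc ∈ H) (x2.ed ∈ M) (x1.ed ∈ M) (x2.rt.ed ∈ M)
  v3 : VR (x3.rt.fc ∈ A) (x2.rt.fc ∈ A) (x3.rt.fc ∈ H) (x2.rt.fc ∈ H) (x3.ed ∈ M) (x2.ed ∈ M) (x3.rt.ed ∈ M)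
  v4 : VR (x4.rt.fc ∈ A) (x3.rt.fc ∈ A) (x4.rt.fc ∈ H) (x3.rt.fc ∈ H) (x4.ed ∈ M) (x3.ed ∈ M) (x4.rt.ed ∈ M)
  q0 : x0.rt.fc ∈ A → x4.rt.fc ∉ H → x0.rt.fc ∉ H → x1.rt.fc ∉ H → x0.ed ∉ M → x0.rt.ed ∉ M → x1.rt.ed ∉ M → False
  q1 : x1.rt.fc ∈ A → x0.rt.fc ∉ H → x1.rt.fc ∉ H → x2.rt.fc ∉ H → x1.ed ∉ M → x1.rt.ed ∉ M → x2.rt.ed ∉ M → False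
  q2 : x2.rt.fc ∈ A → x1.rt.fc ∉ H → x2.rt.fc ∉ H → x3.rt.fc ∉ H → x2.ed ∉ M → x2.rt.ed ∉ M → x3.rt.ed ∉ M → False
  q3 : x3.rt.fc ∈ A → x2.rt.fc ∉ H → x3.rt.fc ∉ H → x4.rt.fc ∉ H → x3.ed ∉ M → x3.rt.ed ∉ M → x4.rt.ed ∉ M → False
  q4 : x4.rt.fc ∈ A → x3.rt.fc ∉ H → x4.rt.fc ∉ H → x0.rt.fc ∉ H → x4.ed ∉ M → x4.rt.ed ∉ M → x0.rt.ed ∉ M → False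
  p01 : x0.rt.fc ∉ H → x4.rt.fc ∉ H → x0.ed ∉ M → x4.ed ∉ M → x1.rt.fc ∉ H → x0.rt.fc ∉ H → x1.ed ∉ M → x0.ed ∉ M → False
  p02 : x0.rt.fc ∉ H → x4.rt.fc ∉ H → x0.ed ∉ M → x4.ed ∉ M → x2.rt.fc ∉ H → x1.rt.fc ∉ H → x2.ed ∉ M → x1.ed ∉ M → False
  p03 : x0.rt.fc ∉ H → x4.rt.fc ∉ H → x0.ed ∉ M → x4.ed ∉ M → x3.rt.fc ∉ H → x2.rt.fc ∉ H → x3.ed ∉ M → x2.ed ∉ M → False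
  p04 : x0.rt.fc ∉ H → x4.rt.fc ∉ H → x0.ed ∉ M → x4.ed ∉ M → x4.rt.fc ∉ H → x3.rt.fc ∉ H → x4.ed ∉ M → x3.ed ∉ M → False
  p12 : x1.rt.fc ∉ H → x0.rt.fc ∉ H → x1.ed ∉ M → x0.ed ∉ M → x2.rt.fc ∉ H → x1.rt.fc ∉ H → x2.ed ∉ M → x1.ed ∉ M → False
  p13 : x1.rt.fc ∉ H → x0.rt.fc ∉ H → x1.ed ∉ M → x0.ed ∉ M → x3.rt.fc ∉ H → x2.rt.fc ∉ H → x3.ed ∉ M → x2.ed ∉ M → False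
  p14 : x1.rt.fc ∉ H → x0.rt.fc ∉ H → x1.ed ∉ M → x0.ed ∉ M → x4.rt.fc ∉ H → x3.rt.fc ∉ H → x4.ed ∉ M → x3.ed ∉ M → False
  p23 : x2.rt.fc ∉ H → x1.rt.fc ∉ H → x2.ed ∉ M → x1.ed ∉ M → x3.rt.fc ∉ H → x2.rt.fc ∉ H → x3.ed ∉ M → x2.ed ∉ M → False
  p24 : x2.rt.fc ∉ H → x1.rt.fc ∉ H → x2.ed ∉ M → x1.ed ∉ M → x4.rt.fc ∉ H → x3.rt.fc ∉ H → x4.ed ∉ M → x3.ed ∉ M → False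
  p34 : x3.rt.fc ∉ H → x2.rt.fc ∉ H → x3.ed ∉ M → x2.ed ∉ M → x4.rt.fc ∉ H → x3.rt.fc ∉ H → x4.ed ∉ M → x3.ed ∉ M → False

theorem PL (hP : IsFullerene P) (T : Tight P A H M) {x : Flag P} (hx : x.fc ∈ A) :
    PLS A H M x x.nx x.nx.nx x.nx.nx.nx x.nx.nx.nx.nx := by
  have h5 := T.pent x hx
  have e := five' h5
  set x1 := x.nx with e1
  set x2 := x1.nx with e2
  set x3 := x2.nx with e3
  set x4 := x3.nx with e4
  have f1 : x1.fc = x.fc := by simp [e1]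
  have f2 : x2.fc = x.fc := by simp [e1, e2]
  have f3 : x3.fc = x.fc := by simp [e1, e2, e3]
  have f4 : x4.fc = x.fc := by simp [e1, e2, e3, e4]
  obtain ⟨n1, n2, n3, n4⟩ := PLne h5
  rw [← e1] at n1 n2 n3 n4
  rw [← e2] at n2 n3 n4
  rw [← e3] at n3 n4
  rw [← e4] at n4
  obtain ⟨n5, n6, n7, -⟩ := PLne (x := x1) (by rwa [f1])
  rw [← e2] at n5 n6 n7
  rw [← e3] at n6 n7
  rw [← e4] at n7
  obtain ⟨n8, n9, -, -⟩ := PLne (x := x2) (by rwa [f2])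
  rw [← e3] at n8 n9
  rw [← e4] at n9
  obtain ⟨n10, -⟩ := PLne (x := x3) (by rwa [f3])
  rw [← e4] at n10
  have a1 : x1.fc ∈ A := by rwa [f1]
  have a2 : x2.fc ∈ A := by rwa [f2]
  have a3 : x3.fc ∈ A := by rwa [f3]
  have a4 : x4.fc ∈ A := by rwa [f4]
  have v0 := vr hP T a4
  rw [e] at v0
  have k0 := cq hP T a4
  rw [e] at k0
  have k1 := cq hP T hx
  have k2 := cq hP T a1
  have k3 := cq hP T a2
  have k4 := cq hP T a3
  rw [← e4, e] at k4
  refine ⟨v0, vr hP T hx, vr hP T a1, vr hP T a2, vr hP T a3, k0, k1, k2, k3, k4, ?_, ?_, ?_, ?_, ?_, ?_, ?_, ?_, ?_, ?_⟩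
  · have := cp hP T (x := x4) (y := x) a4 (by simp [*]) (by rw [← e1, e]; exact n1.symm); rwa [e] at this
  · have := cp hP T (x := x4) (y := x1) a4 (by simp [*]) (by rw [← e2, e]; exact n2.symm); rwa [e] at this
  · have := cp hP T (x := x4) (y := x2) a4 (by simp [*]) (by rw [← e3, e]; exact n3.symm); rwa [e] at this
  · have := cp hP T (x := x4) (y := x3) a4 (by simp [*]) (by rw [← e4, e]; exact n4.symm); rwa [e] at this
  · exact cp hP T (x := x) (y := x1) hx (by simp [*]) n5.symm
  · exact cp hP T (x := x) (y := x2) hx (by simp [*]) n6.symm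
  · exact cp hP T (x := x) (y := x3) hx (by simp [*]) n7.symm
  · exact cp hP T (x := x1) (y := x2) a1 (by simp [*]) n8.symm
  · exact cp hP T (x := x1) (y := x3) a1 (by simp [*]) n9.symm
  · exact cp hP T (x := x2) (y := x3) a2 (by simp [*]) n10.symm

end FG

namespace FG
open Finset
open FG.Flag
variable {V : Type} [Fintype V] [DecidableEq V]
set_option linter.unusedSectionVars false
set_option linter.unusedVariables false
variable {P : PlaneGraph V} {A H : Finset (Finset (Sym2 V))} {M : Finset (Sym2 V)}

/-- the companion dart -/
noncomputable def Flag.st (d : Flag P) : Flag P := d.nx.nx.nx.nx.rt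

theorem st_fc (d : Flag P) : d.st.fc = d.nx.nx.nx.nx.rt.fc := rfl
theorem st_vt (d : Flag P) : d.st.vt = d.nx.nx.nx.nx.vt := vt_rt _

theorem st4 {d : Flag P} (h : d.st.fc.card = 5) : d.st.nx.nx.nx.nx = d.nx.nx.nx.nx.rv := by
  have h2 : d.nx.nx.nx.nx.rv.fc.card = 5 := by rwa [← fc_rt]
  have := five' h2
  rwa [← rt_eq] at this

theorem st_st {d : Flag P} (h0 : d.fc.card = 5) (h : d.st.fc.card = 5) : d.st.st = d := by
  rw [st, st4 h, ← nx_eq, five' h0]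

theorem st3 (hP : IsFullerene P) {d : Flag P} (h0 : d.fc.card = 5) (h : d.st.fc.card = 5) :
    d.st.nx.nx.nx.rv = d.rt := by
  rw [← prev hP, st4 h, ← nx_eq, five' h0]

theorem s0_rt_fc (x : Flag P) : x.s0.rt.fc = x.rt.fc := by
  rw [fc_rt, rv_def, s0_s2, s0_s0, fc_s2]

theorem s0_rt (hP : IsFullerene P) (y : Flag P) : y.s0.rt = y.nx.rt.s2 := by
  have h := prev hP y
  rw [rt_def y.nx.rt] at h
  have : y.nx.rt.s2 = y.rv.s1 := by rw [← h, s1_s1]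
  rw [this, rt_def, s0_s2, rv_def]

theorem nx_s0 {d : Flag P} (h0 : d.fc.card = 5) : d.s0.nx = d.nx.nx.nx.nx.s0 := by
  have := s0_nx d.nx.nx.nx.nx
  rwa [five' h0] at this

theorem nx_s0' (d : Flag P) : d.nx.s0.nx = d.s0 := s0_nx d

theorem nx2_s0 {d : Flag P} (h0 : d.fc.card = 5) : d.s0.nx.nx = d.nx.nx.nx.s0 := by
  rw [nx_s0 h0, nx_s0']
theorem nx3_s0 {d : Flag P} (h0 : d.fc.card = 5) : d.s0.nx.nx.nx = d.nx.nx.s0 := by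
  rw [nx2_s0 h0, nx_s0']
theorem nx4_s0 {d : Flag P} (h0 : d.fc.card = 5) : d.s0.nx.nx.nx.nx = d.nx.s0 := by
  rw [nx3_s0 h0, nx_s0']
theorem st_s0 (hP : IsFullerene P) {d : Flag P} (h0 : d.fc.card = 5) : d.s0.st = d.nx.nx.rt.s2 := by
  rw [st, nx4_s0 h0, s0_rt hP]

structure Main (A H : Finset (Finset (Sym2 V))) (M : Finset (Sym2 V)) (d : Flag P) : Prop where
  m : d.ed ∈ M
  a : d.fc ∈ A
  a1 : d.nx.rt.fc ∈ A
  a4 : d.st.fc ∈ A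
  h2 : d.nx.nx.rt.fc ∈ H
  ms : d.st.ed ∈ M

/-- the matching covers all uncovered vertices -/
def Full (A H : Finset (Finset (Sym2 V))) (M : Finset (Sym2 V)) (P : PlaneGraph V) : Prop :=
  ∀ x : Flag P, x.fc ∈ A → ¬ cov H x → x.ed ∈ M ∨ x.rt.ed ∈ M ∨ x.rt.rt.ed ∈ M

theorem fullN (hP : IsFullerene P) (T : Tight P A H M) (F : Full A H M P) {x : Flag P} (hx : x.fc ∈ A) :
    ¬ x.nx.rt.fc ∈ H → ¬ x.rt.fc ∈ H → x.nx.ed ∈ M ∨ x.nx.rt.ed ∈ M ∨ x.ed ∈ M := by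
  intro h1 h2
  have := F x.nx (by rwa [fc_nx]) (by rw [covN hP T.toRules hx]; tauto)
  rwa [prev hP, ed_rv] at this

theorem fullL (hP : IsFullerene P) (T : Tight P A H M) (F : Full A H M P) {x : Flag P} (hx : x.fc ∈ A) :
    (¬ x.rt.fc ∈ H → ¬ x.nx.nx.nx.nx.rt.fc ∈ H → x.ed ∈ M ∨ x.rt.ed ∈ M ∨ x.nx.nx.nx.nx.ed ∈ M) ∧
    (¬ x.nx.rt.fc ∈ H → ¬ x.rt.fc ∈ H → x.nx.ed ∈ M ∨ x.nx.rt.ed ∈ M ∨ x.ed ∈ M) ∧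
    (¬ x.nx.nx.rt.fc ∈ H → ¬ x.nx.rt.fc ∈ H → x.nx.nx.ed ∈ M ∨ x.nx.nx.rt.ed ∈ M ∨ x.nx.ed ∈ M) ∧
    (¬ x.nx.nx.nx.rt.fc ∈ H → ¬ x.nx.nx.rt.fc ∈ H → x.nx.nx.nx.ed ∈ M ∨ x.nx.nx.nx.rt.ed ∈ M ∨ x.nx.nx.ed ∈ M) ∧
    (¬ x.nx.nx.nx.nx.rt.fc ∈ H → ¬ x.nx.nx.nx.rt.fc ∈ H → x.nx.nx.nx.nx.ed ∈ M ∨ x.nx.nx.nx.nx.rt.ed ∈ M ∨ x.nx.nx.nx.ed ∈ M) := by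
  refine ⟨?_, fullN hP T F hx, fullN hP T F (by simpa), fullN hP T F (by simpa), fullN hP T F (by simpa)⟩
  have := fullN hP T F (x := x.nx.nx.nx.nx) (by simpa)
  rwa [five' (T.pent x hx)] at this

theorem mut1 (hP : IsFullerene P) (T : Tight P A H M) (F : Full A H M P) {d : Flag P} (hx : d.fc ∈ A)
    (hm : d.ed ∈ M) : d.nx.nx.rt.fc ∈ H ∨ d.nx.nx.nx.rt.fc ∈ H := by
  have L := PL hP T hx
  obtain ⟨f0, f1, f2, f3, f4⟩ := fullL hP T F hx
  obtain ⟨v0, v1, v2, v3, v4, q0, q1, q2, q3, q4, p01, p02, p03, p04, p12, p13, p14, p23, p24, p34⟩ := L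
  cases v0; cases v1; cases v2; cases v3; cases v4
  grind

theorem mut2 (hP : IsFullerene P) (T : Tight P A H M) (F : Full A H M P) {d : Flag P} (hx : d.fc ∈ A)
    (hm : d.ed ∈ M) (hh : d.nx.nx.rt.fc ∈ H) : Main A H M d := by
  have L := PL hP T hx
  obtain ⟨f0, f1, f2, f3, f4⟩ := fullL hP T F hx
  obtain ⟨v0, v1, v2, v3, v4, q0, q1, q2, q3, q4, p01, p02, p03, p04, p12, p13, p14, p23, p24, p34⟩ := L
  cases v0; cases v1; cases v2; cases v3; cases v4
  refine ⟨hm, hx, ?_, ?_, hh, ?_⟩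
  · grind
  · rw [st_fc]; grind
  · rw [st]; grind

theorem mutM (hP : IsFullerene P) (T : Tight P A H M) (F : Full A H M P) {d : Flag P} (hx : d.fc ∈ A)
    (hm : d.ed ∈ M) : Main A H M d ∨ Main A H M d.s0 := by
  have h5 := T.pent d hx
  rcases mut1 hP T F hx hm with h | h
  · left; exact mut2 hP T F hx hm h
  · right; apply mut2 hP T F (by simpa) (by simpa)
    rw [nx2_s0 h5, s0_rt_fc]; exact h

namespace Main
variable {d : Flag P}
theorem p5 (T : Tight P A H M) (m : Main A H M d) : d.fc.card = 5 := T.pent _ m.a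
theorem P5 (T : Tight P A H M) (m : Main A H M d) : d.st.fc.card = 5 := T.pent _ m.a4

theorem facts (hP : IsFullerene P) (T : Tight P A H M) (m : Main A H M d) :
    d.rt.fc ∉ H ∧ d.nx.nx.nx.rt.fc ∉ H ∧ d.nx.nx.nx.nx.rt.fc ∉ H ∧ d.nx.rt.fc ∉ H ∧
     d.nx.nx.nx.ed ∉ M ∧ d.nx.nx.nx.nx.ed ∉ M ∧ d.nx.ed ∉ M ∧ d.nx.rt.ed ∉ M := by
  have L := PL hP T m.a
  obtain ⟨hm, hx, a1, a4, hh, ms⟩ := m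
  rw [st] at ms a4
  obtain ⟨v0, v1, v2, v3, v4, q0, q1, q2, q3, q4, p01, p02, p03, p04, p12, p13, p14, p23, p24, p34⟩ := L
  cases v0; cases v1; cases v2; cases v3; cases v4
  refine ⟨?_, ?_, ?_, ?_, ?_, ?_, ?_, ?_⟩ <;> grind

theorem star (hP : IsFullerene P) (T : Tight P A H M) (F : Full A H M P) (m : Main A H M d) :
    Main A H M d.st := by
  rcases mut1 hP T F m.a4 m.ms with h | h
  · exact mut2 hP T F m.a4 m.ms h
  · exfalso
    rw [fc_rt, st3 hP (m.p5 T) (m.P5 T)] at h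
    exact (m.facts hP T).1 h

theorem c1 (hP : IsFullerene P) (T : Tight P A H M) (m : Main A H M d) : chg A H M d.nx.nx.nx.nx := by
  obtain ⟨h0, h3, h4, h1, m3, m4, m1, o1⟩ := m.facts hP T
  rw [chgN hP T.toRules (by simpa using m.a)]; tauto

theorem c2 (hP : IsFullerene P) (T : Tight P A H M) (m : Main A H M d) : chg A H M d.nx.rt := by
  obtain ⟨h0, h3, h4, h1, m3, m4, m1, o1⟩ := m.facts hP T
  refine ⟨m.a1, ?_, o1, by rwa [rt3 hP]⟩
  rw [cov_rt hP, covN hP T.toRules m.a]; tauto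

theorem vne (T : Tight P A H M) (m : Main A H M d) : d.st.ed ≠ d.ed := by
  intro h
  have : d.st.vt ∈ d.ed := by rw [← h]; exact vme _
  obtain ⟨n1, n2, n3, n4⟩ := PLne (m.p5 T)
  obtain ⟨-, -, n5, -⟩ := PLne (x := d.nx) (by simpa using m.p5 T)
  rw [st_vt] at this
  rcases Sym2.mem_iff.1 this with h | h
  · exact n4 h.symm
  · rw [← vt_nx] at h; exact n5 h.symm

end Main

theorem Muniq (hP : IsFullerene P) (R : Rules P A H M) {x y : Flag P} (hx : x.ed ∈ M) (hy : y.ed ∈ M)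
    (h : y.vt = x.vt) : y.ed = x.ed := by
  rcases eq_v hP h with h | h | h | h | h | h
  · rw [h]
  · rw [h] at hy; exact absurd hy (R.mM _ hx)
  · rw [h] at hy; exact absurd hy (mM2 hP R hx)
  · rw [h, ed_s2]
  · rw [h, ed_s2] at hy; exact absurd hy (R.mM _ hx)
  · rw [h, ed_s2] at hy; exact absurd hy (mM2 hP R hx)

theorem Mne (hP : IsFullerene P) (R : Rules P A H M) {x y : Flag P} (hx : x.ed ∈ M) (hy : y.ed ∈ M)
    (h : y.ed ≠ x.ed) : y.vt ≠ x.vt ∧ y.wt ≠ x.vt ∧ y.vt ≠ x.wt ∧ y.wt ≠ x.wt := by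
  refine ⟨fun hh => h (Muniq hP R hx hy hh), fun hh => ?_, fun hh => ?_, fun hh => ?_⟩
  · have := Muniq hP R (x := x) (y := y.rv) hx (by simpa) (by simpa)
    rw [ed_rv] at this; exact h this
  · have := Muniq hP R (x := x.rv) (y := y) (by simpa) hy (by simpa)
    rw [ed_rv] at this; exact h this
  · have := Muniq hP R (x := x.rv) (y := y.rv) (by simpa) (by simpa) (by simpa)
    rw [ed_rv, ed_rv] at this; exact h this

namespace Main
variable {d : Flag P}

theorem rvMain (hP : IsFullerene P) (T : Tight P A H M) (F : Full A H M P) (m : Main A H M d)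
    (hs : d.rv.fc ∈ A) : Main A H M d.rv := by
  apply mut2 hP T F hs (by simpa using m.m)
  have hs := (m.star hP T F).h2
  have h3 := st3 hP (m.p5 T) (m.P5 T)
  have h4 : d.st.nx.nx.nx = d.rt.rv := by rw [← h3, rv_rv]
  have h5 := prev hP d.st.nx.nx
  rw [h4, ← nx_eq, rt_eq d] at h5
  rwa [h5, ← fc_rt]

/-- geometry of the face across `d.nx` -/
theorem g (hP : IsFullerene P) (T : Tight P A H M) (m : Main A H M d) :
    d.nx.nx.rt = d.nx.rt.nx.nx.nx.rv := by
  have h5 : d.nx.rt.fc.card = 5 := T.pent _ m.a1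
  have h5' : d.nx.rv.fc.card = 5 := by rwa [← fc_rt]
  rw [rt_eq d.nx, ← prev hP d.nx.rv.nx.nx.nx.nx, five' h5', ← prev hP d.nx, rt3 hP]

theorem rvst (hP : IsFullerene P) (T : Tight P A H M) (m : Main A H M d) (m' : Main A H M d.rv) :
    d.rv.st = d.nx.rt.nx ∧ d.rv.nx.nx.nx.nx = d.nx.rt.rv := by
  have h : d.rv.nx.nx.nx.nx = d.nx.rt.rv := by
    have := prev hP d.rv.nx.nx.nx.nx
    rw [five' (m'.p5 T), ← nx_eq] at this
    rw [this, rv_rv]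
  exact ⟨by rw [st, h, ← nx_eq], h⟩

theorem dist (hP : IsFullerene P) (T : Tight P A H M) (m : Main A H M d) (m' : Main A H M d.rv) :
    d.rv.st.ed ≠ d.st.ed := by
  intro h
  obtain ⟨e1, e2⟩ := m.rvst hP T m'
  have R := T.toRules
  obtain ⟨n1, n2, n3, n4⟩ := PLne (m.p5 T)
  obtain ⟨n5, n6, n7, -⟩ := PLne (x := d.nx) (by simpa using m.p5 T)
  obtain ⟨w1, w2, w3, w4⟩ := Mne hP R m.m m.ms (m.vne T)
  have p5 : d.nx.rt.fc.card = 5 := T.pent _ m.a1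
  obtain ⟨k1, k2, k3, k4⟩ := PLne p5
  obtain ⟨k5, k6, k7, -⟩ := PLne (x := d.nx.rt.nx) (by simpa using p5)
  have vv : d.nx.rt.vt = d.wt := by simp
  have nb : ∀ y : Flag P, y.vt = d.st.vt → y.wt = d.vt ∨ y.wt = d.st.wt ∨ y.wt = d.nx.nx.nx.vt := by
    intro y hy
    have b1 : d.nx.nx.nx.nx.wt = d.vt := by rw [← vt_nx, five' (m.p5 T)]
    have b2 : d.nx.nx.nx.nx.rt.rt.wt = d.nx.nx.nx.vt := by rw [prev hP, wt_rv]
    rw [st_vt] at hy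
    rcases eq_v hP hy with h | h | h | h | h | h <;> rw [h]
    · left; exact b1
    · right; left; rfl
    · right; right; exact b2
    · left; rw [wt_s2]; exact b1
    · right; left; rw [wt_s2]; rfl
    · right; right; rw [wt_s2]; exact b2
  rw [e1] at h
  have u1 : ¬ cov H d := R.mh _ m.m
  rcases Sym2.eq_iff.1 h with ⟨h1, h2⟩ | ⟨h1, h2⟩
  · rcases nb d.nx.rt.rv (by rw [vt_rv, ← h1, vt_nx]) with hb | hb | hb
    · rw [wt_rv, vv] at hb; exact d.ne hb.symm
    · rw [wt_rv, vv] at hb; exact w4 hb.symm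
    · rw [wt_rv, vt_rt] at hb; exact n6 hb
  · have cw : cov H d.nx.rt.nx.nx.nx := by
      right; left; rw [fc_rt, ← m.g hP T]; exact m.h2
    rcases nb d.nx.rt.nx.nx (by rw [vt_nx, h2]) with hb | hb | hb
    · rw [← vt_nx] at hb
      rw [cov_v hP H hb] at cw; exact u1 cw
    · rw [← vt_nx, ← h1] at hb
      exact k6 hb.symm
    · have := d.nx.nx.rt_ne
      rw [m.g hP T, wt_rv, ← vt_nx d.nx.nx] at this
      rw [← vt_nx] at hb
      exact this hb

end Main
end FG

namespace FG
open Finset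
open FG.Flag
variable {V : Type} [Fintype V] [DecidableEq V]
set_option linter.unusedSectionVars false
set_option linter.unusedVariables false
variable {P : PlaneGraph V} {A H : Finset (Finset (Sym2 V))} {M : Finset (Sym2 V)}

/-- the shape of `B_2` -/
structure Shape2 (S : Finset (Finset (Sym2 V))) (d : Flag P) : Prop where
  pent : ∀ f ∈ S, f.card = 5
  a : d.fc ∈ S
  a1 : d.nx.rt.fc ∈ S
  a4 : d.st.fc ∈ S
  a5 : d.st.nx.rt.fc ∈ S
  all : ∀ f ∈ S, f = d.fc ∨ f = d.nx.rt.fc ∨ f = d.st.fc ∨ f = d.st.nx.rt.fc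
  ns : d.rt.fc ∉ S
  nt : d.st.rt.fc ∉ S
  h1 : d.nx.nx.rt.fc.card = 6
  h2 : d.st.nx.nx.rt.fc.card = 6

/-- the shape of `B_3` -/
structure Shape3 (S : Finset (Finset (Sym2 V))) (d : Flag P) : Prop where
  pent : ∀ f ∈ S, f.card = 5
  a : d.fc ∈ S
  a1 : d.nx.rt.fc ∈ S
  a4 : d.st.fc ∈ S
  a5 : d.st.nx.rt.fc ∈ S
  a6 : d.rv.fc ∈ S
  a7 : d.rv.st.nx.rt.fc ∈ S
  all : ∀ f ∈ S, f = d.fc ∨ f = d.nx.rt.fc ∨ f = d.st.fc ∨ f = d.st.nx.rt.fc ∨ f = d.rv.fc ∨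
    f = d.rv.st.nx.rt.fc
  nt : d.st.rt.fc ∉ S
  nt' : d.rv.st.rt.fc ∉ S
  h1 : d.nx.nx.rt.fc ∉ S
  h2 : d.st.nx.nx.rt.fc ∉ S

theorem exM (hP : IsFullerene P) (T : Tight P A H M) (F : Full A H M P) {x : Flag P} (hx : x.fc ∈ A)
    (hc : ¬ cov H x) : ∃ d : Flag P, Main A H M d ∧ x.vt ∈ d.ed := by
  have key : ∀ z : Flag P, z.vt = x.vt → z.ed ∈ M → ∃ d : Flag P, Main A H M d ∧ x.vt ∈ d.ed := by
    intro z hz hm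
    rcases T.mA z hm with h | h
    · rcases mutM hP T F h hm with h' | h'
      · exact ⟨z, h', by rw [← hz]; exact vme z⟩
      · exact ⟨z.s0, h', by rw [← hz, ed_s0]; exact vme z⟩
    · rw [fc_rt] at h
      rcases mutM hP T F h (by rwa [ed_rv]) with h' | h'
      · exact ⟨z.rv, h', by rw [← hz, ed_rv]; exact vme z⟩
      · exact ⟨z.rv.s0, h', by rw [← hz, ed_s0, ed_rv]; exact vme z⟩
  rcases F x hx hc with h | h | h
  · exact key _ rfl h
  · exact key _ (vt_rt _) h
  · exact key _ (by simp) h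

theorem st4_vt (hP : IsFullerene P) (T : Tight P A H M) {d : Flag P} (m : Main A H M d) :
    d.st.nx.nx.nx.nx.vt = d.vt := by
  rw [st4 (m.P5 T), vt_rv, ← vt_nx, five' (m.p5 T)]

theorem four_ne (hP : IsFullerene P) (T : Tight P A H M) (F : Full A H M P) {d : Flag P} (m : Main A H M d) :
    ({d.fc, d.nx.rt.fc, d.st.fc, d.st.nx.rt.fc} : Finset (Finset (Sym2 V))).card = 4 := by
  have m' := m.star hP T F
  obtain ⟨w1, w2, w3, w4⟩ := Mne hP T.toRules m.m m.ms (m.vne T)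
  have c1 := m.c1 hP T
  have c2 := m.c2 hP T
  have c3 := m'.c1 hP T
  have c4 := m'.c2 hP T
  have hv := st4_vt hP T m
  have e1 : d.nx.nx.nx.nx.vt = d.st.vt := (st_vt d).symm
  have e2 : d.nx.rt.vt = d.wt := by simp
  have e4 : d.st.nx.rt.vt = d.st.wt := by simp
  have f1 : d.nx.nx.nx.nx.fc = d.fc := by simp
  have f3 : d.st.nx.nx.nx.nx.fc = d.st.fc := by simp
  have k12 : d.fc ≠ d.nx.rt.fc := fun h => w3 (by
    have := T.T1 _ _ c1 c2 (by rw [f1, h]); rw [e1, e2] at this; exact this.symm)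
  have k13 : d.fc ≠ d.st.fc := fun h => w1 (by
    have := T.T1 _ _ c1 c3 (by rw [f1, f3, h]); rw [e1, hv] at this; exact this.symm)
  have k14 : d.fc ≠ d.st.nx.rt.fc := fun h => d.st.ne (by
    have := T.T1 _ _ c1 c4 (by rw [f1, h]); rw [e1, e4] at this; exact this.symm)
  have k23 : d.nx.rt.fc ≠ d.st.fc := fun h => d.ne (by
    have := T.T1 _ _ c2 c3 (by rw [f3, h]); rw [e2, hv] at this; exact this)
  have k24 : d.nx.rt.fc ≠ d.st.nx.rt.fc := fun h => w4 (by
    have := T.T1 _ _ c2 c4 (by rw [h]); rw [e2, e4] at this; exact this)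
  have k34 : d.st.fc ≠ d.st.nx.rt.fc := fun h => w2 (by
    have := T.T1 _ _ c3 c4 (by rw [f3, h]); rw [hv, e4] at this; exact this)
  rw [card_insert_of_notMem, card_insert_of_notMem, card_insert_of_notMem, card_singleton] <;>
    simp [k12, k13, k14, k23, k24, k34]

theorem s_not (hP : IsFullerene P) (T : Tight P A H M) (F : Full A H M P) {d : Flag P} (m : Main A H M d)
    (hA : ∀ f ∈ A, f = d.fc ∨ f = d.nx.rt.fc ∨ f = d.st.fc ∨ f = d.st.nx.rt.fc) : d.rt.fc ∉ A := by
  intro h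
  rw [fc_rt] at h
  have m1 := m.rvMain hP T F h
  rcases hA _ h with h | h | h | h
  · exact d.fc_rv_ne h
  · rw [← prev hP] at h; exact fc_rt_ne _ h
  · rw [st, fc_rt d.nx.nx.nx.nx, ← prev hP d.nx.nx.nx.nx, five' (m.p5 T), ← fc_rt] at h
    exact fc_rt_ne _ h.symm
  · have := T.T1 _ _ ((m.star hP T F).c2 hP T) (m1.c1 hP T) (by simpa using h)
    rw [← st_vt, vt_rt, vt_nx] at this
    have := Muniq hP T.toRules (x := d.st.rv) (y := d.rv.st) (by simpa using m.ms) m1.ms (by simpa using this)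
    rw [ed_rv] at this
    exact m.dist hP T m1 this

theorem tight_normal (hP : IsFullerene P) (hA : A ⊆ P.faces) (h5 : ∀ f ∈ A, f.card = 5) (hE : Ext P A)
    (h : IsNormalClarSet P (A.sup id) H) :
    (Uset (A.sup id) H).card = A.card ∧ H ⊆ P.faces ∧ ∃ M, Tight P A H M ∧ Full A H M P := by
  obtain ⟨hU, hH, -⟩ := clar_tight hP hA h5 hE h.1
  obtain ⟨hc, M, m1, m2, m3, m4⟩ := h
  have R : Rules P A H M := rules_of hP hA h5 (fun f hf => ⟨(hc.1.1 f hf).1, (hc.1.1 f hf).2.1⟩) hc.1.2.1 m1 m2 m3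
    (fun v hv _ hn => m4 v (mem_sdiff.2 ⟨hv, hn⟩))
  refine ⟨hU, hH, M, (charge hP R hA hH).2 hU, ?_⟩
  intro x hx hcv
  obtain ⟨e, he, hv⟩ := m4 x.vt (mem_sdiff.2 ⟨(vt_mem hP hA x).2 (Or.inl hx), fun hh => hcv ((vt_mem hP hH x).1 hh)⟩)
  rcases ed_at hP x (edges_sub hA (m1 he)) hv with h | h | h <;> rw [← h] <;> tauto

theorem exMain (hP : IsFullerene P) (T : Tight P A H M) (F : Full A H M P) (hA : A ⊆ P.faces)
    (hne : A.Nonempty) : ∃ d : Flag P, Main A H M d := by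
  obtain ⟨f, hf⟩ := hne
  obtain ⟨x, rfl⟩ := exists_flag_face (hA hf)
  have key : ∀ y : Flag P, chg A H M y → ∃ d : Flag P, Main A H M d := fun y hy => by
    obtain ⟨d, hd, -⟩ := exM hP T F hy.1 hy.2.1
    exact ⟨d, hd⟩
  rcases T0 hP T.toRules hf with h | h | h | h | h <;> exact key _ h

theorem shape2_of (hP : IsFullerene P) (hA : A ⊆ P.faces) (T : Tight P A H M) (F : Full A H M P)
    (h4 : A.card = 4) : ∃ d : Flag P, Shape2 A d := by
  obtain ⟨d, m⟩ := exMain hP T F hA (card_pos.1 (by omega))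
  have m' := m.star hP T F
  have hsub : ({d.fc, d.nx.rt.fc, d.st.fc, d.st.nx.rt.fc} : Finset (Finset (Sym2 V))) ⊆ A := by
    intro f hf
    simp only [mem_insert, mem_singleton] at hf
    rcases hf with rfl | rfl | rfl | rfl
    exacts [m.a, m.a1, m.a4, m'.a1]
  have heq := eq_of_subset_of_card_le hsub (by rw [four_ne hP T F m, h4])
  have hall : ∀ f ∈ A, f = d.fc ∨ f = d.nx.rt.fc ∨ f = d.st.fc ∨ f = d.st.nx.rt.fc := by
    intro f hf; rw [← heq] at hf; simpa using hf
  refine ⟨d, ⟨?_, m.a, m.a1, m.a4, m'.a1, hall, s_not hP T F m hall, s_not hP T F m' ?_, T.hex _ m.h2,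
    T.hex _ m'.h2⟩⟩
  · intro f hf
    obtain ⟨x, rfl⟩ := exists_flag_face (hA hf)
    exact T.pent x hf
  · rw [st_st (m.p5 T) (m.P5 T)]
    intro f hf; have := hall f hf; tauto

theorem b2_shape (hP : IsFullerene P) (hn : 60 ≤ Fintype.card V) {B : Fragment P} (h : IsB2Frag B) :
    Ext P B.inFaces ∧ ∃ d : Flag P, Shape2 B.inFaces d := by
  obtain ⟨h5, h4, ⟨H0, hc, hu⟩, H, hN⟩ := h
  have hE : Ext P B.inFaces := ⟨H0, hc.1, by rw [pentFaces_eq hP hn B h5] at hu; exact hu.le⟩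
  obtain ⟨hU, hH, M, T, F⟩ := tight_normal hP B.subFaces h5 hE hN
  exact ⟨hE, shape2_of hP B.subFaces T F h4⟩

/-- every matched edge end is in `U` -/
theorem Main.mem_U (hP : IsFullerene P) (T : Tight P A H M) (hA : A ⊆ P.faces) (hH : H ⊆ P.faces)
    {d : Flag P} (m : Main A H M d) :
    d.vt ∈ Uset (A.sup id) H ∧ d.wt ∈ Uset (A.sup id) H := by
  have h1 : ¬ cov H d := T.mh _ m.m
  have h2 : ¬ cov H d.nx := mh' T.toRules hP m.m
  refine ⟨mem_sdiff.2 ⟨(vt_mem hP hA d).2 (Or.inl m.a), fun hh => h1 ((vt_mem hP hH d).1 hh)⟩, ?_⟩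
  rw [← vt_nx]
  exact mem_sdiff.2 ⟨(vt_mem hP hA d.nx).2 (Or.inl (by simpa using m.a)), fun hh => h2 ((vt_mem hP hH d.nx).1 hh)⟩

theorem six_U (hP : IsFullerene P) (T : Tight P A H M) (hA : A ⊆ P.faces) (hH : H ⊆ P.faces)
    (hU : (Uset (A.sup id) H).card = 6) {a b c : Flag P} (ma : Main A H M a) (mb : Main A H M b)
    (mc : Main A H M c) (hab : b.ed ≠ a.ed) (hac : c.ed ≠ a.ed) (hbc : c.ed ≠ b.ed) :
    ∀ z : Flag P, Main A H M z → z.ed = a.ed ∨ z.ed = b.ed ∨ z.ed = c.ed := by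
  obtain ⟨a1, a2, a3, a4⟩ := Mne hP T.toRules ma.m mb.m hab
  obtain ⟨b1, b2, b3, b4⟩ := Mne hP T.toRules ma.m mc.m hac
  obtain ⟨c1, c2, c3, c4⟩ := Mne hP T.toRules mb.m mc.m hbc
  have n1 := a.ne
  have n2 := b.ne
  have n3 := c.ne
  have hcard : ({a.vt, a.wt, b.vt, b.wt, c.vt, c.wt} : Finset V).card = 6 := by
    rw [card_insert_of_notMem, card_insert_of_notMem, card_insert_of_notMem, card_insert_of_notMem,
      card_insert_of_notMem, card_singleton] <;> simp [n1, n2, n3, a1.symm, a2.symm, a3.symm, a4.symm,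
        b1.symm, b2.symm, b3.symm, b4.symm, c1.symm, c2.symm, c3.symm, c4.symm]
  have hsub : ({a.vt, a.wt, b.vt, b.wt, c.vt, c.wt} : Finset V) ⊆ Uset (A.sup id) H := by
    intro v hv
    simp only [mem_insert, mem_singleton] at hv
    have u1 := ma.mem_U hP T hA hH
    have u2 := mb.mem_U hP T hA hH
    have u3 := mc.mem_U hP T hA hH
    rcases hv with rfl | rfl | rfl | rfl | rfl | rfl <;> tauto
  have heq := eq_of_subset_of_card_le hsub (by rw [hcard, hU])
  intro z mz
  have hz := (mz.mem_U hP T hA hH).1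
  rw [← heq] at hz
  simp only [mem_insert, mem_singleton] at hz
  have R := T.toRules
  have rr : ∀ y : Flag P, Main A H M y → z.vt = y.wt → z.ed = y.ed := fun y my h => by
    have := Muniq hP R (x := y.rv) (y := z) (by simpa using my.m) mz.m (by simpa using h)
    simpa using this
  rcases hz with h | h | h | h | h | h
  · left; exact Muniq hP R ma.m mz.m h
  · left; exact rr a ma h
  · right; left; exact Muniq hP R mb.m mz.m h
  · right; left; exact rr b mb h
  · right; right; exact Muniq hP R mc.m mz.m h
  · right; right; exact rr c mc h

theorem Main.s0_not (hP : IsFullerene P) (T : Tight P A H M) {d : Flag P} (m : Main A H M d)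
    (m' : Main A H M d.s0) : False := by
  have := m'.h2
  rw [nx2_s0 (m.p5 T), s0_rt_fc] at this
  exact (m.facts hP T).2.1 this

theorem ed_eq_main (hP : IsFullerene P) (T : Tight P A H M) (F : Full A H M P) {d d' : Flag P} (m : Main A H M d)
    (m' : Main A H M d') (hn : d'.ed ≠ d.st.ed) (h : d'.st.ed = d.ed) : d.rv.fc ∈ A := by
  have ms := m'.star hP T F
  rcases eq_e h with h | h | h | h
  · exfalso; apply hn; rw [← h, st_st (m'.p5 T) (m'.P5 T)]
  · rw [h] at ms; exact (m.s0_not hP T ms).elim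
  · rw [h] at ms; have := ms.a; rwa [fc_s2, fc_rt] at this
  · rw [h] at ms; exact ms.a

theorem exDouble (hP : IsFullerene P) (T : Tight P A H M) (F : Full A H M P) (hA : A ⊆ P.faces) (hH : H ⊆ P.faces)
    (h6 : A.card = 6) (hU : (Uset (A.sup id) H).card = 6) :
    ∃ d : Flag P, Main A H M d ∧ d.rv.fc ∈ A := by
  obtain ⟨d, m⟩ := exMain hP T F hA (card_pos.1 (by omega))
  have m' := m.star hP T F
  by_contra hcon
  push Not at hcon
  have hlt : ({d.vt, d.wt, d.st.vt, d.st.wt} : Finset V).card < (Uset (A.sup id) H).card := by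
    have := card_le_four (a := d.vt) (b := d.wt) (c := d.st.vt) (d := d.st.wt); omega
  obtain ⟨y, hy, hyn⟩ := exists_mem_notMem_of_card_lt_card hlt
  obtain ⟨hy1, hy2⟩ := mem_sdiff.1 hy
  obtain ⟨x, rfl, hx⟩ := ev_flag hA hy1
  have hcx : ¬ cov H x := fun hh => hy2 ((vt_mem hP hH x).2 hh)
  obtain ⟨e, me, hxe⟩ := exM hP T F hx hcx
  simp only [mem_insert, mem_singleton, not_or] at hyn
  have n1 : e.ed ≠ d.ed := fun h => by
    rw [h] at hxe; rcases Sym2.mem_iff.1 hxe with h | h <;> tauto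
  have n2 : e.ed ≠ d.st.ed := fun h => by
    rw [h] at hxe; rcases Sym2.mem_iff.1 hxe with h | h <;> tauto
  rcases six_U hP T hA hH hU m m' me (m.vne T) n1 n2 e.st (me.star hP T F) with h | h | h
  · exact hcon d m (ed_eq_main hP T F m me n2 h)
  · exact hcon _ m' (ed_eq_main hP T F m' me (by rwa [st_st (m.p5 T) (m.P5 T)]) h)
  · exact me.vne T h

theorem t_not (hP : IsFullerene P) (T : Tight P A H M) (F : Full A H M P) {d : Flag P} (m : Main A H M d)
    (mr : Main A H M d.rv)
    (hE : ∀ z : Flag P, Main A H M z → z.ed = d.ed ∨ z.ed = d.st.ed ∨ z.ed = d.rv.st.ed) :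
    d.st.rt.fc ∉ A := by
  intro h
  rw [fc_rt] at h
  have ms := m.star hP T F
  have mt := ms.rvMain hP T F h
  have mts := mt.star hP T F
  have mrs := mr.star hP T F
  have R := T.toRules
  have k : d.st.rv.st.ed = d.rv.st.ed := by
    rcases hE _ mts with h | h | h
    · have := ms.dist hP T mt
      rw [st_st (m.p5 T) (m.P5 T)] at this
      exact absurd h this
    · have := mt.vne T
      rw [ed_rv] at this
      exact absurd h this
    · exact h
  obtain ⟨g1, g2⟩ := ms.rvst hP T mt
  obtain ⟨g3, g4⟩ := m.rvst hP T mr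
  obtain ⟨w1, w2, w3, w4⟩ := Mne hP T.toRules m.m m.ms (m.vne T)
  obtain ⟨v1, v2, v3, v4⟩ := Mne hP T.toRules m.ms mr.ms (m.dist hP T mr)
  have ua : ¬ cov H d.st := R.mh _ m.ms
  have ua' : ¬ cov H d.st.nx := mh' R hP m.ms
  rcases Sym2.eq_iff.1 k with ⟨h1, h2⟩ | ⟨h1, h2⟩
  · have hts := chg_unique hP R (mt.c1 hP T) (mr.c1 hP T) (by rw [← st_vt, ← st_vt]; exact h1.symm)
    rw [fc_nx, fc_nx, fc_nx, fc_nx, fc_nx, fc_nx, fc_nx, fc_nx] at hts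
    have hv := vert5 (x := d.rv) (y := d.st.rv.nx) (mr.p5 T) (by simpa using hts.symm)
    have e0 : d.st.rv.nx.vt = d.st.vt := by simp
    rw [e0] at hv
    have h2 := mr.h2
    rcases hv with hv | hv | hv | hv | hv
    · exact w3 (by simpa using hv)
    · exact w1 (by simpa using hv)
    · exact ua ((cov_v hP H hv).2 (Or.inr (Or.inl h2)))
    · apply ua
      rw [cov_v hP H hv]
      right; right
      rw [prev hP, ← fc_rt]; exact h2
    · rw [← st_vt] at hv; exact v1 hv.symm
  · have cw : cov H d.nx.rt.nx.nx.nx := by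
      right; left; rw [fc_rt, ← m.g hP T]; exact m.h2
    have p5 : d.nx.rt.fc.card = 5 := T.pent _ m.a1
    obtain ⟨k5, k6, k7, -⟩ := PLne (x := d.nx.rt.nx) (by simpa using p5)
    have hz : d.nx.rt.nx.nx.vt = d.st.rv.nx.nx.nx.nx.vt := by
      rw [← st_vt, h1, g3, vt_nx]
    have hb : d.nx.rt.nx.nx.wt = d.st.rv.nx.nx.nx.nx.wt ∨ d.nx.rt.nx.nx.wt = d.st.rv.nx.nx.nx.nx.rt.wt ∨
        d.nx.rt.nx.nx.wt = d.st.rv.nx.nx.nx.nx.rt.rt.wt := by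
      rcases eq_v hP hz with h | h | h | h | h | h <;> rw [h] <;> simp
    rw [← vt_nx d.nx.rt.nx.nx] at hb
    rcases hb with hb | hb | hb
    · rw [← vt_nx, five' (mt.p5 T), vt_rv, ← vt_nx d.st] at hb
      exact ua' ((cov_v hP H hb).1 cw)
    · change _ = d.st.rv.st.wt at hb
      rw [h2, g3] at hb
      exact k6 hb.symm
    · rw [prev hP, wt_rv] at hb
      have q1 : d.st.rv.nx.nx = d.nx.nx.nx.rt := by
        rw [← rt_eq, Flag.st, prev hP, ← rt_eq]
      rw [q1] at hb
      have q2 : d.nx.nx.nx.rt.rv.nx = d.nx.nx.rv := by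
        rw [nx_eq, rv_rv, prev hP]
      have q3 : d.nx.nx.nx.rt.rv.nx.nx = d.nx.nx.rt := by rw [q2, ← rt_eq]
      have hx : d.nx.nx.nx.rt.rv.fc.card = 6 := by
        have : d.nx.nx.nx.rt.rv.fc = d.nx.nx.rt.fc := by rw [← q3]; simp
        rw [this]; exact T.hex _ m.h2
      have := it_inj d.nx.nx.nx.rt.rv (i := 0) (j := 3) (by omega) (by omega) (by
        rw [it_succ, it_succ, it_succ, it_zero, q3, vt_nx, m.g hP T, wt_rv, hb, vt_rv, vt_nx])
      omega

theorem shape3_of (hP : IsFullerene P) (hA : A ⊆ P.faces) (hH : H ⊆ P.faces) (T : Tight P A H M) (F : Full A H M P)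
    (h6 : A.card = 6) (hU : (Uset (A.sup id) H).card = 6) : ∃ d : Flag P, Shape3 A d := by
  obtain ⟨d, m, hs⟩ := exDouble hP T F hA hH h6 hU
  have ms := m.star hP T F
  have mr := m.rvMain hP T F hs
  have mrs := mr.star hP T F
  have hE := six_U hP T hA hH hU m ms mrs (m.vne T) (by have := mr.vne T; rwa [ed_rv] at this) (m.dist hP T mr)
  have nt := t_not hP T F m mr hE
  have nt' : d.rv.st.rt.fc ∉ A := t_not hP T F mr (by simpa using m) (by
    intro z hz; have := hE z hz; rw [rv_rv, ed_rv]; tauto)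
  have R := T.toRules
  have c1 := m.c1 hP T
  have c2 := m.c2 hP T
  have c3 := ms.c1 hP T
  have c4 := ms.c2 hP T
  have c5 := mr.c1 hP T
  have c6 := mrs.c2 hP T
  obtain ⟨w1, w2, w3, w4⟩ := Mne hP R m.m m.ms (m.vne T)
  obtain ⟨v1, v2, v3, v4⟩ := Mne hP R m.ms mr.ms (m.dist hP T mr)
  obtain ⟨u1, u2, u3, u4⟩ := Mne hP R m.m mr.ms (by have := mr.vne T; rwa [ed_rv] at this)
  have hv := st4_vt hP T m
  have e1 : d.nx.nx.nx.nx.vt = d.st.vt := (st_vt d).symm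
  have e2 : d.nx.rt.vt = d.wt := by simp
  have e4 : d.st.nx.rt.vt = d.st.wt := by simp
  have e5 : d.rv.nx.nx.nx.nx.vt = d.rv.st.vt := (st_vt _).symm
  have e6 : d.rv.st.nx.rt.vt = d.rv.st.wt := by simp
  have f1 : d.nx.nx.nx.nx.fc = d.fc := by simp
  have f3 : d.st.nx.nx.nx.nx.fc = d.st.fc := by simp
  have f5 : d.rv.nx.nx.nx.nx.fc = d.rv.fc := by simp
  have n1 := d.rv.st.ne
  have tt : ∀ x y : Flag P, chg A H M x → chg A H M y → y.vt ≠ x.vt → y.fc ≠ x.fc := fun x y hx hy hn he =>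
    hn (T.T1 x y hx hy he)
  have k15 := tt _ _ c1 c5 (by rw [e1, e5]; exact v1)
  have k16 := tt _ _ c1 c6 (by rw [e1, e6]; exact v2)
  have k25 := tt _ _ c2 c5 (by rw [e2, e5]; exact u3)
  have k26 := tt _ _ c2 c6 (by rw [e2, e6]; exact u4)
  have k35 := tt _ _ c3 c5 (by rw [hv, e5]; exact u1)
  have k36 := tt _ _ c3 c6 (by rw [hv, e6]; exact u2)
  have k45 := tt _ _ c4 c5 (by rw [e4, e5]; exact v3)
  have k46 := tt _ _ c4 c6 (by rw [e4, e6]; exact v4)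
  have k56 := tt _ _ c5 c6 (by rw [e5, e6]; exact n1.symm)
  rw [f1] at k15 k16
  rw [f3] at k35 k36
  rw [f5] at k15 k25 k35 k45 k56
  have h4 := four_ne hP T F m
  have hcard : (insert d.rv.fc (insert d.rv.st.nx.rt.fc
     ({d.fc, d.nx.rt.fc, d.st.fc, d.st.nx.rt.fc} : Finset (Finset (Sym2 V))))).card = 6 := by
    rw [card_insert_of_notMem, card_insert_of_notMem, h4] <;>
    simp [k15, k16, k25, k26, k35, k36, k45, k46, k56.symm]
  have hsub : (insert d.rv.fc (insert d.rv.st.nx.rt.fc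
     ({d.fc, d.nx.rt.fc, d.st.fc, d.st.nx.rt.fc} : Finset (Finset (Sym2 V))))) ⊆ A := by
    intro f hf
    simp only [mem_insert, mem_singleton] at hf
    rcases hf with rfl | rfl | rfl | rfl | rfl | rfl
    exacts [hs, mrs.a1, m.a, m.a1, m.a4, ms.a1]
  have heq := eq_of_subset_of_card_le hsub (by rw [hcard, h6])
  refine ⟨d, ⟨?_, m.a, m.a1, m.a4, ms.a1, hs, mrs.a1, ?_, nt, nt', fun h => R.hA h m.h2, fun h => R.hA h ms.h2⟩⟩
  · intro f hf
    obtain ⟨x, rfl⟩ := exists_flag_face (hA hf)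
    exact T.pent x hf
  · intro f hf
    rw [← heq] at hf
    clear * - hf
    simp only [mem_insert, mem_singleton] at hf
    tauto

theorem b3_shape (hP : IsFullerene P) (hn : 60 ≤ Fintype.card V) {B : Fragment P} (h : IsB3Frag B) :
    ∃ d : Flag P, Shape3 B.inFaces d := by
  obtain ⟨h5, h4, ⟨H0, hc, hu⟩, H, hN⟩ := h
  have hE : Ext P B.inFaces := ⟨H0, hc.1, by rw [pentFaces_eq hP hn B h5] at hu; exact hu.le⟩
  obtain ⟨hU, hH, M, T, F⟩ := tight_normal hP B.subFaces h5 hE hN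
  exact shape3_of hP B.subFaces hH T F h4 (hU.trans h4)

end FG

namespace FG
open Finset
open FG.Flag
variable {V : Type} [Fintype V] [DecidableEq V]
set_option linter.unusedSectionVars false
set_option linter.unusedVariables false
variable {P : PlaneGraph V} {A H S : Finset (Finset (Sym2 V))} {M : Finset (Sym2 V)}

/-- a face sharing two consecutive edges with `S` -/
def Iso (P : PlaneGraph V) (S : Finset (Finset (Sym2 V))) (f : Finset (Sym2 V)) : Prop :=
  ∃ x : Flag P, x.fc = f ∧ x.rt.fc ∈ S ∧ x.nx.rt.fc ∈ S

theorem Iso.mono {S S' : Finset (Finset (Sym2 V))} {f} (h : Iso P S f) (hs : S ⊆ S') : Iso P S' f := by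
  obtain ⟨x, h1, h2, h3⟩ := h
  exact ⟨x, h1, hs h2, hs h3⟩

theorem ed_nx_ne (hP : IsFullerene P) (x : Flag P) : x.nx.ed ≠ x.ed := by
  have := ed_ne2 hP x.nx
  rw [prev hP, ed_rv] at this
  exact this.symm

theorem rt_of {x y : Flag P} (h1 : x.fc = y.fc) (h2 : x.ed = y.ed) : x.rt.fc = y.rt.fc := by
  rcases eq_ef h2 h1 with rfl | rfl
  · rfl
  · exact s0_rt_fc _

theorem rt_of' {x y : Flag P} (h1 : x.fc = y.rt.fc) (h2 : x.ed = y.ed) : x.rt.fc = y.fc := by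
  have := rt_of (x := x) (y := y.rv) (by rw [h1, fc_rt]) (by rw [h2, ed_rv])
  rw [this, ← nx_eq, fc_nx]

theorem five_cases {x y : Flag P} (h5 : y.fc.card = 5) (h : x.fc = y.fc) :
    (x.ed = y.ed ∧ x.rt.fc = y.rt.fc) ∨ (x.ed = y.nx.ed ∧ x.rt.fc = y.nx.rt.fc) ∨
    (x.ed = y.nx.nx.ed ∧ x.rt.fc = y.nx.nx.rt.fc) ∨ (x.ed = y.nx.nx.nx.ed ∧ x.rt.fc = y.nx.nx.nx.rt.fc) ∨
    (x.ed = y.nx.nx.nx.nx.ed ∧ x.rt.fc = y.nx.nx.nx.nx.rt.fc) := by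
  rcases edge5 h5 (e := x.ed) (by rw [← h]; exact x.me') with h' | h' | h' | h' | h'
  · left; exact ⟨h', rt_of h h'⟩
  · right; left; exact ⟨h', rt_of (by simpa) h'⟩
  · right; right; left; exact ⟨h', rt_of (by simpa) h'⟩
  · right; right; right; left; exact ⟨h', rt_of (by simpa) h'⟩
  · right; right; right; right; exact ⟨h', rt_of (by simpa) h'⟩

theorem PE.third {e : Sym2 V} (hP : IsFullerene P) (h : PE P S H M e) {y : Flag P} (hy : e = y.ed) :
    y.rt.rt.fc ∈ H ∧ y.nx.rt.fc ∈ H := by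
  subst hy
  exact FG.third hP (h.c _ (vme _)) (h.c _ (by rw [vt_nx]; exact Sym2.mem_mk_right _ _)) h.n

/-- the distinguished edge of the shape -/
noncomputable def Flag.ep (d : Flag P) : Flag P := d.nx.rt.nx.nx

theorem ep_fc (d : Flag P) : d.ep.fc = d.nx.rt.fc := by simp [Flag.ep]

structure Core (S : Finset (Finset (Sym2 V))) (d : Flag P) : Prop where
  pent : ∀ f ∈ S, f.card = 5
  a : d.fc ∈ S
  a1 : d.nx.rt.fc ∈ S
  a4 : d.st.fc ∈ S
  a5 : d.st.nx.rt.fc ∈ S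
  ns : d.rt.fc ∉ S
  nt : d.st.rt.fc ∉ S
  h1 : d.nx.nx.rt.fc.card = 6
  h2 : d.st.nx.nx.rt.fc.card = 6

theorem Shape2.core {d : Flag P} (h : Shape2 S d) : Core S d :=
  ⟨h.pent, h.a, h.a1, h.a4, h.a5, h.ns, h.nt, h.h1, h.h2⟩

theorem t_fc (hP : IsFullerene P) (d : Flag P) : d.st.rt.fc = d.nx.nx.nx.rt.fc := by
  rw [st, prev hP, ← fc_rt]

theorem st_fc' (hP : IsFullerene P) {d : Flag P} (h : d.fc.card = 5) : d.st.fc = d.rt.rt.fc := by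
  rw [st, fc_rt d.nx.nx.nx.nx, ← prev hP, five' h]

theorem iso_s (hP : IsFullerene P) {d : Flag P} (h : d.fc.card = 5) (h1 : d.fc ∈ S) (h2 : d.st.fc ∈ S) :
    Iso P S d.rt.fc :=
  ⟨d.rv, (fc_rt d).symm, by rwa [← nx_eq, fc_nx], by rwa [← rt_eq, ← st_fc' hP h]⟩

theorem iso_t (hP : IsFullerene P) {d : Flag P} (h : d.fc.card = 5) (h' : d.st.fc.card = 5)
    (h1 : d.fc ∈ S) (h2 : d.st.fc ∈ S) : Iso P S d.st.rt.fc :=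
  iso_s hP h' h2 (by rwa [st_st h h'])

theorem iso_h (hP : IsFullerene P) {d : Flag P} (h1 : d.fc ∈ S) (h2 : d.nx.rt.fc ∈ S) :
    Iso P S d.nx.nx.rt.fc :=
  ⟨d.nx.nx.rv, (fc_rt _).symm, by rw [← nx_eq]; simpa, by rw [← rt_eq, prev hP, ← fc_rt]; exact h2⟩

namespace Core
variable {d : Flag P}

theorem p5 (c : Core S d) : d.fc.card = 5 := c.pent _ c.a
theorem P5 (c : Core S d) : d.st.fc.card = 5 := c.pent _ c.a4

theorem st (c : Core S d) : Core S d.st := by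
  have := st_st c.p5 c.P5
  exact ⟨c.pent, c.a4, c.a5, by rw [this]; exact c.a, by rw [this]; exact c.a1, c.nt, by rw [this]; exact c.ns, c.h2,
    by rw [this]; exact c.h1⟩

theorem isoS (hP : IsFullerene P) (c : Core S d) : Iso P S d.rt.fc := iso_s hP c.p5 c.a c.a4
theorem isoT (hP : IsFullerene P) (c : Core S d) : Iso P S d.st.rt.fc := c.st.isoS hP

/-- enumeration of outer edges on the faces `d.fc`, `d.nx.rt.fc` -/
theorem en (hP : IsFullerene P) (c : Core S d) {x : Flag P} (hx : x.rt.fc ∉ S) (h5 : x.rt.fc.card = 5)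
    (hi : ¬ Iso P S x.rt.fc) (hf : x.fc = d.fc ∨ x.fc = d.nx.rt.fc) :
    x.ed = d.ep.ed ∨ (x.ed = d.nx.rt.nx.ed ∧ x.rt.fc = d.nx.rt.nx.rt.fc) := by
  rcases hf with hf | hf
  · exfalso
    rcases five_cases c.p5 hf with ⟨-, h⟩ | ⟨-, h⟩ | ⟨-, h⟩ | ⟨-, h⟩ | ⟨-, h⟩ <;> rw [h] at hx h5 hi
    · exact hi (c.isoS hP)
    · exact hx c.a1
    · have := c.h1; omega
    · rw [← t_fc hP] at hi; exact hi (c.isoT hP)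
    · exact hx c.a4
  · have q5 := c.pent _ c.a1
    rcases five_cases q5 hf with ⟨-, h⟩ | ⟨h', h⟩ | ⟨h', h⟩ | ⟨-, h⟩ | ⟨-, h⟩
    · exfalso; rw [h, prev hP, ← fc_rt] at hi; exact hi (c.isoS hP)
    · right; exact ⟨h', h⟩
    · left; exact h'
    · exfalso
      have : d.nx.nx.rt = d.nx.rt.nx.nx.nx.rv := by
        have h5' : d.nx.rv.fc.card = 5 := by rwa [← fc_rt]
        rw [rt_eq d.nx, ← prev hP d.nx.rv.nx.nx.nx.nx, five' h5', ← prev hP d.nx, rt3 hP]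
      rw [h, fc_rt, ← this] at h5
      have := c.h1; omega
    · exfalso
      have h5' : d.nx.rv.fc.card = 5 := by rwa [← fc_rt]
      rw [h, rt_eq d.nx, five' h5', ← nx_eq] at hx
      exact hx (by simpa using c.a)

end Core

/-- Lemma E1 -/
theorem E1 (hP : IsFullerene P) (T : Tight P A H M) {d : Flag P} (a : d.fc ∈ A) (a1 : d.nx.rt.fc ∈ A)
    (n2 : d.nx.nx.rt.fc ∉ A) (n3 : d.nx.nx.nx.rt.fc ∉ A) (hs : d.rt.fc ∈ H) (hm : d.ep.rt.fc ∈ H) : False := by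
  have L := PL hP T a
  have L' := PL hP T a1
  have p5 := T.pent _ a1
  have h5' : d.nx.rv.fc.card = 5 := by rwa [← fc_rt]
  have g1 : d.nx.rt.nx.nx.nx.rt.fc = d.nx.nx.rt.fc := by
    rw [fc_rt, rt_eq d.nx, ← prev hP d.nx.rv.nx.nx.nx.nx, five' h5', ← prev hP d.nx, rt3 hP]
  have g2 : d.nx.rt.nx.nx.nx.nx = d.nx.rv := by rw [rt_eq d.nx, five' h5']
  have g3 : d.nx.rt.nx.nx.nx.nx.ed = d.nx.ed := by rw [g2, ed_rv]
  have g4 : d.nx.rt.nx.nx.nx.ed = d.nx.nx.rt.ed := by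
    rw [rt_eq d.nx, ← ed_rv, ← prev hP d.nx.rv.nx.nx.nx.nx, five' h5', ← prev hP d.nx, rt3 hP]
  obtain ⟨v0, v1, v2, v3, v4, -, -, -, -, -, -⟩ := L
  obtain ⟨w0, w1, w2, w3, w4, -, -, -, -, -, -⟩ := L'
  rw [Flag.ep] at hm
  rw [g1] at w3 w4
  rw [g3, g4] at w4
  rw [g4] at w3
  clear v0 v4 w0 w1 w2 g1 g2 g3 g4
  cases v1; cases v2; cases v3; cases w3; cases w4
  grind

/-- pasting on the shape `B2` -/
theorem paste2 (hP : IsFullerene P) {d : Flag P} (c : Shape2 S d) {x : Flag P} (hf : x.fc ∈ S) (hx : x.rt.fc ∉ S)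
    (h5 : x.rt.fc.card = 5) (hi : ¬ Iso P S x.rt.fc) (he : PE P S H M x.ed) :
    ∃ d' : Flag P, Shape2 S d' ∧ x.ed = d'.ep.ed := by
  have key : ∀ d : Flag P, Core S d → (x.fc = d.fc ∨ x.fc = d.nx.rt.fc) → x.ed = d.ep.ed := by
    intro d c hf
    rcases c.en hP hx h5 hi hf with h | ⟨h, -⟩
    · exact h
    · exfalso
      obtain ⟨t1, t2⟩ := he.third hP h
      rw [prev hP, ← fc_rt, prev hP, ← fc_rt] at t1
      refine E1 hP he.T c.a c.a1 ?_ ?_ t1 t2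
      · intro hh; have := c.pent _ hh; have := c.h1; omega
      · rw [← t_fc hP]; exact c.nt
  rcases c.all _ hf with h | h | h | h
  · exact ⟨d, c, key d c.core (Or.inl h)⟩
  · exact ⟨d, c, key d c.core (Or.inr h)⟩
  all_goals
    have cs := c.core.st
    have h' := st_st c.core.p5 c.core.P5
    refine ⟨d.st, ⟨cs.pent, cs.a, cs.a1, cs.a4, cs.a5, ?_, cs.ns, cs.nt, cs.h1, cs.h2⟩, key d.st cs ?_⟩
    · intro f hf; have := c.all f hf; rw [h']; tauto
    · tauto

end FG

namespace FG
open Finset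
open FG.Flag
variable {V : Type} [Fintype V] [DecidableEq V]
set_option linter.unusedSectionVars false
set_option linter.unusedVariables false
variable {P : PlaneGraph V} {A H S : Finset (Finset (Sym2 V))} {M : Finset (Sym2 V)}

theorem gg (hP : IsFullerene P) {d : Flag P} (h : d.nx.rt.fc.card = 5) :
    d.nx.nx.rt = d.nx.rt.nx.nx.nx.rv := by
  have h5' : d.nx.rv.fc.card = 5 := by rwa [← fc_rt]
  rw [rt_eq d.nx, ← prev hP d.nx.rv.nx.nx.nx.nx, five' h5', ← prev hP d.nx, rt3 hP]

theorem gg4 {d : Flag P} (h : d.nx.rt.fc.card = 5) : d.nx.rt.nx.nx.nx.nx = d.nx.rv := by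
  have h5' : d.nx.rv.fc.card = 5 := by rwa [← fc_rt]
  rw [rt_eq d.nx, five' h5']

theorem ss (hP : IsFullerene P) {d : Flag P} (h : d.nx.rt.fc.card = 5) :
    d.nx.nx.rt.s2 = d.nx.rt.nx.nx.nx.s0 := by
  rw [gg hP h, rv_def, s0_s2, s2_s2]

theorem ss1 (hP : IsFullerene P) {d : Flag P} (h0 : d.fc.card = 5) (h : d.nx.rt.fc.card = 5) :
    d.s0.st = d.nx.rt.nx.nx.nx.s0 := by
  rw [st_s0 hP h0, ss hP h]

theorem ss2 (hP : IsFullerene P) {d : Flag P} (h0 : d.fc.card = 5) (h : d.nx.rt.fc.card = 5) :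
    d.s0.st.nx = d.ep.s0 := by
  rw [ss1 hP h0 h, s0_nx]; rfl

theorem ss3 (hP : IsFullerene P) {d : Flag P} (h0 : d.fc.card = 5) (h : d.nx.rt.fc.card = 5) :
    d.s0.st.nx.nx = d.nx.rt.nx.s0 := by
  rw [ss1 hP h0 h, s0_nx, s0_nx]

theorem rv_s0 (d : Flag P) : d.s0.rv = d.rv.s0 := by
  rw [rv_def, rv_def, s0_s2]

theorem rv_st (hP : IsFullerene P) {d : Flag P} (h : d.rv.fc.card = 5) : d.rv.st = d.nx.rt.nx := by
  have h : d.rv.nx.nx.nx.nx = d.nx.rt.rv := by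
    have := prev hP d.rv.nx.nx.nx.nx
    rw [five' h, ← nx_eq] at this
    rw [this, rv_rv]
  rw [Flag.st, h, ← nx_eq]

theorem h_rv (hP : IsFullerene P) {d : Flag P} (h0 : d.fc.card = 5) (h : d.st.fc.card = 5) :
    d.rv.nx.nx.rt.fc = d.st.nx.nx.rt.fc := by
  have h3 := st3 hP h0 h
  have h4 : d.st.nx.nx.nx = d.rt.rv := by rw [← h3, rv_rv]
  have h5 := prev hP d.st.nx.nx
  rw [h4, ← nx_eq, rt_eq d] at h5
  rw [h5, ← fc_rt]

namespace Shape3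
variable {d : Flag P}

theorem p5 (c : Shape3 S d) : d.fc.card = 5 := c.pent _ c.a
theorem P5 (c : Shape3 S d) : d.st.fc.card = 5 := c.pent _ c.a4
theorem s5 (c : Shape3 S d) : d.rv.fc.card = 5 := c.pent _ c.a6
theorem q5 (c : Shape3 S d) : d.nx.rt.fc.card = 5 := c.pent _ c.a1

theorem e1 (hP : IsFullerene P) (c : Shape3 S d) : d.rv.nx.rt.fc = d.st.fc := by
  rw [← rt_eq, ← st_fc' hP c.p5]
theorem e2 (hP : IsFullerene P) (c : Shape3 S d) : d.rv.st.fc = d.nx.rt.fc := by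
  rw [rv_st hP c.s5, fc_nx]

theorem rv (hP : IsFullerene P) (c : Shape3 S d) : Shape3 S d.rv := by
  have e1 := c.e1 hP
  have e2 := c.e2 hP
  refine ⟨c.pent, c.a6, by rw [e1]; exact c.a4, by rw [e2]; exact c.a1, c.a7, by rw [rv_rv]; exact c.a,
    by rw [rv_rv]; exact c.a5, ?_, c.nt', by rw [rv_rv]; exact c.nt, ?_, ?_⟩
  · intro f hf; have := c.all f hf; rw [e1, e2, rv_rv]; tauto
  · rw [h_rv hP c.p5 c.P5]; exact c.h2
  · rw [← h_rv hP c.s5 (by rw [e2]; exact c.q5), rv_rv]; exact c.h1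

theorem s0 (hP : IsFullerene P) (c : Shape3 S d) : Shape3 S d.s0 := by
  have cr := c.rv hP
  have e1 := c.e1 hP
  have e2 := c.e2 hP
  have f1 : d.s0.nx.rt.fc = d.st.fc := by rw [nx_s0 c.p5, s0_rt_fc]; rfl
  have f2 : d.s0.st.fc = d.nx.rt.fc := by rw [ss1 hP c.p5 c.q5]; simp
  have f3 : d.s0.st.nx.rt.fc = d.rv.st.nx.rt.fc := by
    rw [ss2 hP c.p5 c.q5, s0_rt_fc, rv_st hP c.s5]; rfl
  have f4 : d.s0.rv.fc = d.rv.fc := by rw [rv_s0, fc_s0]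
  have f5 : d.s0.rv.st.nx.rt.fc = d.st.nx.rt.fc := by
    have := rv_st hP (d := d.rv) (by rw [rv_rv]; exact c.p5)
    rw [rv_rv] at this
    rw [rv_s0, ss2 hP c.s5 cr.q5, s0_rt_fc, this]; rfl
  refine ⟨c.pent, by rw [fc_s0]; exact c.a, by rw [f1]; exact c.a4, by rw [f2]; exact c.a1, by rw [f3]; exact c.a7,
    by rw [f4]; exact c.a6, by rw [f5]; exact c.a5, ?_, ?_, ?_, ?_, ?_⟩
  · intro f hf; have := c.all f hf; rw [f1, f2, f3, f4, f5, fc_s0]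
    tauto
  · rw [t_fc hP, nx3_s0 c.p5, s0_rt_fc]; exact c.h1
  · rw [t_fc hP, rv_s0, nx3_s0 c.s5, s0_rt_fc]; exact cr.h1
  · rw [nx2_s0 c.p5, s0_rt_fc, ← t_fc hP]; exact c.nt
  · rw [ss3 hP c.p5 c.q5, s0_rt_fc, ← rv_st hP c.s5]; exact c.nt'

theorem en (hP : IsFullerene P) (c : Shape3 S d) {x : Flag P} (hx : x.rt.fc ∉ S)
    (hi : ¬ Iso P S x.rt.fc) (hf : x.fc = d.fc ∨ x.fc = d.nx.rt.fc ∨ x.fc = d.st.nx.rt.fc) :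
    ∃ d' : Flag P, Shape3 S d' ∧ x.ed = d'.st.ep.ed := by
  have cr := c.rv hP
  rcases hf with hf | hf | hf
  · exfalso
    rcases five_cases c.p5 hf with ⟨-, h⟩ | ⟨-, h⟩ | ⟨-, h⟩ | ⟨-, h⟩ | ⟨-, h⟩ <;> rw [h] at hx hi
    · exact hx (by rw [fc_rt]; exact c.a6)
    · exact hx c.a1
    · exact hi (iso_h hP c.a c.a1)
    · rw [← t_fc hP] at hi; exact hi (iso_t hP c.p5 c.P5 c.a c.a4)
    · exact hx c.a4
  · exfalso
    rcases five_cases c.q5 hf with ⟨-, h⟩ | ⟨-, h⟩ | ⟨-, h⟩ | ⟨-, h⟩ | ⟨-, h⟩ <;> rw [h] at hx hi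
    · rw [prev hP] at hx; exact hx c.a6
    · rw [← rv_st hP c.s5] at hi; exact hi (iso_t hP cr.p5 cr.P5 cr.a cr.a4)
    · rw [← rv_st hP c.s5] at hx; exact hx c.a7
    · rw [fc_rt, ← gg hP c.q5] at hi; exact hi (iso_h hP c.a c.a1)
    · rw [gg4 c.q5, ← nx_eq] at hx; exact hx (by simpa using c.a)
  · have y5 := c.pent _ c.a5
    rcases five_cases y5 hf with ⟨-, h⟩ | ⟨h', h⟩ | ⟨h', h⟩ | ⟨-, h⟩ | ⟨-, h⟩
    · exfalso; rw [h, prev hP, ← fc_rt] at hi; exact hi (iso_t hP c.p5 c.P5 c.a c.a4)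
    · refine ⟨d.rv.s0, cr.s0 hP, ?_⟩
      have := rv_st hP (d := d.rv) (by rw [rv_rv]; exact c.p5)
      rw [rv_rv] at this
      have h2 : d.rv.s0.st.nx = d.st.nx.s0 := by rw [ss2 hP c.s5 cr.q5, this]; rfl
      rw [Flag.ep, h2, s0_rt hP, ss hP y5, s0_nx, s0_nx, ed_s0]
      exact h'
    · exact ⟨d, c, h'⟩
    · exfalso; rw [h, fc_rt, ← gg hP y5] at hi; exact hi (iso_h hP c.a4 c.a5)
    · exfalso; rw [h, gg4 y5, ← nx_eq] at hx; exact hx (by simpa using c.a4)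

theorem paste3 (hP : IsFullerene P) (c : Shape3 S d) {x : Flag P} (hf : x.fc ∈ S) (hx : x.rt.fc ∉ S)
    (hi : ¬ Iso P S x.rt.fc) : ∃ d' : Flag P, Shape3 S d' ∧ x.ed = d'.st.ep.ed := by
  have e1 := c.e1 hP
  rcases c.all _ hf with h | h | h | h | h | h
  · exact c.en hP hx hi (Or.inl h)
  · exact c.en hP hx hi (Or.inr (Or.inl h))
  · exact (c.rv hP).en hP hx hi (Or.inr (Or.inl (by rw [e1]; exact h)))
  · exact c.en hP hx hi (Or.inr (Or.inr h))
  · exact (c.rv hP).en hP hx hi (Or.inl h)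
  · exact (c.rv hP).en hP hx hi (Or.inr (Or.inr h))
end Shape3

end FG

namespace FG
open Finset
open FG.Flag
variable {V : Type} [Fintype V] [DecidableEq V]
set_option linter.unusedSectionVars false
set_option linter.unusedVariables false
variable {P : PlaneGraph V} {A H S C : Finset (Finset (Sym2 V))} {M : Finset (Sym2 V)} {e : Sym2 V}

/-- two sets of pentagons pasted along `e` -/
structure Pst (P : PlaneGraph V) (S C : Finset (Finset (Sym2 V))) (e : Sym2 V) : Prop where
  sS : S ⊆ P.faces
  sC : C ⊆ P.faces
  pS : ∀ f ∈ S, f.card = 5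
  pC : ∀ f ∈ C, f.card = 5
  int : S.sup id ∩ C.sup id = {e}
  eS : IsPastingEdge P (S.sup id) e
  eC : IsPastingEdge P (C.sup id) e

namespace Pst

theorem symm (h : Pst P S C e) : Pst P C S e :=
  ⟨h.sC, h.sS, h.pC, h.pS, by rw [inter_comm]; exact h.int, h.eC, h.eS⟩

theorem uniq (h : Pst P S C e) {a : Sym2 V} (h1 : a ∈ S.sup id) (h2 : a ∈ C.sup id) : a = e := by
  have : a ∈ S.sup id ∩ C.sup id := mem_inter.2 ⟨h1, h2⟩
  rw [h.int] at this; exact mem_singleton.1 this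

theorem uq (h : Pst P S C e) {y : Flag P} (h1 : y.fc ∈ S) (h2 : y.rt.fc ∈ C) : y.ed = e :=
  h.uniq ((ed_mem h.sS _).2 (Or.inl h1)) ((ed_mem h.sC _).2 (Or.inr h2))

theorem uq' (h : Pst P S C e) {y : Flag P} (h1 : y.fc ∈ C) (h2 : y.rt.fc ∈ S) : y.ed = e :=
  h.symm.uq h1 h2

theorem disj (hP : IsFullerene P) (h : Pst P S C e) {f} (h1 : f ∈ S) : f ∉ C := by
  intro h2
  obtain ⟨x, rfl⟩ := exists_flag_face (h.sS h1)
  have a := h.uniq (a := x.ed) ((ed_mem h.sS _).2 (Or.inl h1)) ((ed_mem h.sC _).2 (Or.inl h2))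
  have b := h.uniq (a := x.nx.ed) ((ed_mem h.sS _).2 (Or.inl (by simpa))) ((ed_mem h.sC _).2 (Or.inl (by simpa)))
  exact ed_nx_ne hP x (b.trans a.symm)

theorem iso (hP : IsFullerene P) (h : Pst P S C e) {f} (h1 : Iso P S f) : f ∉ C := by
  intro h2
  obtain ⟨x, rfl, h3, h4⟩ := h1
  exact ed_nx_ne hP x ((h.uq' (y := x.nx) (by simpa) h4).trans (h.uq' h2 h3).symm)

theorem flag (hP : IsFullerene P) (h : Pst P S C e) : ∃ x : Flag P, x.ed = e ∧ x.fc ∈ S ∧ x.rt.fc ∈ C ∧ x.rt.fc ∉ S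
    ∧ x.rt.fc.card = 5 ∧ ¬ Iso P S x.rt.fc := by
  obtain ⟨f, hf, hef⟩ := Flag.mem_sup.1 h.eS.1
  obtain ⟨x, h1, h2, -⟩ := flag_of_face (h.sS hf) hef (Sym2.out_fst_mem e)
  subst h1
  have h3 : x.rt.fc ∈ C := by
    have := h.eC.1
    rw [← h2, ed_mem h.sC] at this
    rcases this with this | this
    · exact absurd this (h.disj hP hf)
    · exact this
  exact ⟨x, h2, hf, h3, h.symm.disj hP h3, h.pC _ h3, fun hi => h.iso hP hi h3⟩

theorem pe (hP : IsFullerene P) (h : Pst P S C e) (hE : Ext P S) : ∃ H M, PE P S H M e :=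
  PE_of hP h.sS h.pS hE h.eS

theorem ext (hP : IsFullerene P) (h : Pst P S C e) (hE : Ext P S) (hc : C.card = 1) : Ext P (S ∪ C) := by
  obtain ⟨x, rfl, hx, hxC, hxS, h5, -⟩ := h.flag hP
  obtain ⟨g, rfl⟩ := card_eq_one.1 hc
  have hg := mem_singleton.1 hxC
  subst hg
  obtain ⟨-, H, h1, h2, h3⟩ := h.eS
  obtain ⟨h4, h6, M, -, -, h7⟩ := clar_tight hP h.sS h.pS hE h1
  have hn : ∀ f ∈ H, x.ed ∉ f := fun f hf hef => h3 (Flag.mem_sup.2 ⟨f, hf, hef⟩)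
  have hcv : ∀ y : Flag P, y.vt ∈ x.ed → cov H y := fun y hy => by
    have := h2 _ hy
    rwa [facesVerts, vt_mem hP h6] at this
  have e1 : x.rv.fc = x.rt.fc := (fc_rt _).symm
  have := paste_adm hP h.sS (x := x.rv) (H := H) (by rwa [e1]) (by rwa [e1]) (by rw [← nx_eq]; simpa) ?_ h1.1
    (hcv _ (by rw [vt_rv]; exact Sym2.mem_mk_right _ _)) (hcv _ (by rw [vt_nx, wt_rv]; exact Sym2.mem_mk_left _ _)) (by simpa)
  · rw [e1, h4] at this
    refine ⟨H, ?_, ?_⟩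
    · rw [union_comm]; exact this.1
    · rw [union_comm]
      change _ ≤ (insert x.rt.fc S).card
      rw [card_insert_of_notMem hxS]; exact this.2
  · intro y hy h'
    rw [ed_rv]
    exact h.uniq h' ((ed_mem h.sC _).2 (Or.inl (by rw [hy, e1]; exact hxC)))

/-- a pentagon used in pasting is extremal -/
theorem ext1 (hP : IsFullerene P) (h : Pst P S C e) (hc : S.card = 1) : Ext P S := by
  obtain ⟨x, rfl, hx, -⟩ := h.flag hP
  obtain ⟨g, rfl⟩ := card_eq_one.1 hc
  have hg := mem_singleton.1 hx
  subst hg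
  obtain ⟨-, H, h1, h2, h3⟩ := h.eS
  have h6 : H ⊆ P.faces := fun f hf => (h1.1.1 f hf).1
  have hn : ∀ f ∈ H, x.ed ∉ f := fun f hf hef => h3 (Flag.mem_sup.2 ⟨f, hf, hef⟩)
  have hcv : ∀ y : Flag P, y.vt ∈ x.ed → cov H y := fun y hy => by
    have := h2 _ hy
    rwa [facesVerts, vt_mem hP h6] at this
  refine ⟨H, h1.1, ?_⟩
  have := pent_ext hP (h.pS _ hx) h1.1 (hcv _ (Sym2.mem_mk_left _ _)) (hcv _ (by rw [vt_nx]; exact Sym2.mem_mk_right _ _)) hn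
  simpa using this

end Pst

theorem Pst.of {B A C : Fragment P} (h : IsPasting B A C) (hA : IsPentagonalFragment A) (hC : IsPentagonalFragment C) :
    ∃ e, Pst P A.inFaces C.inFaces e := by
  obtain ⟨-, e, h1, h2, h3⟩ := h
  exact ⟨e, A.subFaces, C.subFaces, hA, hC, h1, h2, h3⟩

theorem pent_union (h : Pst P S C e) : ∀ f ∈ S ∪ C, f.card = 5 := by
  intro f hf
  rcases mem_union.1 hf with hf | hf
  · exact h.pS f hf
  · exact h.pC f hf

theorem not_union (hP : IsFullerene P) (h : Pst P S C e) {f} (h1 : f ∉ S) (h2 : Iso P S f) : f ∉ S ∪ C := by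
  rw [mem_union]; rintro (h' | h')
  · exact h1 h'
  · exact h.iso hP h2 h'

theorem Core.mono (hP : IsFullerene P) {d : Flag P} (c : Core S d) (h : Pst P S C e) : Core (S ∪ C) d :=
  ⟨pent_union h, mem_union_left _ c.a, mem_union_left _ c.a1, mem_union_left _ c.a4, mem_union_left _ c.a5,
    not_union hP h c.ns (c.isoS hP), not_union hP h c.nt (c.isoT hP), c.h1, c.h2⟩

/-- a `B3` with something attached -/
def Bad3 (S : Finset (Finset (Sym2 V))) (d : Flag P) : Prop :=
  (∀ f ∈ S, f.card = 5) ∧ d.fc ∈ S ∧ d.nx.rt.fc ∈ S ∧ d.st.fc ∈ S ∧ d.st.nx.rt.fc ∈ S ∧ d.rv.fc ∈ S ∧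
  d.rv.st.nx.rt.fc ∈ S ∧ d.st.ep.rt.fc ∈ S ∧
  (d.st.rt.fc ∉ S ∧ Iso P S d.st.rt.fc) ∧ (d.rv.st.rt.fc ∉ S ∧ Iso P S d.rv.st.rt.fc) ∧
  (d.nx.nx.rt.fc ∉ S ∧ Iso P S d.nx.nx.rt.fc) ∧ (d.st.nx.nx.rt.fc ∉ S ∧ Iso P S d.st.nx.nx.rt.fc)

def Bad2 (S : Finset (Finset (Sym2 V))) (d d' : Flag P) : Prop :=
  Core S d ∧ Core S d' ∧ (d'.ep = d.ep.rv ∨ d'.ep = d.ep.s2)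

theorem Bad3.mono (hP : IsFullerene P) {d : Flag P} (c : Bad3 S d) (h : Pst P S C e) : Bad3 (S ∪ C) d := by
  have key : ∀ {f}, (f ∉ S ∧ Iso P S f) → f ∉ S ∪ C ∧ Iso P (S ∪ C) f := fun h' =>
    ⟨not_union hP h h'.1 h'.2, h'.2.mono subset_union_left⟩
  obtain ⟨-, a1, a2, a3, a4, a5, a6, a7, b1, b2, b3, b4⟩ := c
  exact ⟨pent_union h, mem_union_left _ a1, mem_union_left _ a2, mem_union_left _ a3, mem_union_left _ a4,
    mem_union_left _ a5, mem_union_left _ a6, mem_union_left _ a7, key b1, key b2, key b3, key b4⟩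

theorem Bad2.mono (hP : IsFullerene P) {d d' : Flag P} (c : Bad2 S d d') (h : Pst P S C e) : Bad2 (S ∪ C) d d' :=
  ⟨c.1.mono hP h, c.2.1.mono hP h, c.2.2⟩

theorem bad3_of (hP : IsFullerene P) {d : Flag P} (c : Shape3 S d) (h : Pst P S C e) : ∃ d' : Flag P, Bad3 (S ∪ C) d' := by
  obtain ⟨x, rfl, hx, hxC, hxS, h5, hi⟩ := h.flag hP
  obtain ⟨d, c, he⟩ := c.paste3 hP hx hxS hi
  have cr := c.rv hP
  have key : ∀ {f}, f ∉ S → Iso P S f → f ∉ S ∪ C ∧ Iso P (S ∪ C) f := fun h1 h2 =>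
    ⟨not_union hP h h1 h2, h2.mono subset_union_left⟩
  refine ⟨d, pent_union h, mem_union_left _ c.a, mem_union_left _ c.a1, mem_union_left _ c.a4, mem_union_left _ c.a5,
    mem_union_left _ c.a6, mem_union_left _ c.a7, ?_, key c.nt (iso_t hP c.p5 c.P5 c.a c.a4),
    key c.nt' (iso_t hP cr.p5 cr.P5 cr.a cr.a4), key c.h1 (iso_h hP c.a c.a1), key c.h2 (iso_h hP c.a4 c.a5)⟩
  have hf : d.st.ep.fc ∈ S := by rw [ep_fc]; exact c.a5
  have : d.st.ep.rt.fc = x.rt.fc := by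
    rcases eq_e he.symm with h' | h' | h' | h'
    · rw [h']
    · rw [h', s0_rt_fc]
    · rw [h'] at hf; rw [fc_s2] at hf; exact absurd hf hxS
    · rw [h', ← fc_rt] at hf; exact absurd hf hxS
  rw [this]; exact mem_union_right _ hxC

theorem bad2_of (hP : IsFullerene P) {d d' : Flag P} (c : Core S d) (c' : Core C d') (h : Pst P S C e)
    (h1 : e = d.ep.ed) (h2 : e = d'.ep.ed) : Bad2 (S ∪ C) d d' := by
  refine ⟨c.mono hP h, by rw [union_comm]; exact c'.mono hP h.symm, ?_⟩
  have hf : d.ep.fc ∈ S := by rw [ep_fc]; exact c.a1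
  have hf' : d'.ep.fc ∈ C := by rw [ep_fc]; exact c'.a1
  rcases eq_e (h2.symm.trans h1) with h' | h' | h' | h'
  · rw [h'] at hf'; exact absurd hf' (h.disj hP hf)
  · rw [h', fc_s0] at hf'; exact absurd hf' (h.disj hP hf)
  · right; exact h'
  · left; exact h'

end FG

namespace FG
open Finset
open FG.Flag
variable {V : Type} [Fintype V] [DecidableEq V]
set_option linter.unusedSectionVars false
set_option linter.unusedVariables false
variable {P : PlaneGraph V} {A H S C : Finset (Finset (Sym2 V))} {M : Finset (Sym2 V)} {e : Sym2 V}

/-- two pentagons -/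
structure PPS (S : Finset (Finset (Sym2 V))) (x : Flag P) : Prop where
  pent : ∀ f ∈ S, f.card = 5
  a : x.fc ∈ S
  b : x.rt.fc ∈ S
  all : ∀ f ∈ S, f = x.fc ∨ f = x.rt.fc
  one : ∀ y : Flag P, y.fc = x.fc → y.rt.fc = x.rt.fc → y.ed = x.ed
  h1 : x.rt.rt.fc.card = 6
  h2 : x.nx.rt.fc.card = 6

namespace PPS
variable {x : Flag P}

theorem rv (hP : IsFullerene P) (c : PPS S x) : PPS S x.rv := by
  have e1 : x.rv.rt.fc = x.fc := by rw [← nx_eq, fc_nx]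
  have e2 : x.rv.fc = x.rt.fc := (fc_rt x).symm
  refine ⟨c.pent, by rw [e2]; exact c.b, by rw [e1]; exact c.a, fun f hf => by rw [e1, e2]; exact (c.all f hf).symm, ?_, ?_, ?_⟩
  · intro y h1 h2
    rw [ed_rv]
    rw [e1] at h2; rw [e2] at h1
    rw [← c.one y.rv (by rw [← h2, fc_rt]) (by rw [← nx_eq, fc_nx, h1]), ed_rv]
  · rw [← nx_eq]; exact c.h2
  · rw [← rt_eq]; exact c.h1

theorem x4 (hP : IsFullerene P) (h : x.fc.card = 5) : x.nx.nx.nx.nx.rt.fc = x.rt.rt.fc := by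
  rw [← st_fc, st_fc' hP h]

theorem s0 (hP : IsFullerene P) (c : PPS S x) : PPS S x.s0 := by
  have h5 := c.pent _ c.a
  refine ⟨c.pent, by simpa using c.a, by rw [s0_rt_fc]; exact c.b, fun f hf => by rw [s0_rt_fc, fc_s0]; exact c.all f hf, ?_, ?_, ?_⟩
  · intro y h1 h2
    rw [s0_rt_fc] at h2
    rw [ed_s0]; exact c.one y (by simpa using h1) h2
  · rw [s0_rt hP, ← fc_s2, s2_s2]; exact c.h2
  · rw [nx_s0 h5, s0_rt_fc, x4 hP h5]; exact c.h1

theorem key (hP : IsFullerene P) (c : PPS S x) (he : PE P S H M x.nx.nx.ed) : False := by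
  have h5 := c.pent _ c.a
  obtain ⟨t1, t2⟩ := he.third hP rfl
  rw [prev hP, ← fc_rt] at t1
  have T := he.T
  have L := PL hP T c.a
  have cr := c.rv hP
  have L' := PL hP T cr.a
  obtain ⟨v0, v1, -, -, v4, -, -, -, -, -, -⟩ := L
  have w2 := L'.v2
  have hb := c.b
  have e1 : x.rv.nx.ed = x.rt.ed := by rw [← rt_eq]
  rw [e1] at w2
  have n : x.rv.nx.nx.rt.fc ∉ S := by
    intro hn
    have hp := cr.pent _ cr.a
    rcases cr.all _ hn with h | h
    · exact fc_rt_ne x.rv.nx.nx (by rw [h]; simp)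
    · have := cr.one x.rv.nx.nx (by simp) h
      obtain ⟨k1, k2, k3, k4⟩ := PLne hp
      obtain ⟨l1, l2, l3, l4⟩ := PLne (x := x.rv.nx) (by simpa)
      rcases Sym2.eq_iff.1 this with ⟨h, -⟩ | ⟨h, -⟩
      · exact k2 h.symm
      · exact l1 (by rw [h, vt_nx])
  cases v0; cases v1; cases v4; cases w2
  clear L' e1 cr
  grind

theorem no (hP : IsFullerene P) (c : PPS S x) {y : Flag P} (hy : y.fc ∈ S) (hyS : y.rt.fc ∉ S)
    (h5 : y.rt.fc.card = 5) (he : PE P S H M y.ed) : False := by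
  have key : ∀ x : Flag P, PPS S x → y.fc = x.fc → False := by
    intro x c hf
    have p5 := c.pent _ c.a
    rcases five_cases p5 hf with ⟨h, h'⟩ | ⟨h, h'⟩ | ⟨h, h'⟩ | ⟨h, h'⟩ | ⟨h, h'⟩
    · exact hyS (by rw [h']; exact c.b)
    · rw [h', c.h2] at h5; omega
    · rw [h] at he; exact c.key hP he
    · rw [h, ← ed_s0, ← nx2_s0 p5] at he
      exact (c.s0 hP).key hP he
    · rw [h', x4 hP p5, c.h1] at h5; omega
  rcases c.all _ hy with h | h
  · exact key x c h
  · exact key x.rv (c.rv hP) (by rw [h, fc_rt])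

theorem of (hP : IsFullerene P) (h : Pst P S C e) (h1 : S.card = 1) (h2 : C.card = 1) :
    (∃ x : Flag P, PPS (S ∪ C) x) ∧ Ext P (S ∪ C) := by
  have hE := h.ext1 hP h1
  refine ⟨?_, h.ext hP hE h2⟩
  obtain ⟨H, M, he⟩ := h.pe hP hE
  obtain ⟨x, rfl, hx, hxC, hxS, h5, hi⟩ := h.flag hP
  obtain ⟨t1, t2⟩ := he.third hP rfl
  refine ⟨x, pent_union h, mem_union_left _ hx, mem_union_right _ hxC, ?_, ?_, he.T.hex _ t1, he.T.hex _ t2⟩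
  · intro f hf
    rcases mem_union.1 hf with hf | hf
    · left; exact card_le_one.1 h1.le _ hf _ hx
    · right; exact card_le_one.1 h2.le _ hf _ hxC
  · intro y y1 y2
    exact h.uq (by rw [y1]; exact hx) (by rw [y2]; exact hxC)

end PPS

end FG

namespace FG
open Finset
open FG.Flag
variable {V : Type} [Fintype V] [DecidableEq V]
set_option linter.unusedSectionVars false
set_option linter.unusedVariables false
variable {P : PlaneGraph V} {A H S C : Finset (Finset (Sym2 V))} {M : Finset (Sym2 V)} {e : Sym2 V}

theorem rt_mem {x y : Flag P} (h : x.ed = y.ed) (h1 : y.fc ∈ S) (h2 : y.rt.fc ∈ S) : x.rt.fc ∈ S := by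
  rcases eq_e h with rfl | rfl | rfl | rfl
  · exact h2
  · rw [s0_rt_fc]; exact h2
  · rw [← fc_s2, s2_s2]; exact h1
  · rw [← nx_eq, fc_nx]; exact h1

/-- identities at the attached pentagon -/
structure QI (d : Flag P) : Prop where
  i0 : d.ep.rv.rt.fc = d.nx.rt.fc
  i1 : d.ep.rv.nx.rt.fc = d.nx.rt.nx.rt.fc
  i4 : d.ep.rv.nx.nx.nx.nx.rt.fc = d.nx.nx.rt.fc
  j0 : d.ep.rv.ed = d.nx.rt.nx.nx.ed
  j1 : d.nx.rt.nx.nx.rt.ed = d.ep.rv.nx.ed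
  j4 : d.nx.rt.nx.nx.nx.rt.ed = d.ep.rv.nx.nx.nx.nx.ed

theorem qi (hP : IsFullerene P) {d : Flag P} (h : d.nx.rt.fc.card = 5) (h' : d.ep.rt.fc.card = 5) : QI d := by
  have h5 : d.ep.rv.fc.card = 5 := by rwa [← fc_rt]
  refine ⟨by rw [← nx_eq, fc_nx, ep_fc], ?_, ?_, by rw [ed_rv]; rfl, ?_, ?_⟩
  · rw [← rt_eq, Flag.ep, prev hP, ← fc_rt]
  · rw [PPS.x4 hP h5, ← nx_eq, Flag.ep, fc_rt, ← gg hP h]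
  · rw [← rt_eq]; rfl
  · have := prev hP d.ep.rv.nx.nx.nx.nx
    rw [five' h5, ← nx_eq] at this
    have h2 : d.nx.rt.nx.nx.nx.rt = d.ep.rv.nx.nx.nx.nx.rv := this
    rw [h2, ed_rv]

namespace Core
variable {d : Flag P}

theorem isoK (hP : IsFullerene P) (c : Core S d) (hq : d.ep.rt.fc ∈ S) : Iso P S d.nx.rt.nx.rt.fc := by
  have := iso_h hP (d := d.ep.rv.nx.nx.nx.nx) (S := S)
  have h5 : d.ep.rv.fc.card = 5 := by rw [← fc_rt]; exact c.pent _ hq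
  rw [five' h5] at this
  have q := qi hP (c.pent _ c.a1) (c.pent _ hq)
  rw [q.i0, q.i1] at this
  exact this (by simpa [← fc_rt] using hq) c.a1

theorem Q (hP : IsFullerene P) (c : Core S d) (hq : d.ep.rt.fc ∈ S) {x : Flag P} (hx : x.rt.fc ∉ S)
    (h5 : x.rt.fc.card = 5) (hi : ¬ Iso P S x.rt.fc) (hf : x.fc = d.ep.rt.fc) :
    x.ed = d.ep.rv.nx.nx.ed ∨ x.ed = d.ep.rv.nx.nx.nx.ed := by
  have q := qi hP (c.pent _ c.a1) (c.pent _ hq)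
  have q5 : d.ep.rv.fc.card = 5 := by rw [← fc_rt]; exact c.pent _ hq
  rw [fc_rt] at hf
  rcases five_cases q5 hf with ⟨-, h⟩ | ⟨-, h⟩ | ⟨h, -⟩ | ⟨h, -⟩ | ⟨-, h⟩
  · rw [h, q.i0] at hx; exact absurd c.a1 hx
  · rw [h, q.i1] at hi; exact absurd (c.isoK hP hq) hi
  · exact Or.inl h
  · exact Or.inr h
  · rw [h, q.i4, c.h1] at h5; omega

theorem F1 (hP : IsFullerene P) (c : Core S d) (hq : d.ep.rt.fc ∈ S) (he : PE P S H M d.ep.rv.nx.nx.nx.ed) : False := by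
  have q := qi hP (c.pent _ c.a1) (c.pent _ hq)
  obtain ⟨t1, t2⟩ := he.third hP rfl
  rw [prev hP, ← fc_rt] at t1
  rw [q.i4] at t2
  have L := PL hP he.T c.a1
  have L' := PL hP he.T (x := d.ep.rv) (by rw [← fc_rt]; exact hq)
  obtain ⟨v0, v1, v2, v3, v4, -, -, -, -, -, -⟩ := L
  obtain ⟨w0, w1, w2, w3, w4, -, -, -, -, -, -⟩ := L'
  have e0 : d.nx.rt.rt.fc = d.rt.fc := by rw [prev hP, ← fc_rt]
  have e3 : d.nx.rt.nx.nx.nx.rt.fc = d.nx.nx.rt.fc := by rw [fc_rt, ← gg hP (c.pent _ c.a1)]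
  have e2 : d.nx.rt.nx.nx.rt.fc ∈ S := hq
  have ns := c.ns
  rw [q.i1] at w2
  rw [q.j1] at v2
  rw [e0] at v1
  rw [e3] at v3
  cases v1; cases v2; cases v3; cases w2
  clear v0 v4 w0 w1 w3 w4
  grind

structure F2S (A H : Finset (Finset (Sym2 V))) (M : Finset (Sym2 V)) (d : Flag P) : Prop where
  m1 : d.ed ∈ M
  m2 : d.nx.rt.nx.nx.nx.ed ∈ M
  t : d.nx.nx.nx.rt.fc ∈ H
  h : d.st.nx.nx.rt.fc ∈ H
  k : d.nx.rt.nx.rt.fc ∈ H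
  c1 : chg A H M d.nx.nx
  c2 : chg A H M d.ep.rv
  c3 : chg A H M d.nx.rt
  c4 : chg A H M d.st.nx.nx.nx.nx

theorem F2 (hP : IsFullerene P) (c : Core S d) (hq : d.ep.rt.fc ∈ S) (he : PE P S H M d.ep.rv.nx.nx.ed) :
    F2S S H M d := by
  have q := qi hP (c.pent _ c.a1) (c.pent _ hq)
  have T := he.T
  have q5 := c.pent _ c.a1
  have r5 : d.ep.rv.fc.card = 5 := by rw [← fc_rt]; exact c.pent _ hq
  obtain ⟨t1, t2⟩ := he.third hP rfl
  rw [prev hP, ← fc_rt, q.i1] at t1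
  have L := PL hP he.T c.a1
  have L' := PL hP he.T (x := d.ep.rv) (by rw [← fc_rt]; exact hq)
  have LD := PL hP he.T c.a4
  obtain ⟨z0, z1, z2, z3, z4, -, -, -, -, -, -⟩ := LD
  have zp := (PL hP he.T c.a4).p34
  have Lp := PL hP he.T c.a
  obtain ⟨p0, p1, p2, p3, p4, -, -, -, -, -, -⟩ := Lp
  have pp := (PL hP he.T c.a).p23
  obtain ⟨v0, v1, v2, v3, v4, -, -, -, -, -, -⟩ := L
  obtain ⟨w0, w1, w2, w3, w4, -, -, -, -, -, -⟩ := L'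
  have e0 : d.nx.rt.rt.fc = d.rt.fc := by rw [prev hP, ← fc_rt]
  have e3 : d.nx.rt.nx.nx.nx.rt.fc = d.nx.nx.rt.fc := by rw [fc_rt, ← gg hP (c.pent _ c.a1)]
  have e2 : d.nx.rt.nx.nx.rt.fc ∈ S := hq
  have e4 : d.nx.rt.nx.nx.nx.nx.rt.fc = d.fc := by rw [gg4 q5, ← nx_eq]; simp
  have e5 : d.nx.rt.rt.ed = d.ed := by rw [prev hP, ed_rv]
  have e6 : d.nx.nx.rt.ed = d.nx.rt.nx.nx.nx.ed := by rw [gg hP q5, ed_rv]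
  have e7 : d.st.nx.nx.nx.rt.fc = d.rt.fc := by rw [fc_rt, st3 hP c.p5 c.P5]
  have e8 : d.st.nx.nx.nx.nx.rt.fc = d.fc := by rw [st4 c.P5, ← nx_eq]; simp
  have e9 : d.st.nx.nx.nx.nx.rt.ed = d.ed := by rw [st4 c.P5, ← nx_eq, five' c.p5]
  have e10 : d.st.rt.fc = d.nx.nx.nx.rt.fc := t_fc hP d
  have ns := c.ns
  have nt := c.nt
  have a := c.a
  have a1 := c.a1
  have a4 := c.a4
  have nhc : d.nx.nx.rt.fc ∉ S := fun hh => by have := c.pent _ hh; have := c.h1; omega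
  have nh : d.st.nx.nx.rt.fc ∉ S := fun hh => by have := c.pent _ hh; have := c.h2; omega
  rw [q.i4] at w4 w0
  rw [q.i0] at w0
  rw [q.j0] at w0
  rw [q.j1] at v2
  rw [q.j4] at v3
  rw [e0] at v1 v0
  rw [e3] at v3 v4
  rw [e4] at v4 v0
  rw [e5] at v0
  rw [e6] at p2
  rw [e7] at z3 z4 zp
  rw [e8] at z4 zp
  rw [e9] at z4
  rw [e10] at nt
  have x1 : d.nx.nx.rt.fc ∉ H := (fun h => w4.r1 h t2)
  have x2 : d.nx.rt.nx.nx.nx.ed ∈ M := by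
    clear z0 z1 z2 z3 z4 zp p0 p1 p2 p3 p4 pp v0 v1 v4 w0 w1 w2 w3
    cases v3; cases v2; cases w4
    grind
  have x3 : d.rt.fc ∉ H := v1.r1 t1
  have x4 : d.ed ∈ M := by
    clear z0 z1 z2 z3 z4 zp p0 p1 p2 p3 p4 pp v2 v3 w0 w1 w2 w3 w4
    have := T.toRules.hA a
    have m4 : d.nx.rt.nx.nx.nx.nx.ed ∉ M := fun h => v4.r3 h x2
    have m0 : d.nx.rt.ed ∉ M := fun h => v1.r8 h t1
    rcases v0.r12 (Or.inr a) x3 this with h | h | h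
    · exact absurd h m0
    · exact h
    · exact absurd h m4
  have x5 : d.nx.nx.nx.rt.fc ∈ H := by
    by_contra ht
    have m2 : d.nx.nx.ed ∉ M := fun h => p2.r4 h x2
    have m1 : d.nx.ed ∉ M := fun h => p2.r5 x2 h
    have := T.toRules.hA a1
    have m3 : d.nx.nx.nx.ed ∉ M := by
      rcases p3.r14 ht x1 with h | h | h
      · exact h.1
      · exact absurd h.1 nt
      · exact absurd h.1 nhc
    exact pp x1 this m2 m1 ht x1 m3 m2
  have pA : d.fc ∉ H := T.toRules.hA a
  have zm4 : d.st.nx.nx.nx.nx.ed ∉ M := fun h => z4.r4 h x4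
  have zm3 : d.st.nx.nx.nx.ed ∉ M := fun h => z4.r5 x4 h
  have x6 : d.st.nx.nx.rt.fc ∈ H := by
    by_contra hh
    rcases z3.r14 x3 hh with h | h | h
    · exact zp x3 hh zm3 h.2 pA x3 zm4 zm3
    · exact ns h.1
    · exact nh h.1
  refine ⟨x4, x2, x5, x6, t1, ?_, ?_, ?_, ?_⟩
  · rw [chgN hP T.toRules (by simpa using a)]
    exact ⟨x1, T.toRules.hA a1, fun h => p2.r4 h x2, fun h => p2.r5 x2 h⟩
  · rw [← five' r5, chgN hP T.toRules (by rw [fc_nx, fc_nx, fc_nx, fc_nx, ← fc_rt]; exact hq), five' r5, q.i0, q.i4, q.j0]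
    refine ⟨T.toRules.hA a1, x1, fun h => v2.r7 h t1, fun h => w4.r7 h t2⟩
  · rw [← five' q5, chgN hP T.toRules (by simpa using a1), five' q5, e0, e4]
    exact ⟨x3, pA, fun h => v1.r8 h t1, fun h => v4.r3 h x2⟩
  · rw [chgN hP T.toRules (by simpa using a4), e7, e8]
    exact ⟨pA, x3, zm4, zm3⟩

end Core
end FG

namespace FG
open Finset
open FG.Flag
variable {V : Type} [Fintype V] [DecidableEq V]
set_option linter.unusedSectionVars false
set_option linter.unusedVariables false
variable {P : PlaneGraph V} {A H S C : Finset (Finset (Sym2 V))} {M : Finset (Sym2 V)} {e : Sym2 V}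

structure PB2S (S : Finset (Finset (Sym2 V))) (d : Flag P) : Prop where
  c : Core S d
  q : d.ep.rt.fc ∈ S
  all : ∀ f ∈ S, f = d.fc ∨ f = d.nx.rt.fc ∨ f = d.st.fc ∨ f = d.st.nx.rt.fc ∨ f = d.ep.rt.fc

structure PB2PS (S : Finset (Finset (Sym2 V))) (d : Flag P) : Prop where
  c : Core S d
  q : d.ep.rt.fc ∈ S
  r : d.st.ep.rt.fc ∈ S
  card : S.card = 6
  all : ∀ f ∈ S, f = d.fc ∨ f = d.nx.rt.fc ∨ f = d.st.fc ∨ f = d.st.nx.rt.fc ∨ f = d.ep.rt.fc ∨ f = d.st.ep.rt.fc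

theorem PB2S.sw (hP : IsFullerene P) {d : Flag P} (b : PB2S S d) (f : Core.F2S S H M d) (T : Rules P S H M) :
    PB2S S d.s0 ∧ d.s0.st.ep.ed = d.ep.rv.nx.nx.ed := by
  have c := b.c
  have p5 := c.p5
  have q5 := c.pent _ c.a1
  have r5 := c.pent _ b.q
  have f1 : d.s0.nx.rt.fc = d.st.fc := by rw [nx_s0 p5, s0_rt_fc]; rfl
  have f2 : d.s0.st.fc = d.nx.rt.fc := by rw [ss1 hP p5 q5]; simp
  have f3 : d.s0.st.nx.rt.fc = d.ep.rt.fc := by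
    rw [ss2 hP p5 q5, s0_rt_fc]
  have f4 : d.s0.ep.rt.fc = d.st.nx.rt.fc := by
    have h1 : d.rt.s2 = d.st.nx.nx.nx.s0 := by
      rw [← st3 hP p5 c.P5, rv_def, s0_s2, s2_s2]
    rw [Flag.ep, nx_s0 p5, s0_rt hP, five' p5, h1, s0_nx, s0_nx, s0_rt_fc]
  have nhc : d.nx.nx.rt.fc ∉ S := fun hh => by have := c.pent _ hh; have := c.h1; omega
  refine ⟨⟨⟨c.pent, by rw [fc_s0]; exact c.a, by rw [f1]; exact c.a4, by rw [f2]; exact c.a1, by rw [f3]; exact b.q,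
    by rw [s0_rt_fc]; exact c.ns, ?_, ?_, ?_⟩, by rw [f4]; exact c.a5, ?_⟩, ?_⟩
  · rw [t_fc hP, nx3_s0 p5, s0_rt_fc]; exact nhc
  · rw [nx2_s0 p5, s0_rt_fc]; exact T.hex _ f.t
  · rw [ss3 hP p5 q5, s0_rt_fc]; exact T.hex _ f.k
  · intro g hg; have := b.all g hg; rw [f1, f2, f3, f4, fc_s0]; tauto
  · rw [Flag.ep, ss2 hP p5 q5, s0_rt hP]
    have h1 := ss hP (d := d.nx.rt.nx) (by exact r5)
    have h2 : d.ep.nx.rt.s2 = d.ep.rt.nx.nx.nx.s0 := h1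
    rw [h2, s0_nx, s0_nx, ed_s0, rt_eq]

theorem PB2S.en (hP : IsFullerene P) {d : Flag P} (b : PB2S S d) {x : Flag P} (hf : x.fc ∈ S) (hx : x.rt.fc ∉ S)
    (h5 : x.rt.fc.card = 5) (hi : ¬ Iso P S x.rt.fc) (he : PE P S H M x.ed) :
    ∃ d' : Flag P, PB2S S d' ∧ x.ed = d'.st.ep.ed := by
  have c := b.c
  have k1 : x.fc = d.fc ∨ x.fc = d.nx.rt.fc → False := by
    intro h
    rcases c.en hP hx h5 hi h with h | ⟨-, h⟩
    · exact hx (rt_mem h (by rw [ep_fc]; exact c.a1) b.q)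
    · rw [h] at hi; exact hi (c.isoK hP b.q)
  have k2 : x.fc = d.st.fc ∨ x.fc = d.st.nx.rt.fc → x.ed = d.st.ep.ed := by
    intro h
    have cs := c.st
    rcases cs.en hP hx h5 hi h with h | ⟨h, -⟩
    · exact h
    · exfalso
      obtain ⟨t1, t2⟩ := he.third hP h
      rw [prev hP, ← fc_rt, prev hP, ← fc_rt] at t1
      refine E1 hP he.T cs.a cs.a1 ?_ ?_ t1 t2
      · intro hh; have := cs.pent _ hh; have := cs.h1; omega
      · rw [← t_fc hP]; exact cs.nt
  rcases b.all _ hf with h | h | h | h | h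
  · exact absurd (Or.inl h) k1
  · exact absurd (Or.inr h) k1
  · exact ⟨d, b, k2 (Or.inl h)⟩
  · exact ⟨d, b, k2 (Or.inr h)⟩
  · rcases c.Q hP b.q hx h5 hi h with h | h
    · rw [h] at he
      have f := c.F2 hP b.q he
      obtain ⟨b', h'⟩ := b.sw hP f he.T.toRules
      exact ⟨d.s0, b', by rw [h, h']⟩
    · rw [h] at he; exact (c.F1 hP b.q he).elim

namespace PB2PS
variable {d : Flag P}

theorem st (b : PB2PS S d) : PB2PS S d.st := by
  have := st_st b.c.p5 b.c.P5
  exact ⟨b.c.st, b.r, by rw [this]; exact b.q, b.card, fun f hf => by have := b.all f hf; rw [‹d.st.st = d›]; tauto⟩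

set_option maxHeartbeats 1000000 in
theorem F2no (hP : IsFullerene P) (b : PB2PS S d) (T : Tight P S H M) (f : Core.F2S S H M d) : False := by
  have c := b.c
  have L := PL hP T c.a5
  have L' := PL hP T (x := d.st.ep.rv) (by rw [← fc_rt]; exact b.r)
  have q := qi hP (c.pent _ c.a5) (c.pent _ b.r)
  obtain ⟨v0, v1, v2, v3, v4, -, -, -, -, -, -⟩ := L
  obtain ⟨w0, w1, w2, w3, w4, -, -, -, -, -, -⟩ := L'
  have e0 : d.st.nx.rt.rt.fc = d.nx.nx.nx.rt.fc := by rw [prev hP, ← fc_rt, t_fc hP]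
  have e3 : d.st.nx.rt.nx.nx.nx.rt.fc = d.st.nx.nx.rt.fc := by rw [fc_rt, ← gg hP (c.pent _ c.a5)]
  have e2 : d.st.nx.rt.nx.nx.rt.fc ∈ S := b.r
  have nr := T.toRules.hA e2
  rw [e0] at v1
  rw [e3] at v3
  rw [q.j1] at v2
  have k : d.st.nx.rt.nx.rt.fc ∉ H := fun h => v1.r1 h f.t
  have m1 : d.st.nx.rt.nx.ed ∉ M := fun h => v1.r7 h f.t
  have m2 : d.st.nx.rt.nx.nx.ed ∉ M := fun h => v3.r8 h f.h
  have mo : d.st.ep.rv.nx.ed ∈ M := by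
    have := v2.r12 (Or.inl e2) nr k
    clear * - this m1 m2
    tauto
  -- `y2` charges `P4`
  have cy : chg S H M d.st.ep := by
    rw [Flag.ep, chgN hP T.toRules (by simpa using c.a5)]
    exact ⟨nr, k, m2, m1⟩
  have g2 := w2.r8 mo
  have g3 := w2.r9 mo
  have g4 : d.st.ep.rv.nx.nx.rt.fc ∈ S ∧ d.st.ep.rv.nx.nx.ed ∉ M ∧ d.st.ep.rv.nx.nx.rt.ed ∉ M := by
    have := w2.r14 g2 g3
    clear * - this mo
    tauto
  have cz : chg S H M d.st.ep.rv.nx.nx.rt := by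
    refine ⟨g4.1, ?_, g4.2.2, by rw [rt3 hP]; exact g4.2.1⟩
    rw [cov_rt hP, covN hP T.toRules (by rw [fc_nx, ← fc_rt]; exact b.r)]
    clear * - mo g2 g3 g4
    tauto
  have vy : d.st.ep.rv.nx.vt = d.st.ep.vt := by rw [vt_nx, wt_rv]
  have vz : d.st.ep.rv.nx.nx.rt.vt = d.st.ep.rv.nx.wt := by rw [vt_rt, vt_nx]
  -- if the edge at z1* is `x.ed`, and `x.wt` charges
  have key : ∀ x y z : Flag P, x.ed ∈ M → chg S H M y → chg S H M z → y.vt = x.vt → z.vt = x.wt →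
      y.fc = d.st.ep.rv.nx.nx.rt.fc → d.st.nx.rt.fc = z.fc := by
    intro x y z hx hy hz hyx hzx hf
    have h1 := T.T1 _ _ cz hy hf
    have h2 := Muniq hP T.toRules (x := d.st.ep.rv.nx.rv) (y := x) (by rw [ed_rv]; exact mo) hx
      (by rw [← hyx, h1, vz, vt_rv])
    rw [ed_rv] at h2
    have h3 : z.vt = d.st.ep.vt := by
      rw [hzx, ← vy]
      rcases Sym2.eq_iff.1 h2 with ⟨h, h'⟩ | ⟨h, h'⟩
      · exfalso
        rw [hyx, h, vz] at h1
        exact d.st.ep.rv.nx.ne h1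
      · exact h'
    have := chg_unique hP T.toRules hz cy h3.symm
    rw [← this, ep_fc]
  have vw : d.ep.rv.vt = d.nx.rt.nx.nx.nx.vt := by rw [vt_rv, Flag.ep, vt_nx]
  have q5 := c.pent _ c.a1
  have vw' : d.nx.nx.vt = d.nx.rt.nx.nx.nx.wt := by
    rw [← vt_nx, gg4 q5, vt_rv, vt_nx]
  have vu : d.st.nx.nx.nx.nx.vt = d.vt := by
    rw [st4 c.P5, vt_rv, ← vt_nx, five' c.p5]
  have vv : d.nx.rt.vt = d.wt := by rw [vt_rt, vt_nx]
  have card := b.card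
  have all := b.all
  have small : ∀ a1 a2 a3 a4 a5 : Finset (Sym2 V), ¬ (∀ f ∈ S, f = a1 ∨ f = a2 ∨ f = a3 ∨ f = a4 ∨ f = a5) := by
    intro a1 a2 a3 a4 a5 h
    have : S ⊆ {a1, a2, a3, a4, a5} := by
      intro f hf; simpa using h f hf
    have := (card_le_card this).trans card_le_five
    omega
  have q0 : d.ep.rv.fc = d.ep.rt.fc := (fc_rt _).symm
  have u0 : d.st.nx.nx.nx.nx.fc = d.st.fc := by simp
  rcases all _ g4.1 with h | h | h | h | h | h
  · have := key d.nx.rt.nx.nx.nx.rv d.nx.nx d.ep.rv (by rw [ed_rv]; exact f.m2) f.c1 f.c2 (by rw [vt_rv, vw'])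
      (by rw [wt_rv, vw]) (by rw [h]; simp)
    rw [q0] at this
    rw [this] at all
    exact small _ _ _ _ _ (fun g hg => by have := all g hg; clear * - this; tauto)
  · have := key d.rv d.nx.rt d.st.nx.nx.nx.nx (by rw [ed_rv]; exact f.m1) f.c3 f.c4 (by rw [vt_rv, vv])
      (by rw [wt_rv, vu]) (by rw [h])
    rw [u0] at this
    exact d.st.nx.fc_rt_ne (by rw [this, fc_nx])
  · have := key d d.st.nx.nx.nx.nx d.nx.rt f.m1 f.c4 f.c3 vu vv (by rw [h, u0])
    rw [this] at all
    exact small _ _ _ _ _ (fun g hg => by have := all g hg; clear * - this; tauto)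
  · have h1 := T.T1 _ _ cz cy (by rw [h, ep_fc])
    rw [vz, ← vy] at h1
    exact d.st.ep.rv.nx.ne h1
  · have := key d.nx.rt.nx.nx.nx d.ep.rv d.nx.nx f.m2 f.c2 f.c1 vw vw' (by rw [h, q0])
    rw [fc_nx, fc_nx] at this
    rw [this] at all
    exact small _ _ _ _ _ (fun g hg => by have := all g hg; clear * - this; tauto)
  · exact d.st.ep.rv.nx.nx.fc_rt_ne (by rw [h, fc_nx, fc_nx, fc_rt])

theorem no (hP : IsFullerene P) (b : PB2PS S d) {x : Flag P} (hf : x.fc ∈ S) (hx : x.rt.fc ∉ S)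
    (h5 : x.rt.fc.card = 5) (hi : ¬ Iso P S x.rt.fc) (he : PE P S H M x.ed) : False := by
  have key : ∀ d : Flag P, PB2PS S d → (x.fc = d.fc ∨ x.fc = d.nx.rt.fc) ∨ x.fc = d.ep.rt.fc → False := by
    intro d b h
    have c := b.c
    rcases h with h | h
    · rcases c.en hP hx h5 hi h with h | ⟨-, h⟩
      · exact hx (rt_mem h (by rw [ep_fc]; exact c.a1) b.q)
      · rw [h] at hi; exact hi (c.isoK hP b.q)
    · rcases c.Q hP b.q hx h5 hi h with h | h
      · rw [h] at he
        exact b.F2no hP he.T (c.F2 hP b.q he)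
      · rw [h] at he; exact (c.F1 hP b.q he).elim
  have k1 := key d b
  have k2 := key d.st b.st
  have := b.all _ hf
  tauto

end PB2PS

theorem PB2S.of (hP : IsFullerene P) {d : Flag P} (s : Shape2 S d) (h : Pst P S C e) (hE : Ext P S) (h1 : C.card = 1) :
    ∃ d' : Flag P, PB2S (S ∪ C) d' := by
  obtain ⟨H, M, he⟩ := h.pe hP hE
  obtain ⟨x, rfl, hx, hxC, hxS, h5, hi⟩ := h.flag hP
  obtain ⟨d, s, hd⟩ := paste2 hP s hx hxS h5 hi he
  have hq : d.ep.rt.fc = x.rt.fc := by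
    have hf : d.ep.fc ∈ S := by rw [ep_fc]; exact s.a1
    rcases eq_e hd.symm with h' | h' | h' | h'
    · rw [h']
    · rw [h', s0_rt_fc]
    · rw [h', fc_s2] at hf; exact absurd hf hxS
    · rw [h', ← fc_rt] at hf; exact absurd hf hxS
  refine ⟨d, s.core.mono hP h, by rw [hq]; exact mem_union_right _ hxC, ?_⟩
  intro f hf
  rw [hq]
  rcases mem_union.1 hf with hf | hf
  · have := s.all f hf; clear * - this; tauto
  · have := card_le_one.1 h1.le _ hf _ hxC; clear * - this; tauto

theorem PB2PS.of (hP : IsFullerene P) {d : Flag P} (s : PB2S S d) (h : Pst P S C e) (hE : Ext P S) (h1 : C.card = 1)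
    (h5 : S.card = 5) : ∃ d' : Flag P, PB2PS (S ∪ C) d' := by
  obtain ⟨H, M, he⟩ := h.pe hP hE
  obtain ⟨x, rfl, hx, hxC, hxS, h5', hi⟩ := h.flag hP
  obtain ⟨d, s, hd⟩ := s.en hP hx hxS h5' hi he
  have hq : d.st.ep.rt.fc = x.rt.fc := by
    have hf : d.st.ep.fc ∈ S := by rw [ep_fc]; exact s.c.a5
    rcases eq_e hd.symm with h' | h' | h' | h'
    · rw [h']
    · rw [h', s0_rt_fc]
    · rw [h', fc_s2] at hf; exact absurd hf hxS
    · rw [h', ← fc_rt] at hf; exact absurd hf hxS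
  refine ⟨d, s.c.mono hP h, mem_union_left _ s.q, by rw [hq]; exact mem_union_right _ hxC, ?_, ?_⟩
  · rw [card_union_of_disjoint, h5, h1]
    rw [disjoint_left]; intro f hf; exact h.disj hP hf
  intro f hf
  rw [hq]
  rcases mem_union.1 hf with hf | hf
  · have := s.all f hf; clear * - this; tauto
  · have := card_le_one.1 h1.le _ hf _ hxC; clear * - this; tauto

end FG

namespace FG
open Finset
open FG.Flag
variable {V : Type} [Fintype V] [DecidableEq V]
set_option linter.unusedSectionVars false
set_option linter.unusedVariables false
variable {P : PlaneGraph V} {A H S C : Finset (Finset (Sym2 V))} {M : Finset (Sym2 V)} {e : Sym2 V}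

def Bad (P : PlaneGraph V) (S : Finset (Finset (Sym2 V))) : Prop :=
  (∃ d : Flag P, Bad3 S d) ∨ ∃ d d' : Flag P, Bad2 S d d'

theorem Bad.mono (hP : IsFullerene P) (b : Bad P S) (h : Pst P S C e) : Bad P (S ∪ C) := by
  rcases b with ⟨d, b⟩ | ⟨d, d', b⟩
  · exact Or.inl ⟨d, b.mono hP h⟩
  · exact Or.inr ⟨d, d', b.mono hP h⟩

def Inv (B : Fragment P) : Prop :=
  IsPentagonFrag B ∨ IsB2Frag B ∨ IsB3Frag B ∨
  (IsPPFrag B ∧ (∃ x : Flag P, PPS B.inFaces x) ∧ Ext P B.inFaces) ∨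
  (IsPB2Frag B ∧ (∃ x : Flag P, PB2S B.inFaces x) ∧ B.inFaces.card = 5 ∧ Ext P B.inFaces) ∨
  (IsPB2PFrag B ∧ (∃ x : Flag P, PB2PS B.inFaces x) ∧ Ext P B.inFaces) ∨
  Bad P B.inFaces

theorem IsPasting.symm {B A C : Fragment P} (h : IsPasting B A C) : IsPasting B C A := by
  obtain ⟨h1, e, h2, h3, h4⟩ := h
  exact ⟨by rw [h1, union_comm], e, by rw [inter_comm, h2], h4, h3⟩

theorem basic_pent {B : Fragment P} (h : IsBasicFrag B) : IsPentagonalFragment B := by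
  rcases h with h | h | h <;> exact h.1

theorem union_card5 (hP : IsFullerene P) (h : Pst P S C e) (h1 : S.card = 4) (h2 : C.card = 1) : (S ∪ C).card = 5 := by
  rw [card_union_of_disjoint, h1, h2]
  rw [disjoint_left]; intro f hf; exact h.disj hP hf

theorem inv_pb2 (hP : IsFullerene P) (hn : 60 ≤ Fintype.card V) {B A C : Fragment P} (hA : IsPentagonFrag A)
    (hC : IsB2Frag C) (h : IsPasting B A C) : Inv B := by
  obtain ⟨e, p⟩ := Pst.of h.symm hC.1 hA.1
  obtain ⟨hE, d, sd⟩ := b2_shape hP hn hC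
  refine Or.inr (Or.inr (Or.inr (Or.inr (Or.inl ⟨⟨A, C, hA, hC, h⟩, ?_, ?_, ?_⟩))))
  · rw [h.symm.1]; exact PB2S.of hP sd p hE hA.2
  · rw [h.symm.1]; exact union_card5 hP p hC.2.1 hA.2
  · rw [h.symm.1]; exact p.ext hP hE hA.2

theorem inv_bad {B : Fragment P} (h : Bad P B.inFaces) : Inv B :=
  Or.inr (Or.inr (Or.inr (Or.inr (Or.inr (Or.inr h)))))

theorem inv_step (hP : IsFullerene P) (hn : 60 ≤ Fintype.card V) {B A C : Fragment P}
    (hA5 : IsPentagonalFragment A) (hA : Inv A) (hC : IsBasicFrag C) (h : IsPasting B A C) : Inv B := by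
  obtain ⟨e, p⟩ := Pst.of h hA5 (basic_pent hC)
  have hB := h.1
  -- a pentagon or a `B2` on the right
  rcases hC with hC | hC | hC
  · rcases hA with hA | hA | hA | ⟨hA, ⟨x, b⟩, hE⟩ | ⟨hA, ⟨x, b⟩, h5, hE⟩ | ⟨hA, ⟨x, b⟩, hE⟩ | hA
    · refine Or.inr (Or.inr (Or.inr (Or.inl ⟨⟨A, C, hA, hC, h⟩, ?_⟩)))
      rw [hB]; exact PPS.of hP p hA.2 hC.2
    · exact inv_pb2 hP hn hC hA h.symm
    · obtain ⟨d, sd⟩ := b3_shape hP hn hA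
      exact inv_bad (by rw [hB]; exact Or.inl (bad3_of hP sd p))
    · exfalso
      obtain ⟨H, M, he⟩ := p.pe hP hE
      obtain ⟨y, rfl, hx, hxC, hxS, h5, hi⟩ := p.flag hP
      exact b.no hP hx hxS h5 he
    · obtain ⟨A', C', a1, a2, a3⟩ := hA
      refine Or.inr (Or.inr (Or.inr (Or.inr (Or.inr (Or.inl ⟨⟨A, A', C', C, a1, a2, hC, a3, h⟩, ?_, ?_⟩)))))
      · rw [hB]; exact PB2PS.of hP b p hE hC.2 h5
      · rw [hB]; exact p.ext hP hE hC.2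
    · exfalso
      obtain ⟨H, M, he⟩ := p.pe hP hE
      obtain ⟨y, rfl, hx, hxC, hxS, h5, hi⟩ := p.flag hP
      exact b.no hP hx hxS h5 hi he
    · exact inv_bad (by rw [hB]; exact hA.mono hP p)
  · rcases hA with hA | hA | hA | ⟨hA, ⟨x, b⟩, hE⟩ | ⟨hA, ⟨x, b⟩, h5, hE⟩ | ⟨hA, ⟨x, b⟩, hE⟩ | hA
    · exact inv_pb2 hP hn hA hC h
    · obtain ⟨hE, d, sd⟩ := b2_shape hP hn hA
      obtain ⟨hE', d', sd'⟩ := b2_shape hP hn hC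
      obtain ⟨H, M, he⟩ := p.pe hP hE
      obtain ⟨H', M', he'⟩ := p.symm.pe hP hE'
      obtain ⟨y, hy, hx, hxC, hxS, h5, hi⟩ := p.flag hP
      obtain ⟨y', hy', hx', hxC', hxS', h5', hi'⟩ := p.symm.flag hP
      rw [← hy] at he
      rw [← hy'] at he'
      obtain ⟨z, sz, hz⟩ := paste2 hP sd hx hxS h5 hi he
      obtain ⟨z', sz', hz'⟩ := paste2 hP sd' hx' hxS' h5' hi' he'
      exact inv_bad (by rw [hB]; exact Or.inr ⟨z, z', bad2_of hP sz.core sz'.core p (hy.symm.trans hz) (hy'.symm.trans hz')⟩)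
    · obtain ⟨d, sd⟩ := b3_shape hP hn hA
      exact inv_bad (by rw [hB]; exact Or.inl (bad3_of hP sd p))
    · exfalso
      obtain ⟨H, M, he⟩ := p.pe hP hE
      obtain ⟨y, rfl, hx, hxC, hxS, h5, hi⟩ := p.flag hP
      exact b.no hP hx hxS h5 he
    · obtain ⟨hE', d', sd'⟩ := b2_shape hP hn hC
      obtain ⟨H, M, he⟩ := p.pe hP hE
      obtain ⟨H', M', he'⟩ := p.symm.pe hP hE'
      obtain ⟨y, hy, hx, hxC, hxS, h5, hi⟩ := p.flag hP
      obtain ⟨y', hy', hx', hxC', hxS', h5', hi'⟩ := p.symm.flag hP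
      rw [← hy] at he
      rw [← hy'] at he'
      obtain ⟨z, sz, hz⟩ := b.en hP hx hxS h5 hi he
      obtain ⟨z', sz', hz'⟩ := paste2 hP sd' hx' hxS' h5' hi' he'
      exact inv_bad (by rw [hB]; exact Or.inr ⟨z.st, z', bad2_of hP sz.c.st sz'.core p (hy.symm.trans hz) (hy'.symm.trans hz')⟩)
    · exfalso
      obtain ⟨H, M, he⟩ := p.pe hP hE
      obtain ⟨y, rfl, hx, hxC, hxS, h5, hi⟩ := p.flag hP
      exact b.no hP hx hxS h5 hi he
    · exact inv_bad (by rw [hB]; exact hA.mono hP p)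
  · obtain ⟨d, sd⟩ := b3_shape hP hn hC
    exact inv_bad (by rw [hB, union_comm]; exact Or.inl (bad3_of hP sd p.symm))

theorem pasted_pent {B : Fragment P} (h : Pasted P B) : IsPentagonalFragment B := by
  induction h with
  | base B h => exact basic_pent h
  | paste B A C hA hC h ih =>
    intro f hf
    rw [h.1, mem_union] at hf
    rcases hf with hf | hf
    · exact ih f hf
    · exact basic_pent hC f hf

theorem pasted_inv (hP : IsFullerene P) (hn : 60 ≤ Fintype.card V) {B : Fragment P} (h : Pasted P B) : Inv B := by
  induction h with
  | base B h =>
    rcases h with h | h | h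
    · exact Or.inl h
    · exact Or.inr (Or.inl h)
    · exact Or.inr (Or.inr (Or.inl h))
  | paste B A C hA hC h ih => exact inv_step hP hn (pasted_pent hA) ih hC h

/-- outer faces along a maximal fragment are hexagons -/
theorem maximal_hex (hP : IsFullerene P) (hn : 60 ≤ Fintype.card V) {B : Fragment P} (h5 : IsPentagonalFragment B)
    (hm : IsMaximalIn P B.edges) (x : Flag P) (hx : x.fc ∈ B.inFaces) (hx' : x.rt.fc ∉ B.inFaces) :
    x.rt.fc.card = 6 := by
  have he : x.ed ∈ B.edges := (ed_mem B.subFaces _).2 (Or.inl hx)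
  refine hm _ ?_
  simp only [adjoiningFaces, mem_filter]
  refine ⟨x.rt.mf, fun h => hx' (hole hP hn B h5 x.rt.mf h), x.ed, mem_inter.2 ⟨?_, he⟩⟩
  rw [fc_rt, ← ed_rv]; exact x.rv.me

end FG

namespace FG
open Finset
open FG.Flag
variable {V : Type} [Fintype V] [DecidableEq V]
set_option linter.unusedSectionVars false
set_option linter.unusedVariables false
variable {P : PlaneGraph V}

/-! A small exhaustive search: a partial cubic map is stored as a partial reversal table on the
darts `3 v + i` (`i < 3`); faces are closed up one at a time. -/
namespace Srch

theorem beqi (a b : ℕ) : (Nat.beq a b = true) ↔ a = b := by rw [Nat.beq_eq]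

/-- partial tables indexed by natural numbers, as binary trees -/
inductive Tr where
  | nil : Tr
  | nd : Tr → Option ℕ → Tr → Tr

namespace Tr

def get : Tr → ℕ → Option ℕ
  | nil, _ => none
  | nd l v r, k => bif Nat.beq k 0 then v else bif Nat.beq (k % 2) 1 then get l (k / 2) else get r (k / 2 - 1)

def set : ℕ → Tr → ℕ → ℕ → Tr
  | 0, t, _, _ => t
  | f + 1, nil, k, y => bif Nat.beq k 0 then nd nil (some y) nil else
      bif Nat.beq (k % 2) 1 then nd (set f nil (k / 2) y) none nil else nd nil none (set f nil (k / 2 - 1) y)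
  | f + 1, nd l v r, k, y => bif Nat.beq k 0 then nd l (some y) r else
      bif Nat.beq (k % 2) 1 then nd (set f l (k / 2) y) v r else nd l v (set f r (k / 2 - 1) y)

def ents : Tr → ℕ → ℕ → List (ℕ × ℕ) → List (ℕ × ℕ)
  | nil, _, _, acc => acc
  | nd l v r, a, b, acc =>
    let acc' := ents l (2 * a) (a + b) (ents r (2 * a) (2 * a + b) acc)
    match v with
    | none => acc'
    | some y => (b, y) :: acc'

theorem get_set (f : ℕ) : ∀ (t : Tr) (k y j z : ℕ), (set f t k y).get j = some z →
    (j = k ∧ z = y) ∨ t.get j = some z := by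
  induction f with
  | zero => intro t k y j z h; exact Or.inr h
  | succ f ih =>
    intro t k y j z h
    cases t with
    | nil =>
      rcases Nat.eq_zero_or_pos k with rfl | hk
      · simp only [set, beqi, get, cond_eq_ite, if_true] at h
        split_ifs at h <;> simp_all
      · left
        simp only [set, beqi, cond_eq_ite] at h
        rw [if_neg (by omega)] at h
        split_ifs at h with h1
        · simp only [get, beqi, cond_eq_ite] at h
          split_ifs at h with h2 h3
          rcases ih _ _ _ _ _ h with h | h
          · exact ⟨by omega, h.2⟩
          · simp [get] at h
        · simp only [get, beqi, cond_eq_ite] at h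
          split_ifs at h with h2 h3
          rcases ih _ _ _ _ _ h with h | h
          · exact ⟨by omega, h.2⟩
          · simp [get] at h
    | nd l v r =>
      rcases Nat.eq_zero_or_pos k with rfl | hk
      · simp only [set, beqi, get, cond_eq_ite, if_true] at h ⊢
        split_ifs at h ⊢ with h1 <;> simp_all
      · simp only [set, beqi, cond_eq_ite] at h
        rw [if_neg (by omega)] at h
        split_ifs at h with h1
        · simp only [get, beqi, cond_eq_ite] at h ⊢
          split_ifs at h ⊢ with h2 h3
          · exact Or.inr h
          · rcases ih _ _ _ _ _ h with h | h
            · left; exact ⟨by omega, h.2⟩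
            · exact Or.inr h
          · exact Or.inr h
        · simp only [get, beqi, cond_eq_ite] at h ⊢
          split_ifs at h ⊢ with h2 h3
          · exact Or.inr h
          · exact Or.inr h
          · rcases ih _ _ _ _ _ h with h | h
            · left; exact ⟨by omega, h.2⟩
            · exact Or.inr h

theorem mem_ents : ∀ (t : Tr) (a b : ℕ) (acc : List (ℕ × ℕ)) (x y : ℕ), (x, y) ∈ ents t a b acc →
    (x, y) ∈ acc ∨ ∃ j, x = a * j + b ∧ t.get j = some y
  | nil, a, b, acc, x, y, h => Or.inl h
  | nd l v r, a, b, acc, x, y, h => by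
    have key : (x, y) ∈ ents l (2 * a) (a + b) (ents r (2 * a) (2 * a + b) acc) →
        (x, y) ∈ acc ∨ ∃ j, x = a * j + b ∧ (nd l v r).get j = some y := by
      intro h
      rcases mem_ents l _ _ _ _ _ h with hl | ⟨j, rfl, hj⟩
      · rcases mem_ents r _ _ _ _ _ hl with hr | ⟨j, rfl, hj⟩
        · exact Or.inl hr
        · right
          refine ⟨2 * j + 2, by ring, ?_⟩
          simp only [get, beqi, cond_eq_ite]
          rw [if_neg (by omega), if_neg (by omega), show (2 * j + 2) / 2 - 1 = j by omega]
          exact hj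
      · right
        refine ⟨2 * j + 1, by ring, ?_⟩
        simp only [get, beqi, cond_eq_ite]
        rw [if_neg (by omega), if_pos (by omega), show (2 * j + 1) / 2 = j by omega]
        exact hj
    cases v with
    | none => exact key h
    | some z =>
      rw [ents] at h
      rcases List.mem_cons.1 h with h | h
      · obtain ⟨rfl, rfl⟩ := Prod.mk.inj h
        right
        exact ⟨0, by simp, by simp [get]⟩
      · exact key h

end Tr

structure St where
  n : ℕ
  t : Tr

def rot (x : ℕ) : ℕ := bif Nat.beq (x % 3) 2 then x - 2 else x + 1

def ins : List (ℕ × ℕ) → Tr → List (ℕ × ℕ) → Option (Tr × List (ℕ × ℕ))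
  | [], t, ps => some (t, ps)
  | (x, y) :: es, t, ps =>
    bif Nat.beq (x / 3) (y / 3) then none else
    match t.get x with
    | none => ins es (t.set 10 x y) ps
    | some z => bif Nat.beq z y then ins es t ps else ins es t ((z, y) :: ps)

def sub (a b x : ℕ) : ℕ :=
  bif Nat.beq (x / 3) (a / 3) then 3 * (b / 3) + (x % 3 + (b % 3 + 3 - a % 3)) % 3 else x

def mg : ℕ → St → List (ℕ × ℕ) → Option St
  | 0, s, _ => some s
  | _ + 1, s, [] => some s
  | f + 1, s, (a, b) :: ps =>
    bif Nat.beq a b then mg f s ps else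
    bif Nat.beq (a / 3) (b / 3) then none else
    let A := bif Nat.ble a b then b else a
    let B := bif Nat.ble a b then a else b
    match ins ((s.t.ents 1 0 []).map fun p => (sub A B p.1, sub A B p.2)) Tr.nil
      (ps.map fun p => (sub A B p.1, sub A B p.2)) with
    | none => none
    | some (t, ps) => mg f ⟨s.n, t⟩ ps

def bk (t : Tr) : ℕ → ℕ → ℕ
  | 0, d => d
  | f + 1, d => match t.get (rot (rot d)) with
    | none => d
    | some y => bk t f y

def link (t : Tr) (x y : ℕ) : Tr := (t.set 10 x y).set 10 y x

def fw (d : ℕ) : ℕ → St → ℕ → Option St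
  | 0, s, x => mg 60 s [(x, d)]
  | r + 1, s, x => match s.t.get x with
    | some y => fw d r s (rot y)
    | none =>
      match r with
      | 0 => match s.t.get (rot (rot d)) with
        | some z => mg 60 s [(z, x)]
        | none => bif Nat.beq (x / 3) (d / 3) then none else some ⟨s.n, link s.t x (rot (rot d))⟩
      | r + 1 => fw d (r + 1) ⟨s.n + 1, link s.t x (3 * s.n)⟩ (3 * s.n + 1)

def setf (s : St) (d k : ℕ) : Option St := let d := bk s.t 6 d; fw d k s d

/-- letters: `0` reversal, `1` rotation, `2` next -/
def walk (t : Tr) : List ℕ → ℕ → Option ℕ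
  | [], x => some x
  | c :: w, x => bif Nat.beq c 1 then walk t w (rot x) else
    match t.get x with
    | none => none
    | some y => walk t w (bif Nat.beq c 0 then y else rot y)

def isSome : Option ℕ → Bool
  | none => false
  | some _ => true

/-- the live vertices, when everything is closed -/
def done (s : St) : Bool :=
  let L := (List.range s.n).filter fun v => isSome (s.t.get (3 * v))
  Nat.ble L.length 59 && isSome (s.t.get 0) && L.all fun v => (List.range 3).all fun i =>
    match s.t.get (3 * v + i) with
    | none => false
    | some y => isSome (s.t.get (3 * (y / 3)))

def chk : ℕ → Option St → List ℕ → Option (List ℕ)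
  | 0, _, _ => none
  | _ + 1, none, hs => some hs
  | _ + 1, some _, [] => none
  | f + 1, some s, d :: hs => bif Nat.beq d 0 then (bif done s then some hs else none) else bif Nat.ble s.n (d / 3) then none else
    match chk f (setf s d 5) hs with
    | none => none
    | some hs' => chk f (setf s d 6) hs'

def facts : List (List ℕ × ℕ) → St → Option St
  | [], s => some s
  | (w, k) :: fs, s => match walk s.t w 0 with
    | none => facts fs s
    | some x => match setf s x k with
      | none => none
      | some s' => facts fs s'

def run (fs : List (List ℕ × ℕ)) (hs : List ℕ) : Bool :=
  match chk 100 (facts fs ⟨1, Tr.nil⟩) hs with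
  | none => false
  | some _ => true

/-! soundness -/

noncomputable def val (ι : ℕ → Flag P) (x : ℕ) : Flag P := rt^[x % 3] (ι (x / 3))

structure Ok (s : St) (ι : ℕ → Flag P) : Prop where
  pos : 0 < s.n
  r : ∀ x y, s.t.get x = some y → x / 3 < s.n ∧ y / 3 < s.n ∧ (val ι x).rv = val ι y

theorem rt_iter (hP : IsFullerene P) (k : ℕ) (x : Flag P) : rt^[k % 3] x = rt^[k] x := by
  have h3 : (rt : Flag P → Flag P)^[3] = id := funext fun x => rt3 hP x
  conv_rhs => rw [← Nat.mod_add_div k 3, Function.iterate_add_apply, Function.iterate_mul, h3, Function.iterate_id]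
  rfl

theorem val_rot (hP : IsFullerene P) (ι : ℕ → Flag P) (x : ℕ) : val ι (rot x) = (val ι x).rt := by
  unfold rot val
  simp only [beqi, cond_eq_ite]
  split_ifs with h
  · rw [show (x - 2) % 3 = 0 by omega, show (x - 2) / 3 = x / 3 by omega, h]
    exact (rt3 hP _).symm
  · rw [show (x + 1) % 3 = x % 3 + 1 by omega, show (x + 1) / 3 = x / 3 by omega, Function.iterate_succ_apply']

theorem rot_div (x : ℕ) : rot x / 3 = x / 3 := by
  unfold rot
  simp only [beqi, cond_eq_ite]
  split_ifs <;> omega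

theorem val_inj (hP : IsFullerene P) (ι : ℕ → Flag P) {a b : ℕ} (h : a / 3 = b / 3) (h' : val ι a = val ι b) : a = b := by
  have key : ∀ (x : Flag P) (i j : ℕ), i < 3 → j < 3 → rt^[i] x = rt^[j] x → i = j := by
    intro x i j hi hj h
    have h := congrArg Flag.wt h
    have e0 := x.rt_ne
    have e1 := x.rt.rt_ne
    have e2 := rt_rt_ne hP x
    interval_cases i <;> interval_cases j <;> simp [Function.iterate_succ_apply'] at h ⊢
    · exact e0 h.symm
    · exact e2 h.symm
    · exact e0 h
    · exact e1 h.symm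
    · exact e2 h
    · exact e1 h
  unfold val at h'
  rw [h] at h'
  have := key _ _ _ (Nat.mod_lt _ (by norm_num)) (Nat.mod_lt _ (by norm_num)) h'
  omega

theorem val_vt (ι : ℕ → Flag P) (x : ℕ) : (val ι x).vt = (ι (x / 3)).vt := by
  unfold val
  generalize x % 3 = k
  induction k with
  | zero => rfl
  | succ k ih => rw [Function.iterate_succ_apply', vt_rt, ih]

theorem val_sub (hP : IsFullerene P) (ι : ℕ → Flag P) {a b : ℕ} (h : val ι a = val ι b) (x : ℕ) :
    val ι (sub a b x) = val ι x := by
  unfold sub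
  simp only [beqi, cond_eq_ite]
  split_ifs with hx
  · unfold val at h ⊢
    rw [hx]
    have h1 : ι (a / 3) = rt^[b % 3 + 3 - a % 3] (ι (b / 3)) := by
      have := congrArg (rt^[3 - a % 3]) h
      rw [← Function.iterate_add_apply, ← Function.iterate_add_apply] at this
      have ha := Nat.mod_lt a (show 3 > 0 by norm_num)
      rw [show 3 - a % 3 + a % 3 = 3 by omega, show 3 - a % 3 + b % 3 = b % 3 + 3 - a % 3 by omega] at this
      rw [← this]; exact (rt3 hP _).symm
    rw [h1, ← Function.iterate_add_apply]
    generalize x % 3 + (b % 3 + 3 - a % 3) = m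
    rw [show (3 * (b / 3) + m % 3) % 3 = m % 3 by omega, show (3 * (b / 3) + m % 3) / 3 = b / 3 by omega]
    exact rt_iter hP _ _
  · rfl

theorem sub_lt {a b n : ℕ} (hb : b / 3 < n) {x : ℕ} (hx : x / 3 < n) : sub a b x / 3 < n := by
  unfold sub
  simp only [beqi, cond_eq_ite]
  split_ifs
  · generalize x % 3 + (b % 3 + 3 - a % 3) = m
    omega
  · exact hx

theorem no_loop (ι : ℕ → Flag P) {x y : ℕ} (h : (val ι x).rv = val ι y) (h' : x / 3 = y / 3) : False := by
  have := congrArg Flag.vt h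
  rw [vt_rv, val_vt, ← h', ← val_vt ι x] at this
  exact (val ι x).ne this.symm

def OkP (n : ℕ) (ι : ℕ → Flag P) (ps : List (ℕ × ℕ)) : Prop :=
  ∀ a b, (a, b) ∈ ps → a / 3 < n ∧ b / 3 < n ∧ val ι a = val ι b

def OkT (n : ℕ) (ι : ℕ → Flag P) (t : Tr) : Prop :=
  ∀ x y, t.get x = some y → x / 3 < n ∧ y / 3 < n ∧ (val ι x).rv = val ι y

theorem OkT.set {n : ℕ} {ι : ℕ → Flag P} {t : Tr} (h : OkT n ι t) {x y : ℕ}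
    (h' : x / 3 < n ∧ y / 3 < n ∧ (val ι x).rv = val ι y) (f : ℕ) : OkT n ι (t.set f x y) := by
  intro a b hab
  rcases Tr.get_set _ _ _ _ _ _ hab with ⟨rfl, rfl⟩ | hab
  · exact h'
  · exact h _ _ hab

theorem OkT.link {n : ℕ} {ι : ℕ → Flag P} {t : Tr} (h : OkT n ι t) {x y : ℕ}
    (h' : x / 3 < n ∧ y / 3 < n ∧ (val ι x).rv = val ι y) : OkT n ι (link t x y) :=
  (h.set h' _).set ⟨h'.2.1, h'.1, by rw [← h'.2.2, rv_rv]⟩ _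

theorem ins_ok {n : ℕ} {ι : ℕ → Flag P} : ∀ (es : List (ℕ × ℕ)) (t : Tr) (ps : List (ℕ × ℕ)),
    (∀ x y, (x, y) ∈ es → x / 3 < n ∧ y / 3 < n ∧ (val ι x).rv = val ι y) → OkT n ι t → OkP n ι ps →
    ∃ t' ps', ins es t ps = some (t', ps') ∧ OkT n ι t' ∧ OkP n ι ps'
  | [], t, ps, _, ht, hp => ⟨t, ps, rfl, ht, hp⟩
  | (x, y) :: es, t, ps, he, ht, hp => by
    have hxy := he x y (by simp)
    have he' : ∀ x y, (x, y) ∈ es → x / 3 < n ∧ y / 3 < n ∧ (val ι x).rv = val ι y := fun a b h =>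
      he a b (by simp [h])
    rw [ins]
    simp only [beqi, cond_eq_ite]
    rw [if_neg (fun h => no_loop ι hxy.2.2 h)]
    rcases hg : t.get x with _ | z
    · exact ins_ok es _ _ he' (ht.set hxy _) hp
    · simp only
      split_ifs with h
      · exact ins_ok es _ _ he' ht hp
      · refine ins_ok es _ _ he' ht ?_
        intro a b hab
        have := ht _ _ hg
        rcases List.mem_cons.1 hab with hab | hab
        · obtain ⟨rfl, rfl⟩ := Prod.mk.inj hab
          exact ⟨this.2.1, hxy.2.1, by rw [← this.2.2, hxy.2.2]⟩
        · exact hp _ _ hab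

theorem mg_ok (hP : IsFullerene P) {ι : ℕ → Flag P} : ∀ (f : ℕ) (s : St) (ps : List (ℕ × ℕ)), Ok s ι → OkP s.n ι ps →
    ∃ s', mg f s ps = some s' ∧ Ok s' ι
  | 0, s, _, h, _ => ⟨s, by cases ‹List (ℕ × ℕ)› <;> rfl, h⟩
  | _ + 1, s, [], h, _ => ⟨s, rfl, h⟩
  | f + 1, s, (a, b) :: ps, h, hp => by
    have hab := hp a b (by simp)
    have hp' : OkP s.n ι ps := fun a b h => hp a b (by simp [h])
    rw [mg]
    simp only [beqi, cond_eq_ite]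
    by_cases h1 : a = b
    · rw [if_pos h1]; exact mg_ok hP f s ps h hp'
    · rw [if_neg h1, if_neg (fun h2 => h1 (val_inj hP ι h2 hab.2.2))]
      generalize hA : (if Nat.ble a b = true then b else a) = A
      generalize hB : (if Nat.ble a b = true then a else b) = B
      have hAB : val ι A = val ι B ∧ B / 3 < s.n := by
        rw [← hA, ← hB]
        split_ifs
        · exact ⟨hab.2.2.symm, hab.1⟩
        · exact ⟨hab.2.2, hab.2.1⟩
      obtain ⟨t', ps', e, ht, hq⟩ := ins_ok (n := s.n) (ι := ι)
        ((s.t.ents 1 0 []).map fun p => (sub A B p.1, sub A B p.2)) Tr.nil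
        (ps.map fun p => (sub A B p.1, sub A B p.2)) (by
          intro x y hxy
          obtain ⟨⟨x, y⟩, hm, he⟩ := List.mem_map.1 hxy
          obtain ⟨rfl, rfl⟩ := Prod.mk.inj he
          rcases Tr.mem_ents _ _ _ _ _ _ hm with hm | ⟨j, rfl, hm2⟩
          · simp at hm
          · have := h.r _ _ hm2
            simp only [one_mul, add_zero]
            exact ⟨sub_lt hAB.2 this.1, sub_lt hAB.2 this.2.1, by rw [val_sub hP ι hAB.1, val_sub hP ι hAB.1]; exact this.2.2⟩)
        (by intro x y h; simp [Tr.get] at h) (by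
          intro x y hxy
          obtain ⟨⟨x, y⟩, hm, he⟩ := List.mem_map.1 hxy
          obtain ⟨rfl, rfl⟩ := Prod.mk.inj he
          have := hp' _ _ hm
          exact ⟨sub_lt hAB.2 this.1, sub_lt hAB.2 this.2.1, by rw [val_sub hP ι hAB.1, val_sub hP ι hAB.1]; exact this.2.2⟩)
      rw [e]
      exact mg_ok hP f ⟨s.n, t'⟩ ps' ⟨h.pos, ht⟩ hq

theorem rot2 (hP : IsFullerene P) (ι : ℕ → Flag P) (d : ℕ) : (val ι (rot (rot d))).rt = val ι d := by
  rw [val_rot hP, val_rot hP, rt3 hP]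

theorem bk_ok (hP : IsFullerene P) {s : St} {ι : ℕ → Flag P} (h : Ok s ι) : ∀ (f d : ℕ), d / 3 < s.n →
    bk s.t f d / 3 < s.n ∧ (val ι (bk s.t f d)).fc = (val ι d).fc
  | 0, d, hd => ⟨hd, rfl⟩
  | f + 1, d, hd => by
    rw [bk]
    rcases hg : s.t.get (rot (rot d)) with _ | y
    · exact ⟨hd, rfl⟩
    · have := h.r _ _ hg
      obtain ⟨h1, h2⟩ := bk_ok hP h f y this.2.1
      refine ⟨h1, h2.trans ?_⟩
      rw [← this.2.2, ← fc_rt, rot2 hP]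

theorem fw_ok (hP : IsFullerene P) (d : ℕ) : ∀ (r : ℕ) (s : St) (x : ℕ) (ι : ℕ → Flag P), Ok s ι → d / 3 < s.n →
    x / 3 < s.n → (val ι x).it r = val ι d → ∃ s' ι', fw d r s x = some s' ∧ Ok s' ι' ∧ ι' 0 = ι 0
  | 0, s, x, ι, h, hd, hx, e => by
    obtain ⟨s', h1, h2⟩ := mg_ok hP 60 s [(x, d)] h (by
      intro a b hab; simp only [List.mem_singleton, Prod.mk.injEq] at hab; obtain ⟨rfl, rfl⟩ := hab
      exact ⟨hx, hd, by simpa using e⟩)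
    exact ⟨s', ι, h1, h2, rfl⟩
  | r + 1, s, x, ι, h, hd, hx, e => by
    rw [fw.eq_def]
    simp only
    rcases hg : s.t.get x with _ | y
    · simp only
      cases r with
      | zero =>
        simp only
        have e' : (val ι x).rv = val ι (rot (rot d)) := by
          rw [val_rot hP, val_rot hP, ← e, it_succ, it_zero, prev hP]
        rcases hz : s.t.get (rot (rot d)) with _ | z
        · simp only [beqi, cond_eq_ite]
          rw [if_neg (fun h => no_loop ι e' (by rw [rot_div, rot_div]; exact h))]
          exact ⟨_, ι, rfl, ⟨h.pos, OkT.link h.r ⟨hx, by rw [rot_div, rot_div]; exact hd, e'⟩⟩, rfl⟩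
        · have := h.r _ _ hz
          obtain ⟨s', h1, h2⟩ := mg_ok hP 60 s [(z, x)] h (by
            intro a b hab; simp only [List.mem_singleton, Prod.mk.injEq] at hab; obtain ⟨rfl, rfl⟩ := hab
            exact ⟨this.2.1, hx, by rw [← this.2.2, ← e', rv_rv]⟩)
          exact ⟨s', ι, h1, h2, rfl⟩
      | succ r =>
        simp only
        let ι' : ℕ → Flag P := Function.update ι s.n (val ι x).rv
        have hv : ∀ z, z / 3 < s.n → val ι' z = val ι z := by
          intro z hz
          unfold val
          rw [show ι' (z / 3) = ι (z / 3) from Function.update_of_ne (by omega) _ _]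
        have hn : ι' s.n = (val ι x).rv := Function.update_self _ _ _
        have h3 : val ι' (3 * s.n) = (val ι x).rv := by
          unfold val
          rw [show 3 * s.n % 3 = 0 by omega, show 3 * s.n / 3 = s.n by omega]
          exact hn
        have h31 : val ι' (3 * s.n + 1) = (val ι x).nx := by
          unfold val
          rw [show (3 * s.n + 1) % 3 = 1 by omega, show (3 * s.n + 1) / 3 = s.n by omega, hn]
          exact (nx_eq _).symm
        have ho : OkT (s.n + 1) ι' s.t := by
          intro a b hab
          have := h.r _ _ hab
          exact ⟨by omega, by omega, by rw [hv _ this.1, hv _ this.2.1]; exact this.2.2⟩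
        obtain ⟨s', ι'', q1, q2, q3⟩ := fw_ok hP d (r + 1) ⟨s.n + 1, link s.t x (3 * s.n)⟩ (3 * s.n + 1) ι'
          ⟨by simp, ho.link ⟨by omega, by omega, by rw [h3, hv _ hx]⟩⟩ (by simp only; omega) (by simp only; omega)
          (by rw [h31, hv _ hd, ← it_succ']; exact e)
        exact ⟨s', ι'', q1, q2, q3.trans (Function.update_of_ne (by have := h.pos; omega) _ _)⟩
    · have := h.r _ _ hg
      refine fw_ok hP d r s (rot y) ι h hd (by rw [rot_div]; exact this.2.1) ?_
      rw [val_rot hP, ← this.2.2, ← nx_eq, ← it_succ']; exact e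

theorem setf_ok (hP : IsFullerene P) {s : St} {ι : ℕ → Flag P} (h : Ok s ι) {d k : ℕ} (hd : d / 3 < s.n)
    (hk : (val ι d).fc.card = k) : ∃ s' ι', setf s d k = some s' ∧ Ok s' ι' ∧ ι' 0 = ι 0 := by
  obtain ⟨h1, h2⟩ := bk_ok hP h 6 d hd
  refine fw_ok hP _ k s _ ι h h1 h1 ?_
  rw [← hk, ← h2, it_card]

theorem done_ok (hP : IsFullerene P) {s : St} {ι : ℕ → Flag P} (h : Ok s ι) (hd : done s = true) :
    Fintype.card V ≤ 59 := by
  unfold done at hd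
  simp only [Bool.and_eq_true, List.all_eq_true] at hd
  generalize hL : (List.range s.n).filter (fun v => isSome (s.t.get (3 * v))) = L at hd
  obtain ⟨⟨h1, h0⟩, h2⟩ := hd
  have hmem : ∀ y, y / 3 < s.n → isSome (s.t.get (3 * (y / 3))) = true → y / 3 ∈ L := by
    intro y hy hs
    rw [← hL]; simp [hy, hs]
  have key : ∀ v : V, ∃ k ∈ L, (ι k).vt = v := by
    intro v
    refine conn hP (fun v => ∃ k ∈ L, (ι k).vt = v) ?_ (v := (ι 0).vt) ⟨0, hmem 0 (by simpa using h.pos) (by simpa using h0), rfl⟩ v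
    rintro v w hvw ⟨k, hk, rfl⟩
    have hbr := nbr hP (ι k).vt (ι k).wt (ι k).rt.wt (ι k).rt.rt.wt (ι k).rt_ne.symm (ι k).rt.rt_ne.symm
      (rt_rt_ne hP (ι k)).symm (ι k).adj (by simpa using (ι k).rt.adj) (by simpa using (ι k).rt.rt.adj) w
    have go : ∀ i < 3, ∃ k' ∈ L, (ι k').vt = (rt^[i] (ι k)).wt := by
      intro i hi
      have := h2 k hk i (by simpa using hi)
      rcases hg : s.t.get (3 * k + i) with _ | y
      · rw [hg] at this; simp at this
      · rw [hg] at this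
        have hr := h.r _ _ hg
        refine ⟨y / 3, hmem y hr.2.1 this, ?_⟩
        rw [← val_vt, ← hr.2.2, vt_rv]
        unfold val
        rw [show (3 * k + i) % 3 = i by omega, show (3 * k + i) / 3 = k by omega]
    rcases hbr.1 hvw with rfl | rfl | rfl
    · exact go 0 (by norm_num)
    · exact go 1 (by norm_num)
    · exact go 2 (by norm_num)
  have : (univ : Finset V) ⊆ L.toFinset.image fun k => (ι k).vt := by
    intro v _
    obtain ⟨k, hk, hv⟩ := key v
    exact mem_image.2 ⟨k, by simpa using hk, hv⟩
  calc Fintype.card V = (univ : Finset V).card := rfl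
    _ ≤ _ := card_le_card this
    _ ≤ L.toFinset.card := card_image_le
    _ ≤ L.length := List.toFinset_card_le _
    _ ≤ 59 := Nat.le_of_ble_eq_true h1

theorem chk_ok (hP : IsFullerene P) : ∀ (f : ℕ) (s : St) (ι : ℕ → Flag P) (hs hs' : List ℕ), Ok s ι →
    chk f (some s) hs = some hs' → Fintype.card V ≤ 59
  | 0, s, ι, hs, hs', h, hc => by simp [chk] at hc
  | f + 1, s, ι, [], hs', h, hc => by simp [chk] at hc
  | f + 1, s, ι, d :: hs, hs', h, hc => by
    rw [chk] at hc
    simp only [beqi, cond_eq_ite] at hc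
    split_ifs at hc with h1 h2 h3
    · exact done_ok hP h h2
    · have hd : d / 3 < s.n := by
        by_contra hd
        exact h3 (Nat.ble_eq_true_of_le (by omega))
      · rcases hq : chk f (setf s d 5) hs with _ | hs2
        · rw [hq] at hc; simp at hc
        · rw [hq] at hc
          rcases hP.faceSize _ (val ι d).mf with h5 | h6
          · obtain ⟨s', ι', e, ho, -⟩ := setf_ok hP h hd h5
            rw [e] at hq
            exact chk_ok hP f s' ι' _ _ ho hq
          · obtain ⟨s', ι', e, ho, -⟩ := setf_ok hP h hd h6
            simp only [e] at hc
            exact chk_ok hP f s' ι' _ _ ho hc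

noncomputable def evalw : List ℕ → Flag P → Flag P
  | [], x => x
  | c :: w, x => evalw w (if c = 1 then x.rt else if c = 0 then x.rv else x.nx)

theorem walk_ok (hP : IsFullerene P) {s : St} {ι : ℕ → Flag P} (h : Ok s ι) : ∀ (w : List ℕ) (x y : ℕ),
    x / 3 < s.n → walk s.t w x = some y → y / 3 < s.n ∧ val ι y = evalw w (val ι x)
  | [], x, y, hx, e => by
    rw [walk] at e
    cases e
    exact ⟨hx, rfl⟩
  | c :: w, x, y, hx, e => by
    rw [walk] at e
    simp only [beqi, cond_eq_ite] at e
    rw [evalw]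
    by_cases h1 : c = 1
    · rw [if_pos h1] at e
      rw [if_pos h1, ← val_rot hP]
      exact walk_ok hP h w _ _ (by rw [rot_div]; exact hx) e
    · rw [if_neg h1] at e
      rw [if_neg h1]
      rcases hg : s.t.get x with _ | z
      · rw [hg] at e; simp at e
      · rw [hg] at e
        simp only at e
        have hr := h.r _ _ hg
        split_ifs at e with h0
        · rw [if_pos h0, hr.2.2]
          exact walk_ok hP h w _ _ hr.2.1 e
        · rw [if_neg h0, nx_eq, hr.2.2, ← val_rot hP]
          exact walk_ok hP h w _ _ (by rw [rot_div]; exact hr.2.1) e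

theorem facts_ok (hP : IsFullerene P) : ∀ (fs : List (List ℕ × ℕ)) (s : St) (ι : ℕ → Flag P), Ok s ι →
    (∀ f ∈ fs, (evalw f.1 (ι 0)).fc.card = f.2) → ∃ (s' : St) (ι' : ℕ → Flag P), facts fs s = some s' ∧ Ok s' ι'
  | [], s, ι, h, _ => ⟨s, ι, rfl, h⟩
  | (w, k) :: fs, s, ι, h, hf => by
    have hf' : ∀ f ∈ fs, (evalw f.1 (ι 0)).fc.card = f.2 := fun f hm => hf f (by simp [hm])
    have hw := hf (w, k) (by simp)
    rw [facts]
    rcases hg : walk s.t w 0 with _ | x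
    · exact facts_ok hP fs s ι h hf'
    · obtain ⟨h1, h2⟩ := walk_ok hP h w 0 x (by simpa using h.pos) hg
      have h00 : val ι 0 = ι 0 := rfl
      obtain ⟨s', ι', e, ho, h0⟩ := setf_ok hP h h1 (k := k) (by rw [h2, h00]; exact hw)
      simp only [e]
      exact facts_ok hP fs s' ι' ho (by rw [h0]; exact hf')

theorem run_ok (hP : IsFullerene P) (fs : List (List ℕ × ℕ)) (hs : List ℕ) (hr : run fs hs = true) (d : Flag P)
    (hf : ∀ f ∈ fs, (evalw f.1 d).fc.card = f.2) : Fintype.card V ≤ 59 := by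
  obtain ⟨s', ι', e, ho⟩ := facts_ok hP fs ⟨1, Tr.nil⟩ (fun _ => d)
    ⟨by simp, by intro x y h; simp [Tr.get] at h⟩ hf
  unfold run at hr
  rw [e] at hr
  rcases hq : chk 100 (some s') hs with _ | hs'
  · rw [hq] at hr; simp at hr
  · exact chk_ok hP _ _ _ _ _ ho hq

end Srch
end FG

namespace FG
open Finset
open FG.Flag
variable {V : Type} [Fintype V] [DecidableEq V]
set_option linter.unusedSectionVars false
set_option linter.unusedVariables false
variable {P : PlaneGraph V} {A H S C : Finset (Finset (Sym2 V))} {M : Finset (Sym2 V)} {e : Sym2 V}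
namespace Srch

def transF : List (List ℕ × ℕ) :=
  [([], 5), ([2, 1], 5), ([2, 2, 2, 2, 1], 5), ([2, 2, 2, 2, 1, 2, 1], 5), ([1], 6), ([2, 2, 2, 2, 1, 1], 6),
  ([2, 2, 1], 6), ([2, 2, 2, 2, 1, 2, 2, 1], 6), ([2, 1, 2, 2, 0], 5), ([2, 1, 2, 2, 0, 1, 1, 0, 1, 1, 0, 1,
  1], 5), ([2, 1, 2, 2, 0, 1, 1, 0, 1, 1, 0, 1, 1, 1, 1, 0], 5), ([2, 1, 2, 2, 0, 1, 1, 0, 1, 1, 0, 1, 1, 1,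
  1, 0, 2, 1], 5), ([2, 1, 2, 2, 0, 1, 1, 0, 1, 1, 0, 1, 1, 1, 1, 0, 2, 2, 2, 2, 1], 5), ([2, 1, 2, 2, 0, 1,
  1, 0, 1, 1, 0, 1, 1, 1, 1, 0, 2, 2, 2, 2, 1, 2, 1], 5), ([2, 1, 2, 2, 0, 1, 1, 0, 1, 1, 0, 1, 1, 1, 1, 0,
  1], 6), ([2, 1, 2, 2, 0, 1, 1, 0, 1, 1, 0, 1, 1, 1, 1, 0, 2, 2, 2, 2, 1, 1], 6), ([2, 1, 2, 2, 0, 1, 1, 0,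
  1, 1, 0, 1, 1, 1, 1, 0, 2, 2, 1], 6), ([2, 1, 2, 2, 0, 1, 1, 0, 1, 1, 0, 1, 1, 1, 1, 0, 2, 2, 2, 2, 1, 2, 2,
  1], 6)]
def transH : List ℕ :=
  [105, 51, 36, 60, 0, 93, 114, 117, 0, 120, 93, 108, 114, 36, 117, 108, 108, 0, 126, 117, 108, 0, 108, 120,
  120, 0, 132, 51, 36, 60, 114, 60, 120, 114, 114, 0, 126, 120, 123, 0, 126, 123, 129, 0, 132, 36, 60, 123,
  114, 114, 93, 93, 0, 132, 123, 126, 114, 114, 0, 132, 114, 93, 129, 129, 0, 138, 93, 129, 0, 129, 132, 132,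
  0, 144, 60, 114, 93, 108, 132, 108, 108, 0, 138, 93, 108, 120, 120, 0, 138, 108, 120, 129, 129, 0, 144, 120,
  129, 0, 129, 138, 138, 0, 150, 114, 93, 108, 120, 108, 120, 126, 141, 0, 120, 126, 0, 144, 138, 144, 147, 0,
  150, 93, 108, 120, 120, 126, 141, 0, 144, 108, 120, 126, 144, 126, 126, 0, 150, 120, 126, 132, 147, 0, 150,
  126, 132, 141, 0, 156, 141, 153, 153, 0, 132, 141, 150, 150, 0, 162, 141, 150, 0, 150, 156, 156, 168, 168,
  0]
set_option maxRecDepth 100000 in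
theorem trans_run : run transF transH = true := by decide +kernel

def cisF : List (List ℕ × ℕ) :=
  [([], 5), ([2, 1], 5), ([2, 2, 2, 2, 1], 5), ([2, 2, 2, 2, 1, 2, 1], 5), ([1], 6), ([2, 2, 2, 2, 1, 1], 6),
  ([2, 2, 1], 6), ([2, 2, 2, 2, 1, 2, 2, 1], 6), ([2, 1, 2, 2, 0], 5), ([2, 1, 2, 2, 1, 1, 1, 1, 0, 1, 1, 1,
  1, 0, 1, 1, 1, 1, 0], 5), ([2, 1, 2, 2, 1, 1, 1, 1, 0, 1, 1, 1, 1, 0, 1, 1, 1, 1, 1, 1, 1, 1, 0, 0], 5),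
  ([2, 1, 2, 2, 1, 1, 1, 1, 0, 1, 1, 1, 1, 0, 1, 1, 1, 1, 1, 1, 1, 1, 0, 0, 1, 1, 1, 1, 0], 5), ([2, 1, 2, 2,
  1, 1, 1, 1, 0, 1, 1, 1, 1, 0, 1, 1, 1, 1, 1, 1, 1, 1, 0, 0, 1, 1, 0, 1, 1, 0, 1, 1, 0, 1, 1, 1, 1, 1, 1, 0],
  6), ([2, 1, 2, 2, 1, 1, 1, 1, 0, 1, 1, 1, 1, 0, 1, 1, 1, 1, 1, 1, 1, 1, 0, 0, 1, 1, 0, 1, 1, 0, 1, 1, 0, 1,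
  1, 1, 1, 0], 5), ([2, 1, 2, 2, 1, 1, 1, 1, 0, 1, 1, 1, 1, 0, 1, 1, 1, 1, 1, 1, 1, 1, 0, 0, 1, 1, 0, 1, 1, 0,
  1, 1, 0, 1, 1, 1, 1, 0, 1, 1, 1, 1, 0], 5), ([2, 1, 2, 2, 1, 1, 1, 1, 0, 1, 1, 1, 1, 0, 1, 1, 1, 1, 1, 1, 1,
  1, 0, 1, 1, 0], 6), ([2, 1, 2, 2, 1, 1, 1, 1, 0, 1, 1, 1, 1, 0, 1, 1, 1, 1, 1, 1, 1, 1, 0, 0, 1, 1, 0, 1, 1,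
  1, 1, 0], 6), ([2, 1, 2, 2, 1, 1, 1, 1, 0, 1, 1, 1, 1, 0, 1, 1, 1, 1, 1, 1, 1, 1, 0, 0, 1, 1, 0, 1, 1, 0, 1,
  1, 0, 1, 1, 1, 1, 0, 1, 1, 0, 1, 1, 1, 1, 0], 6)]
def cisH : List ℕ :=
  [96, 102, 36, 0, 108, 36, 60, 0, 60, 105, 0, 114, 105, 111, 111, 0, 36, 60, 108, 108, 111, 0, 114, 111, 114,
  117, 0, 60, 114, 63, 108, 108, 0, 120, 108, 120, 102, 102, 0, 120, 102, 0, 126, 102, 126, 126, 0, 132, 114,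
  108, 102, 117, 123, 0, 126, 102, 117, 0, 117, 120, 120, 0, 132, 108, 102, 120, 126, 120, 120, 0, 132, 102,
  120, 117, 129, 0, 132, 123, 120, 132, 0, 138, 132, 135, 135, 0, 120, 132, 135, 141, 0, 132, 138, 0, 144,
  138, 144, 147, 150, 150, 0]
set_option maxRecDepth 100000 in
theorem cis_run : run cisF cisH = true := by decide +kernel

def b3F : List (List ℕ × ℕ) :=
  [([], 5), ([2, 1], 5), ([2, 2, 2, 2, 1], 5), ([2, 2, 2, 2, 1, 2, 1], 5), ([0], 5), ([0, 2, 2, 2, 2, 1, 2,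
  1], 5), ([2, 2, 2, 2, 1, 2, 1, 2, 2, 1], 5), ([2, 2, 2, 2, 1, 1], 6), ([0, 2, 2, 2, 2, 1, 1], 6), ([2, 2,
  1], 6), ([2, 2, 2, 2, 1, 2, 2, 1], 6)]
def b3H : List ℕ :=
  [54, 72, 48, 84, 75, 75, 0, 90, 84, 87, 0, 90, 87, 93, 0, 96, 48, 75, 78, 81, 81, 0, 96, 78, 81, 0, 81, 90,
  90, 0, 102, 75, 78, 81, 81, 87, 99, 0, 102, 78, 81, 87, 81, 87, 0, 87, 105, 0, 108, 105, 108, 111, 0, 114,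
  72, 48, 87, 75, 0, 75, 78, 78, 0, 96, 87, 75, 78, 0, 96, 78, 93, 93, 0, 75, 78, 93, 99, 0, 102, 78, 93, 0,
  102, 93, 96, 0, 108, 96, 105, 105, 0, 114, 48, 75, 78, 81, 0, 96, 81, 99, 0, 102, 78, 84, 99, 0, 102, 99,
  102, 105, 0, 84, 93, 99, 105, 0, 108, 93, 99, 0, 108, 102, 111, 0, 114, 111, 114, 117, 0, 120, 75, 78, 81,
  84, 84, 0, 102, 84, 102, 90, 0, 108, 90, 105, 105, 0, 102, 108, 105, 111, 0, 114, 108, 111, 0, 114, 111,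
  117, 120, 120, 0, 78, 84, 102, 90, 90, 0, 108, 102, 105, 0, 108, 90, 108, 0, 114, 108, 111, 111, 0, 120, 84,
  105, 90, 96, 111, 0, 114, 90, 96, 0, 114, 96, 108, 0, 120, 108, 117, 117, 0, 126, 105, 90, 96, 111, 0, 120,
  111, 117, 117, 0, 96, 111, 114, 114, 0, 126, 111, 114, 0, 114, 120, 120, 132, 132, 0, 90, 96, 111, 114, 123,
  0, 111, 120, 0, 126, 120, 126, 129, 132, 132, 0, 96, 111, 114, 0, 126, 117, 126, 0, 132, 126, 129, 129, 0,
  138, 111, 117, 129, 0, 132, 129, 132, 135, 0, 138, 117, 132, 123, 0, 138, 123, 135, 135, 0, 144, 132, 123,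
  138, 0, 144, 138, 141, 141, 0, 150, 123, 138, 141, 147, 0, 150, 138, 144, 150, 150, 0, 144, 153, 156, 156,
  0, 153, 159, 0, 162, 159, 162, 165, 168, 168, 0, 174]
set_option maxRecDepth 100000 in
theorem b3_run : run b3F b3H = true := by decide +kernel


theorem evalw_append (w w' : List ℕ) (x : Flag P) : evalw (w ++ w') x = evalw w' (evalw w x) := by
  induction w generalizing x with
  | nil => rfl
  | cons c w ih => rw [List.cons_append, evalw, evalw, ih]

def mir : List ℕ → List ℕ
  | [] => []
  | c :: w => (if c = 1 then [1, 1] else if c = 0 then [0] else [0, 1, 1]) ++ mir w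

theorem evalw_mir (hP : IsFullerene P) (w : List ℕ) (x : Flag P) : evalw (mir w) x = (evalw w x.s2).s2 := by
  induction w generalizing x with
  | nil => simp [mir, evalw]
  | cons c w ih =>
    rw [mir, evalw_append, ih, evalw]
    congr 2
    split_ifs with h1 h2
    · simp only [evalw, if_true]
      rw [rt_rt_eq hP, rt_def x.s2, s2_s2, s2_s2]
    · simp [evalw, rv_def, s0_s2]
    · simp only [evalw, if_true, if_false, Nat.zero_ne_one]
      rw [rt_rt_eq hP, s2_s2, nx_def, rv_def]

def stW : List ℕ := [2, 2, 2, 2, 1]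
def epW : List ℕ := [2, 1, 2, 2]
def epJ : List ℕ := [1, 1, 0, 1, 1, 0, 1, 1]
def epI : List ℕ := epJ ++ [1, 1, 0]
def coreF : List (List ℕ × ℕ) := [([], 5), ([2, 1], 5), (stW, 5), (stW ++ [2, 1], 5), ([1], 6), (stW ++ [1], 6),
  ([2, 2, 1], 6), (stW ++ [2, 2, 1], 6)]
def transG : List (List ℕ × ℕ) := coreF ++ [(epW ++ [0], 5), (epW ++ [0] ++ epJ, 5)] ++
  coreF.map fun f => (epW ++ [0] ++ epI ++ f.1, f.2)
def cisG : List (List ℕ × ℕ) := coreF ++ [(epW ++ [0], 5), (epW ++ mir epJ ++ [0], 5)] ++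
  coreF.map fun f => (epW ++ mir (epI ++ f.1) ++ [0], f.2)

theorem evalw_st (d : Flag P) : evalw stW d = d.st := rfl
theorem evalw_ep (d : Flag P) : evalw epW d = d.ep := rfl
theorem evalw_epJ (hP : IsFullerene P) (d : Flag P) : evalw epJ d.ep = d.nx := by
  simp only [epJ, evalw, Flag.ep, if_true, if_false, Nat.zero_ne_one]
  rw [prev hP, rv_rv, prev hP, rv_rv, rt3 hP]
theorem evalw_epI (hP : IsFullerene P) (d : Flag P) : evalw epI d.ep = d := by
  rw [epI, evalw_append, evalw_epJ hP]
  simp only [evalw, if_true, if_false, Nat.zero_ne_one]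
  rw [prev hP, rv_rv]

theorem core_facts {d : Flag P} (c : Core S d) (hm : ∀ x : Flag P, x.fc ∈ S → x.rt.fc ∉ S → x.rt.fc.card = 6) :
    ∀ f ∈ coreF, (evalw f.1 d).fc.card = f.2 := by
  simp only [coreF, List.forall_mem_cons, evalw_append, evalw_st]
  exact ⟨c.pent _ c.a, c.pent _ c.a1, c.pent _ c.a4, c.pent _ c.a5, hm _ c.a c.ns, hm _ c.a4 c.nt, c.h1, c.h2,
    fun f hf => by simp at hf⟩

theorem s2_rv_fc (y : Flag P) : y.s2.rv.fc = y.fc := by simp [rv_def]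

theorem bad2_small (hP : IsFullerene P) {d d' : Flag P} (c : Bad2 S d d')
    (hm : ∀ x : Flag P, x.fc ∈ S → x.rt.fc ∉ S → x.rt.fc.card = 6) : Fintype.card V ≤ 59 := by
  obtain ⟨c1, c2, h | h⟩ := c
  · refine run_ok hP transF transH trans_run d fun f hf => ?_
    have hs : ∀ f ∈ transF, f ∈ transG := by decide
    have hf := hs f hf
    simp only [transG, List.mem_append, List.mem_map, List.mem_cons, List.not_mem_nil, or_false] at hf
    have hq : evalw (epW ++ [0]) d = d'.ep := by rw [evalw_append, evalw_ep, h]; rfl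
    rcases hf with (hf | rfl | rfl) | ⟨g, hg, rfl⟩
    · exact core_facts c1 hm f hf
    · simp only [hq, ep_fc]; exact c2.pent _ c2.a1
    · simp only [evalw_append _ epJ, hq, evalw_epJ hP, fc_nx]; exact c2.pent _ c2.a
    · simp only [evalw_append _ epI, evalw_append _ g.1, hq, evalw_epI hP]
      exact core_facts c2 hm g hg
  · refine run_ok hP cisF cisH cis_run d fun f hf => ?_
    have hs : ∀ f ∈ cisF, f ∈ cisG := by decide
    have hf := hs f hf
    simp only [cisG, List.mem_append, List.mem_map, List.mem_cons, List.not_mem_nil, or_false] at hf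
    have hq : evalw epW d = d'.ep.s2 := by rw [evalw_ep, h, s2_s2]
    have h0 : ∀ x : Flag P, evalw [0] x = x.rv := fun x => rfl
    rcases hf with (hf | rfl | rfl) | ⟨g, hg, rfl⟩
    · exact core_facts c1 hm f hf
    · simp only [evalw_append _ [0], hq, h0, s2_rv_fc, ep_fc]; exact c2.pent _ c2.a1
    · simp only [evalw_append _ [0], evalw_append _ (mir _), hq, evalw_mir hP, s2_s2, h0, s2_rv_fc, evalw_epJ hP, fc_nx]
      exact c2.pent _ c2.a
    · simp only [evalw_append _ [0], evalw_append _ (mir _), hq, evalw_mir hP, s2_s2, h0, s2_rv_fc,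
        evalw_append _ g.1, evalw_epI hP]
      exact core_facts c2 hm g hg

def b3G : List (List ℕ × ℕ) := [([], 5), ([2, 1], 5), (stW, 5), (stW ++ [2, 1], 5), ([0], 5), ([0] ++ stW ++ [2, 1], 5),
  (stW ++ epW ++ [1], 5), (stW ++ [1], 6), ([0] ++ stW ++ [1], 6), ([2, 2, 1], 6), (stW ++ [2, 2, 1], 6)]

theorem bad3_small (hP : IsFullerene P) {d : Flag P} (c : Bad3 S d)
    (hm : ∀ x : Flag P, x.fc ∈ S → x.rt.fc ∉ S → x.rt.fc.card = 6) (h4 : d.rv.st.fc ∈ S) : Fintype.card V ≤ 59 := by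
  obtain ⟨p, a1, a2, a3, a4, a5, a6, a7, b1, b2, b3, b4⟩ := c
  refine run_ok hP b3F b3H b3_run d fun f hf => ?_
  have hs : ∀ f ∈ b3F, f ∈ b3G := by decide
  have hf := hs f hf
  simp only [b3G, List.mem_cons, List.not_mem_nil, or_false] at hf
  rcases hf with rfl | rfl | rfl | rfl | rfl | rfl | rfl | rfl | rfl | rfl | rfl
  · exact p _ a1
  · exact p _ a2
  · exact p _ a3
  · exact p _ a4
  · exact p _ a5
  · exact p _ a6
  · exact p _ a7
  · exact hm d.st a3 b1.1
  · exact hm d.rv.st h4 b2.1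
  · exact hm d.nx.nx (by simpa using a1) b3.1
  · exact hm d.st.nx.nx (by simpa using a3) b4.1

end Srch

theorem bad_small (hP : IsFullerene P) (c : Bad P S)
    (hm : ∀ x : Flag P, x.fc ∈ S → x.rt.fc ∉ S → x.rt.fc.card = 6) : Fintype.card V ≤ 59 := by
  rcases c with ⟨d, c⟩ | ⟨d, d', c⟩
  · refine Srch.bad3_small hP c hm ?_
    obtain ⟨p, -, a2, -, -, a5, -⟩ := c
    rw [st_fc' hP (p _ a5), ← nx_eq]; exact a2
  · exact Srch.bad2_small hP c hm

theorem part_one (hP : IsFullerene P) (hn : 60 ≤ Fintype.card V) (B : Fragment P) (h5 : IsPentagonalFragment B)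
    (hm : IsMaximalIn P B.edges) (hp : Pasted P B) : SixShapes B := by
  rcases pasted_inv hP hn hp with h | h | h | h | h | h | h
  · exact Or.inl h
  · exact Or.inr (Or.inl h)
  · exact Or.inr (Or.inr (Or.inl h))
  · exact Or.inr (Or.inr (Or.inr (Or.inl h.1)))
  · exact Or.inr (Or.inr (Or.inr (Or.inr (Or.inl h.1))))
  · exact Or.inr (Or.inr (Or.inr (Or.inr (Or.inr h.1))))
  · have := bad_small hP h (maximal_hex hP hn h5 hm)
    omega

end FG

namespace FG
open Finset

section tc
variable {W : Type} [Fintype W] [DecidableEq W]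

/-- A connected graph in which the neighbours of every vertex lie on a cycle avoiding it, such that
these cycles overlap suitably, is 3-connected. -/
theorem three_conn (G : SimpleGraph W) (hG : G.Connected) (m : W → ℕ) (g : W → ℕ → W) (E : W → Finset (Sym2 W))
    (hc : ∀ a, Cyc (m a) (g a) (E a)) (he : ∀ a, ∀ e ∈ E a, e ∈ G.edgeSet) (hna : ∀ a i, g a i ≠ a)
    (hnb : ∀ a b, G.Adj a b → ∃ i, g a i = b) (hcm : ∀ a b, G.Adj a b → ∃ i j, g a i = g b j ∧ g a i ≠ b)
    (s : Set W) (hs : s.ncard ≤ 2) : (G.induce sᶜ).Connected := by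
  have h3 : ∀ a b c, a ∈ s → b ∈ s → c ∈ s → a ≠ b → a ≠ c → b ≠ c → False := by
    intro a b c ha hb hc h1 h2 h3
    have hsub : (({a, b, c} : Finset W) : Set W) ⊆ s := by
      intro x hx; simp at hx; rcases hx with rfl | rfl | rfl <;> assumption
    have := Set.ncard_le_ncard hsub (Set.toFinite s)
    rw [Set.ncard_coe_finset, card_eq_three.2 ⟨a, b, c, h1, h2, h3, rfl⟩] at this
    omega
  let R : W → W → Prop := fun x y => ∃ (hx : x ∈ sᶜ) (hy : y ∈ sᶜ), (G.induce sᶜ).Reachable ⟨x, hx⟩ ⟨y, hy⟩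
  have rr : ∀ {x}, x ∉ s → R x x := fun {x} hx => ⟨hx, hx, SimpleGraph.Reachable.refl _⟩
  have rt : ∀ {x y z}, R x y → R y z → R x z := by
    rintro x y z ⟨h1, h2, h3⟩ ⟨h4, h5, h6⟩
    exact ⟨h1, h5, h3.trans h6⟩
  have rs : ∀ {x y}, R x y → R y x := by
    rintro x y ⟨h1, h2, h3⟩
    exact ⟨h2, h1, h3.symm⟩
  have ra : ∀ {x y}, x ∉ s → y ∉ s → G.Adj x y → R x y := by
    intro x y hx hy h
    refine ⟨hx, hy, SimpleGraph.Adj.reachable ?_⟩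
    simpa using h
  have adj : ∀ a i, G.Adj (g a i) (g a (i + 1)) := fun a i => by simpa using he a _ ((hc a).edge i)
  let N : W → W → Prop := fun v x => (v ∉ s ∧ x = v) ∨ (v ∈ s ∧ x ∉ s ∧ ∃ i, g v i = x)
  have seg : ∀ v a k, (∀ j ≤ k, g v (a + j) ∉ s) → R (g v a) (g v (a + k)) := by
    intro v a k
    induction k with
    | zero => intro h; exact rr (h 0 le_rfl)
    | succ k ih =>
      intro h
      exact rt (ih fun j hj => h j (by omega)) (ra (h k (by omega)) (h (k + 1) le_rfl) (adj v (a + k)))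
  have c1 : ∀ v x y, N v x → N v y → R x y := by
    intro v x y h1 h2
    rcases h1 with ⟨hv, rfl⟩ | ⟨hv, hx, i, rfl⟩ <;> rcases h2 with ⟨hv', rfl⟩ | ⟨hv', hy, j, rfl⟩
    · exact rr hv
    · exact absurd hv' hv
    · exact absurd hv hv'
    · have m3 := (hc v).three
      by_cases ht : ∃ i0, g v i0 ∈ s
      · obtain ⟨i0, ht⟩ := ht
        have key : ∀ i, g v i ∉ s → R (g v (i0 + 1)) (g v i) := by
          intro i hi
          have hne : i % m v ≠ i0 % m v := fun h => hi (by rw [((hc v).eq_iff i i0).2 h]; exact ht)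
          obtain ⟨k, hk, hk2⟩ : ∃ k, k < m v - 1 ∧ (i0 + 1 + k) % m v = i % m v := by
            refine ⟨(i % m v + (m v - 1 - i0 % m v)) % m v, ?_, ?_⟩
            · have a1 := Nat.mod_lt i (show m v > 0 by omega)
              have a2 := Nat.mod_lt i0 (show m v > 0 by omega)
              rcases Nat.lt_or_ge (i % m v + (m v - 1 - i0 % m v)) (m v) with h | h
              · rw [Nat.mod_eq_of_lt h]; omega
              · rw [Nat.mod_eq_sub_mod h, Nat.mod_eq_of_lt (by omega)]; omega
            · have a2 := Nat.mod_lt i0 (show m v > 0 by omega)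
              rw [Nat.add_mod_mod, ← Nat.mod_add_mod, ← Nat.mod_add_mod i0, Nat.mod_add_mod,
                show i0 % m v + 1 + (i % m v + (m v - 1 - i0 % m v)) = i % m v + m v by omega]
              simp
          have e := ((hc v).eq_iff _ _).2 hk2
          rw [← e]
          refine seg v _ _ fun j hj hjs => ?_
          refine h3 v (g v i0) _ hv ht hjs (hna v _).symm (hna v _).symm fun h => ?_
          have h := ((hc v).eq_iff _ _).1 h
          have h' : (0 + i0) % m v = (1 + j + i0) % m v := by rw [zero_add, h]; congr 1; omega
          have h' : (0 : ℕ) ≡ 1 + j [MOD m v] := Nat.ModEq.add_right_cancel' i0 h'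
          unfold Nat.ModEq at h'
          rw [Nat.zero_mod, Nat.mod_eq_of_lt (by omega)] at h'
          omega
        exact rt (rs (key i hx)) (key j hy)
      · push Not at ht
        have key : ∀ i, R (g v 0) (g v i) := fun i => by
          have := seg v 0 i fun j _ => ht _
          rwa [zero_add] at this
        exact rt (rs (key i)) (key j)
  have c0 : ∀ v, ∃ x, N v x := by
    intro v
    by_cases hv : v ∈ s
    · have m3 := (hc v).three
      by_cases h0 : g v 0 ∈ s
      · refine ⟨g v 1, Or.inr ⟨hv, fun h1 => ?_, 1, rfl⟩⟩
        refine h3 v _ _ hv h0 h1 (hna v _).symm (hna v _).symm fun h => ?_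
        have := (hc v).inj 0 (by omega) 1 (by omega) h
        omega
      · exact ⟨g v 0, Or.inr ⟨hv, h0, 0, rfl⟩⟩
    · exact ⟨v, Or.inl ⟨hv, rfl⟩⟩
  have cs : ∀ v x, N v x → x ∉ s := by
    rintro v x (⟨h, rfl⟩ | ⟨-, h, -⟩) <;> exact h
  have c2 : ∀ v w, G.Adj v w → ∃ x y, N v x ∧ N w y ∧ R x y := by
    intro v w h
    by_cases hv : v ∈ s
    · by_cases hw : w ∈ s
      · obtain ⟨i, j, h1, h2⟩ := hcm v w h
        have hx : g v i ∉ s := fun h' => h3 v w _ hv hw h' h.ne (hna v _).symm h2.symm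
        exact ⟨g v i, g v i, Or.inr ⟨hv, hx, i, rfl⟩, Or.inr ⟨hw, hx, j, h1.symm⟩, rr hx⟩
      · obtain ⟨i, hi⟩ := hnb v w h
        exact ⟨w, w, Or.inr ⟨hv, hw, i, hi⟩, Or.inl ⟨hw, rfl⟩, rr hw⟩
    · by_cases hw : w ∈ s
      · obtain ⟨i, hi⟩ := hnb w v h.symm
        exact ⟨v, v, Or.inl ⟨hv, rfl⟩, Or.inr ⟨hw, hv, i, hi⟩, rr hv⟩
      · exact ⟨v, w, Or.inl ⟨hv, rfl⟩, Or.inl ⟨hw, rfl⟩, ra hv hw h⟩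
  have c3 : ∀ v w (p : G.Walk v w) x y, N v x → N w y → R x y := by
    intro v w p
    induction p with
    | nil => exact fun x y => c1 _ x y
    | cons h p ih =>
      intro x y hx hy
      obtain ⟨x', y', h1, h2, h3⟩ := c2 _ _ h
      exact rt (rt (c1 _ _ _ hx h1) h3) (ih _ _ h2 hy)
  rw [SimpleGraph.connected_iff]
  refine ⟨?_, ?_⟩
  · rintro ⟨x, hx⟩ ⟨y, hy⟩
    obtain ⟨p⟩ := hG.preconnected x y
    obtain ⟨_, _, h⟩ := c3 x y p x y (Or.inl ⟨hx, rfl⟩) (Or.inl ⟨hy, rfl⟩)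
    exact h
  · obtain ⟨v⟩ := hG.nonempty
    obtain ⟨x, hx⟩ := c0 v
    exact ⟨⟨x, cs v x hx⟩⟩

end tc

/-- the edges of a closed walk given by its list of vertices -/
def led {W : Type} (l : List W) : List (Sym2 W) := List.zipWith (fun a b => s(a, b)) l (l.rotate 1)

theorem mem_led {W : Type} [Inhabited W] (l : List W) (e : Sym2 W) :
    e ∈ led l ↔ ∃ i < l.length, e = s(l.getD (i % l.length) default, l.getD ((i + 1) % l.length) default) := by
  unfold led
  rw [List.mem_iff_getElem]
  constructor
  · rintro ⟨i, hi, rfl⟩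
    have hi : i < l.length := by simpa using hi
    refine ⟨i, hi, ?_⟩
    have h2 : (i + 1) % l.length < l.length := Nat.mod_lt _ (by omega)
    simp [List.getElem_zipWith, List.getElem_rotate, Nat.mod_eq_of_lt hi, List.getElem?_eq_getElem, hi, h2]
  · rintro ⟨i, hi, rfl⟩
    refine ⟨i, by simpa using hi, ?_⟩
    have h2 : (i + 1) % l.length < l.length := Nat.mod_lt _ (by omega)
    simp [List.getElem_zipWith, List.getElem_rotate, Nat.mod_eq_of_lt hi, List.getElem?_eq_getElem, hi, h2]

theorem cyc_led {W : Type} [Inhabited W] [DecidableEq W] (l : List W) (h3 : 3 ≤ l.length) (hn : l.Nodup) :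
    Cyc l.length (fun i => l.getD (i % l.length) default) (led l).toFinset := by
  refine ⟨h3, fun i => by simp, ?_, ?_⟩
  · intro i hi j hj h
    simp only [Nat.mod_eq_of_lt hi, Nat.mod_eq_of_lt hj] at h
    simp [hi, hj] at h
    exact (hn.getElem_inj_iff).1 h
  · intro e
    rw [List.mem_toFinset, mem_led]

theorem getD_mem {W : Type} [Inhabited W] (l : List W) (h : 0 < l.length) (i : ℕ) :
    l.getD (i % l.length) default ∈ l := by
  have h2 : i % l.length < l.length := Nat.mod_lt _ h
  simp [h2]

theorem mem_getD {W : Type} [Inhabited W] (l : List W) {x : W} (h : x ∈ l) :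
    ∃ i, l.getD (i % l.length) default = x := by
  obtain ⟨i, hi, rfl⟩ := List.mem_iff_getElem.1 h
  exact ⟨i, by simp [Nat.mod_eq_of_lt hi, hi]⟩

end FG

namespace FG
open Finset
set_option linter.unusedVariables false

abbrev N60 := Fin 60

instance (priority := 100000) decBAll {W : Type} (p : W → Prop) [DecidablePred p] (l : List W) :
    Decidable (∀ x ∈ l, p x) := List.decidableBAll p l

instance (priority := 100000) decBEx {W : Type} (p : W → Prop) [DecidablePred p] (l : List W) :
    Decidable (∃ x ∈ l, p x) := List.decidableBEx p l
/-- the sixty vertices, as an explicit list -/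
def allV : List N60 := [
  0, 1, 2, 3, 4, 5, 6, 7, 8, 9, 10, 11, 12, 13, 14, 15, 16, 17, 18, 19,
  20, 21, 22, 23, 24, 25, 26, 27, 28, 29, 30, 31, 32, 33, 34, 35, 36, 37, 38, 39,
  40, 41, 42, 43, 44, 45, 46, 47, 48, 49, 50, 51, 52, 53, 54, 55, 56, 57, 58, 59]

theorem mem_allV (a : N60) : a ∈ allV := by
  have h : allV = (List.range 60).map (Fin.ofNat 60) := by decide +kernel
  rw [h, List.mem_map]
  exact ⟨a.1, List.mem_range.2 a.2, Fin.ext (Nat.mod_eq_of_lt a.2)⟩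

theorem forall_V {p : N60 → Prop} (h : ∀ a ∈ allV, p a) (a : N60) : p a := h a (mem_allV a)

abbrev fz (l : List N60) : Finset (Sym2 N60) := (led l).toFinset

/-- checks for a fullerene on 60 vertices given by its facial cycles, neighbour lists, and for every
vertex the cycle around it -/
structure DOk (F : List (List N60)) (nb lk : N60 → List N60) : Prop where
  sym : ∀ a, ∀ b ∈ nb a, a ∈ nb b ∧ a ≠ b
  three : ∀ a, (nb a).Nodup ∧ (nb a).length = 3
  face : ∀ l ∈ F, l.Nodup ∧ (l.length = 5 ∨ l.length = 6) ∧ ∀ p ∈ List.zip l (l.rotate 1), p.2 ∈ nb p.1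
  dist : F.Pairwise fun l l' => ∃ x ∈ l, x ∉ l'
  two : ∀ a, ∀ b ∈ nb a, (F.filter fun l => (a, b) ∈ List.zip l (l.rotate 1) ∨ (b, a) ∈ List.zip l (l.rotate 1)).length = 2
  cnt : F.length = 32 ∧ (F.map List.length).sum = 180 ∧ (F.filter fun l => l.length = 5).length = 12
  tree : ∀ a, a ≠ 0 → ∃ b ∈ nb a, b < a
  link : ∀ a, (lk a).Nodup ∧ 3 ≤ (lk a).length ∧ a ∉ lk a ∧ (∀ p ∈ List.zip (lk a) ((lk a).rotate 1), p.2 ∈ nb p.1) ∧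
    ∀ b ∈ nb a, b ∈ lk a ∧ ∃ x ∈ lk a, x ∈ lk b ∧ x ≠ b

theorem mem_led_zip {W : Type} (l : List W) (e : Sym2 W) : e ∈ led l ↔ ∃ p ∈ List.zip l (l.rotate 1), e = s(p.1, p.2) := by
  unfold led
  rw [← List.map_uncurry_zip_eq_zipWith, List.mem_map]
  simp only [eq_comm]
  rfl

theorem mem_led_zip' {W : Type} (l : List W) (a b : W) : s(a, b) ∈ led l ↔
    (a, b) ∈ List.zip l (l.rotate 1) ∨ (b, a) ∈ List.zip l (l.rotate 1) := by
  rw [mem_led_zip]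
  constructor
  · rintro ⟨⟨x, y⟩, hp, he⟩
    rcases Sym2.eq_iff.1 he with ⟨rfl, rfl⟩ | ⟨rfl, rfl⟩
    · exact Or.inl hp
    · exact Or.inr hp
  · rintro (h | h)
    · exact ⟨_, h, rfl⟩
    · exact ⟨_, h, Sym2.eq_swap⟩

namespace DOk
variable {F : List (List N60)} {nb lk : N60 → List N60}

def gr (nb : N60 → List N60) (h : ∀ a, ∀ b ∈ nb a, a ∈ nb b ∧ a ≠ b) : SimpleGraph N60 where
  Adj a b := b ∈ nb a
  symm := ⟨fun a b hab => (h a b hab).1⟩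
  loopless := ⟨fun a ha => (h a a ha).2 rfl⟩

theorem led_adj (D : DOk F nb lk) {l : List N60} (h : ∀ p ∈ List.zip l (l.rotate 1), p.2 ∈ nb p.1) :
    ∀ e ∈ fz l, e ∈ (gr nb D.sym).edgeSet := by
  intro e he
  obtain ⟨p, hp, rfl⟩ := (mem_led_zip l e).1 (List.mem_toFinset.1 he)
  exact h p hp

theorem inF (D : DOk F nb lk) {l} (hl : l ∈ F) : Cyc l.length (fun i => l.getD (i % l.length) default) (fz l) :=
  cyc_led l (by rcases (D.face l hl).2.1 with h | h <;> omega) (D.face l hl).1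

theorem nodup (D : DOk F nb lk) : (F.map fz).Nodup := by
  rw [List.Nodup, List.pairwise_map]
  refine List.Pairwise.imp_of_mem ?_ D.dist
  rintro l l' hl hl' ⟨x, hx, hx'⟩ he
  obtain ⟨i, rfl⟩ := mem_getD l hx
  have := (D.inF hl).edge i
  rw [he] at this
  obtain ⟨j, -, hj⟩ := (D.inF hl').mem_vert this
  rw [hj] at hx'
  exact hx' (getD_mem l' (by have := (D.inF hl').three; omega) _)

theorem card_filter (D : DOk F nb lk) (p : Finset (Sym2 N60) → Prop) [DecidablePred p] :
    ((F.map fz).toFinset.filter p).card = (F.filter fun l => p (fz l)).length := by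
  have h : (F.map fz).toFinset.filter p = ((F.map fz).filter (fun x => decide (p x))).toFinset := by
    ext x; simp
  rw [h, List.toFinset_card_of_nodup (D.nodup.filter _), List.filter_map, List.length_map]
  rfl

def pg (D : DOk F nb lk) : PlaneGraph N60 where
  graph := gr nb D.sym
  faces := (F.map fz).toFinset
  face_edges := by
    intro f hf
    obtain ⟨l, hl, rfl⟩ := List.mem_map.1 (List.mem_toFinset.1 hf)
    exact D.led_adj (D.face l hl).2.2
  face_cycle := by
    intro f hf
    obtain ⟨l, hl, rfl⟩ := List.mem_map.1 (List.mem_toFinset.1 hf)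
    exact (D.inF hl).toWalk (D.led_adj (D.face l hl).2.2)
  edge_faces := by
    intro e
    induction e with
    | h a b =>
      intro he
      rw [D.card_filter, ← D.two a b he]
      congr 2
      ext l
      exact decide_eq_decide.2 (List.mem_toFinset.trans (mem_led_zip' l a b))
  euler := by
    have h : F.map ((fun f => f.card) ∘ fz) = F.map List.length :=
      List.map_congr_left fun l hl => (D.inF hl).card
    rw [List.toFinset_card_of_nodup D.nodup, List.length_map, D.cnt.1, List.sum_toFinset _ D.nodup, List.map_map,
      h, D.cnt.2.1]
    rfl

theorem full (D : DOk F nb lk) : IsFullerene D.pg where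
  cubic := by
    intro v
    have : D.pg.graph.neighborSet v = ((nb v).toFinset : Set N60) := by
      ext w; simp [pg, gr]
    rw [this, Set.ncard_coe_finset, List.toFinset_card_of_nodup (D.three v).1, (D.three v).2]
  threeConnected := by
    have hc : D.pg.graph.Connected := by
      rw [SimpleGraph.connected_iff]
      have key : ∀ (k : ℕ) (v : N60), v.1 = k → D.pg.graph.Reachable v 0 := by
        intro k
        induction k using Nat.strong_induction_on with
        | _ k ih =>
          intro v hv
          by_cases h0 : v = 0
          · rw [h0]
          · obtain ⟨b, hb, hlt⟩ := D.tree v h0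
            exact SimpleGraph.Reachable.trans (SimpleGraph.Adj.reachable hb) (ih b.1 (by have : b.1 < v.1 := hlt; omega) b rfl)
      exact ⟨fun u v => (key _ u rfl).trans (key _ v rfl).symm, ⟨0⟩⟩
    refine three_conn _ hc (fun a => (lk a).length) (fun a i => (lk a).getD (i % (lk a).length) default)
      (fun a => fz (lk a)) (fun a => cyc_led _ (D.link a).2.1 (D.link a).1) (fun a => D.led_adj (D.link a).2.2.2.1) ?_ ?_ ?_
    · intro a i h
      have := getD_mem (lk a) (by have := (D.link a).2.1; omega) i
      rw [h] at this
      exact (D.link a).2.2.1 this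
    · intro a b h
      exact mem_getD _ ((D.link a).2.2.2.2 b h).1
    · intro a b h
      obtain ⟨x, h1, h2, h3⟩ := ((D.link a).2.2.2.2 b h).2
      obtain ⟨i, rfl⟩ := mem_getD _ h1
      obtain ⟨j, hj⟩ := mem_getD _ h2
      exact ⟨i, j, hj.symm, h3⟩
  faceSize := by
    intro f hf
    obtain ⟨l, hl, rfl⟩ := List.mem_map.1 (List.mem_toFinset.1 hf)
    rw [(D.inF hl).card]
    exact (D.face l hl).2.1
  pentTwelve := by
    have := D.card_filter (fun f => f.card = 5)
    change ((F.map fz).toFinset.filter _).card = 12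
    rw [this, ← D.cnt.2.2]
    congr 1
    refine List.filter_congr fun l hl => ?_
    rw [(D.inF hl).card]

end DOk
end FG

namespace FG
open Finset
set_option linter.unusedVariables false

instance decMatching (M : Finset (Sym2 N60)) : Decidable (IsMatching M) := by
  unfold IsMatching; infer_instance

abbrev SE (S : List (List N60)) : Finset (Finset (Sym2 N60)) := (S.map fz).toFinset

/-- checks that the faces `S` form a pentagonal fragment with boundary cycle `bd` -/
structure FOk (F : List (List N60)) (nb : N60 → List N60) (S : List (List N60)) (bd : List N60) : Prop where
  ne : S ≠ []
  sub : ∀ l ∈ S, l ∈ F ∧ l.length = 5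
  bnd : bd.Nodup ∧ 3 ≤ bd.length ∧ ∀ p ∈ List.zip bd (bd.rotate 1), p.2 ∈ nb p.1
  cyc : fz bd = ((SE S).sup id).filter fun e => ((SE S).filter fun f => e ∈ f).card = 1

/-- checks that `H` is a set of hexagons in `𝒮`, with matching `M`, leaving few vertices -/
structure HOk (F : List (List N60)) (S H : List (List N60)) (M : List (N60 × N60)) : Prop where
  hex : ∀ l ∈ H, l ∈ F ∧ l.length = 6 ∧ ∃ e ∈ fz l, e ∈ (SE S).sup id
  dis : ∀ l ∈ H, ∀ l' ∈ H, l ≠ l' → ∀ x ∈ l, x ∉ l'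
  sub : ∀ p ∈ M, s(p.1, p.2) ∈ (SE S).sup id ∧ p.1 ≠ p.2 ∧ ∀ l ∈ H, p.1 ∉ l ∧ p.2 ∉ l
  mat : ∀ p ∈ M, ∀ q ∈ M, p ≠ q → p.1 ≠ q.1 ∧ p.1 ≠ q.2 ∧ p.2 ≠ q.1 ∧ p.2 ≠ q.2
  cov : ∀ v ∈ S.flatten, deg ((SE S).sup id) v = 3 → v ∉ H.flatten → ∃ p ∈ M, v = p.1 ∨ v = p.2
  crd : (S.flatten.dedup.filter fun v => v ∉ H.flatten).length ≤ (SE S).card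

abbrev ms (M : List (N60 × N60)) : Finset (Sym2 N60) := (M.map fun p => s(p.1, p.2)).toFinset

theorem verts_fz (l : List N60) (h : l.Nodup) (h3 : 3 ≤ l.length) : edgeVerts (fz l) = l.toFinset := by
  have hC := cyc_led l h3 h
  ext v
  rw [edgeVerts, mem_filter, List.mem_toFinset]
  constructor
  · rintro ⟨-, e, he, hv⟩
    obtain ⟨w, rfl⟩ := hv
    obtain ⟨i, -, hi⟩ := hC.mem_vert he
    rw [hi]
    exact getD_mem l (by omega) i
  · intro hv
    obtain ⟨i, rfl⟩ := mem_getD l hv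
    exact ⟨mem_univ _, _, hC.edge i, Sym2.mem_mk_left _ _⟩

namespace DOk
variable {F : List (List N60)} {nb lk : N60 → List N60} {S H : List (List N60)} {bd : List N60}
  {M : List (N60 × N60)}

theorem verts (D : DOk F nb lk) {l} (hl : l ∈ F) : edgeVerts (fz l) = l.toFinset :=
  verts_fz l (D.face l hl).1 (D.inF hl).three

theorem mem_SE {f} : f ∈ SE S ↔ ∃ l ∈ S, fz l = f := by
  rw [List.mem_toFinset, List.mem_map]

theorem fverts (D : DOk F nb lk) (h : ∀ l ∈ H, l ∈ F) (v : N60) : v ∈ facesVerts (SE H) ↔ v ∈ H.flatten := by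
  rw [List.mem_flatten, facesVerts, edgeVerts, mem_filter]
  constructor
  · rintro ⟨-, e, he, hv⟩
    obtain ⟨f, hf, hef⟩ := Finset.mem_sup.1 he
    obtain ⟨l, hl, rfl⟩ := mem_SE.1 hf
    refine ⟨l, hl, ?_⟩
    rw [← List.mem_toFinset, ← D.verts (h l hl)]
    exact mem_filter.2 ⟨mem_univ _, e, hef, hv⟩
  · rintro ⟨l, hl, hv⟩
    rw [← List.mem_toFinset, ← D.verts (h l hl)] at hv
    obtain ⟨-, e, he, hve⟩ := mem_filter.1 hv
    exact ⟨mem_univ _, e, Finset.mem_sup.2 ⟨_, mem_SE.2 ⟨l, hl, rfl⟩, he⟩, hve⟩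

theorem sub_faces (h : ∀ l ∈ S, l ∈ F) (D : DOk F nb lk) : SE S ⊆ D.pg.faces := by
  intro f hf
  obtain ⟨l, hl, rfl⟩ := mem_SE.1 hf
  exact List.mem_toFinset.2 (List.mem_map.2 ⟨l, h l hl, rfl⟩)

def frag (D : DOk F nb lk) (h : FOk F nb S bd) : Fragment D.pg where
  inFaces := SE S
  nonempty := by
    obtain ⟨l, hl⟩ := List.exists_mem_of_ne_nil S h.ne
    exact ⟨_, mem_SE.2 ⟨l, hl, rfl⟩⟩
  subFaces := sub_faces (fun l hl => (h.sub l hl).1) D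
  boundary_cycle := by
    rw [← h.cyc]
    exact (cyc_led bd h.bnd.2.1 h.bnd.1).toWalk (D.led_adj h.bnd.2.2)

theorem pent (D : DOk F nb lk) (h : FOk F nb S bd) : IsPentagonalFragment (D.frag h) := by
  intro f hf
  obtain ⟨l, hl, rfl⟩ := mem_SE.1 hf
  rw [(D.inF (h.sub l hl).1).card]
  exact (h.sub l hl).2

theorem maxi (D : DOk F nb lk) (h : FOk F nb S bd)
    (hm : ∀ l ∈ F, l.length = 5 → l ∉ S → ∀ e ∈ led l, e ∉ (SE S).sup id) : IsMaximalIn D.pg (D.frag h).edges := by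
  intro f hf
  obtain ⟨h1, h2, e, he⟩ := mem_filter.1 hf
  obtain ⟨l, hl, rfl⟩ := List.mem_map.1 (List.mem_toFinset.1 h1)
  rw [(D.inF hl).card]
  refine (D.face l hl).2.1.resolve_left fun h5 => ?_
  by_cases hS : l ∈ S
  · exact h2 (Finset.le_sup (f := id) (mem_SE.2 ⟨l, hS, rfl⟩))
  · exact hm l hl h5 hS e (List.mem_toFinset.1 (mem_inter.1 he).1) (mem_inter.1 he).2

theorem mat (D : DOk F nb lk) (k : HOk F S H M) : ms M ⊆ (SE S).sup id ∧ IsMatching (ms M) ∧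
    (∀ e ∈ ms M, ∀ v : N60, v ∈ e → v ∉ facesVerts (SE H)) := by
  have key : ∀ e ∈ ms M, ∃ p ∈ M, s(p.1, p.2) = e := fun e he => List.mem_map.1 (List.mem_toFinset.1 he)
  refine ⟨?_, ⟨?_, ?_⟩, ?_⟩
  · intro e he
    obtain ⟨p, hp, rfl⟩ := key e he
    exact (k.sub p hp).1
  · intro e he
    obtain ⟨p, hp, rfl⟩ := key e he
    exact (k.sub p hp).2.1
  · intro e he e' he' hne v hv hv'
    obtain ⟨p, hp, rfl⟩ := key e he
    obtain ⟨q, hq, rfl⟩ := key e' he'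
    have := k.mat p hp q hq (fun h => hne (by rw [h]))
    rw [Sym2.mem_iff] at hv hv'
    rcases hv with rfl | rfl <;> rcases hv' with h | h <;> simp_all
  · intro e he v hv hvH
    obtain ⟨p, hp, rfl⟩ := key e he
    rw [D.fverts (fun l hl => (k.hex l hl).1), List.mem_flatten] at hvH
    obtain ⟨l, hl, hvl⟩ := hvH
    have := (k.sub p hp).2.2 l hl
    rcases Sym2.mem_iff.1 hv with rfl | rfl
    · exact this.1 hvl
    · exact this.2 hvl

theorem mem_ev (D : DOk F nb lk) (h : FOk F nb S bd) (v : N60) :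
    v ∈ edgeVerts ((SE S).sup id) ↔ v ∈ S.flatten := D.fverts (fun l hl => (h.sub l hl).1) v

theorem uset (D : DOk F nb lk) (h : FOk F nb S bd) (k : HOk F S H M) (v : N60) :
    v ∈ Uset ((SE S).sup id) (SE H) ↔ v ∈ S.flatten ∧ v ∉ H.flatten := by
  rw [Uset, mem_sdiff, D.fverts (fun l hl => (k.hex l hl).1), D.mem_ev h]

theorem ucard (D : DOk F nb lk) (h : FOk F nb S bd) (k : HOk F S H M) :
    (Uset ((SE S).sup id) (SE H)).card ≤ (SE S).card := by
  refine (card_le_card ?_).trans ((List.toFinset_card_le _).trans k.crd)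
  intro v hv
  rw [List.mem_toFinset, List.mem_filter, List.mem_dedup, decide_eq_true_iff]
  exact (D.uset h k v).1 hv

theorem clar (D : DOk F nb lk) (h : FOk F nb S bd) (k : HOk F S H M) : IsClarSet D.pg (D.frag h).edges (SE H) := by
  refine clar_of D.full (D.frag h).subFaces (D.pent h) ⟨?_, ?_, ms M, (D.mat k).1, (D.mat k).2.1, (D.mat k).2.2, ?_⟩ ?_
  · intro f hf
    obtain ⟨l, hl, rfl⟩ := mem_SE.1 hf
    obtain ⟨h1, h2, e, he, he'⟩ := k.hex l hl
    exact ⟨sub_faces (fun l hl => (k.hex l hl).1) D hf, by rw [(D.inF h1).card, h2], e, mem_inter.2 ⟨he, he'⟩⟩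
  · intro f hf g hg hne
    obtain ⟨l, hl, rfl⟩ := mem_SE.1 hf
    obtain ⟨l', hl', rfl⟩ := mem_SE.1 hg
    rw [D.verts (k.hex l hl).1, D.verts (k.hex l' hl').1, Finset.disjoint_left]
    intro x hx hx'
    exact k.dis l hl l' hl' (fun h => hne (by rw [h])) x (List.mem_toFinset.1 hx) (List.mem_toFinset.1 hx')
  · intro v hv h3 hvH
    rw [D.fverts (fun l hl => (k.hex l hl).1)] at hvH
    obtain ⟨p, hp, hvp⟩ := k.cov v ((D.mem_ev h v).1 hv) h3 hvH
    exact ⟨_, List.mem_toFinset.2 (List.mem_map.2 ⟨p, hp, rfl⟩), Sym2.mem_iff.2 hvp⟩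
  · exact D.ucard h k

theorem extr (D : DOk F nb lk) (h : FOk F nb S bd) (k : HOk F S H M) : IsExtremalSub D.pg (D.frag h).edges := by
  have hc := D.clar h k
  refine ⟨_, hc, ?_⟩
  have e : pentFaces D.pg (D.frag h).edges = (D.frag h).inFaces := by
    ext f
    rw [pentFaces, mem_filter]
    constructor
    · rintro ⟨h1, -, h2⟩
      exact hole D.full (by simp) _ (D.pent h) h1 h2
    · intro hf
      exact ⟨(D.frag h).subFaces hf, D.pent h f hf, Finset.le_sup (f := id) hf⟩
  rw [e]
  refine le_antisymm ?_ (adm_card D.full (D.frag h).subFaces (D.pent h) hc.1)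
  exact D.ucard h k

theorem norm (D : DOk F nb lk) (h : FOk F nb S bd) (k : HOk F S H M)
    (hc : ∀ v ∈ S.flatten, v ∉ H.flatten → ∃ p ∈ M, v = p.1 ∨ v = p.2) :
    IsExtremalSub D.pg (D.frag h).edges ∧ ∃ H, IsNormalClarSet D.pg (D.frag h).edges H := by
  refine ⟨D.extr h k, SE H, D.clar h k, ms M, (D.mat k).1, (D.mat k).2.1, (D.mat k).2.2, ?_⟩
  intro v hv
  have hv' := (D.uset h k v).1 hv
  obtain ⟨p, hp, hvp⟩ := hc v hv'.1 hv'.2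
  exact ⟨_, List.mem_toFinset.2 (List.mem_map.2 ⟨p, hp, rfl⟩), Sym2.mem_iff.2 hvp⟩

theorem pedge (D : DOk F nb lk) (h : FOk F nb S bd) (k : HOk F S H M) {a b : N60} (he : s(a, b) ∈ (SE S).sup id)
    (ha : a ∈ H.flatten ∧ b ∈ H.flatten ∧ ∀ l ∈ H, s(a, b) ∉ led l) : IsPastingEdge D.pg (D.frag h).edges s(a, b) := by
  refine ⟨he, SE H, D.clar h k, ?_, ?_⟩
  · intro v hv
    rw [D.fverts (fun l hl => (k.hex l hl).1)]
    rcases Sym2.mem_iff.1 hv with rfl | rfl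
    · exact ha.1
    · exact ha.2.1
  · intro hs
    obtain ⟨f, hf, hef⟩ := Finset.mem_sup.1 hs
    obtain ⟨l, hl, rfl⟩ := mem_SE.1 hf
    exact ha.2.2 l hl (List.mem_toFinset.1 hef)

theorem pasting (D : DOk F nb lk) {T S' H' : List (List N60)} {bd' bdT : List N60} {M' : List (N60 × N60)}
    (h : FOk F nb S bd) (k : HOk F S H M) (h' : FOk F nb S' bd') (k' : HOk F S' H' M') (hT : FOk F nb T bdT)
    (hTe : ∀ l, l ∈ T ↔ l ∈ S ∨ l ∈ S')
    {a b : N60} (hab : (SE S).sup id ∩ (SE S').sup id = {s(a, b)})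
    (ha : a ∈ H.flatten ∧ b ∈ H.flatten ∧ ∀ l ∈ H, s(a, b) ∉ led l)
    (ha' : a ∈ H'.flatten ∧ b ∈ H'.flatten ∧ ∀ l ∈ H', s(a, b) ∉ led l) :
    IsPasting (D.frag hT) (D.frag h) (D.frag h') := by
  have hm := mem_inter.1 (hab ▸ mem_singleton_self _ : s(a, b) ∈ (SE S).sup id ∩ (SE S').sup id)
  refine ⟨?_, s(a, b), hab, D.pedge h k hm.1 ha, D.pedge h' k' hm.2 ha'⟩
  change SE T = SE S ∪ SE S'
  ext f
  simp only [mem_union, mem_SE, hTe]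
  constructor
  · rintro ⟨l, h | h, rfl⟩
    · exact Or.inl ⟨l, h, rfl⟩
    · exact Or.inr ⟨l, h, rfl⟩
  · rintro (⟨l, h, rfl⟩ | ⟨l, h, rfl⟩)
    · exact ⟨l, Or.inl h, rfl⟩
    · exact ⟨l, Or.inr h, rfl⟩

theorem b2 (D : DOk F nb lk) (h : FOk F nb S bd) (k : HOk F S H M) (hc : (SE S).card = 4)
    (hn : ∀ v ∈ S.flatten, v ∉ H.flatten → ∃ p ∈ M, v = p.1 ∨ v = p.2) : IsB2Frag (D.frag h) :=
  ⟨D.pent h, hc, (D.norm h k hn).1, (D.norm h k hn).2⟩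

theorem b3 (D : DOk F nb lk) (h : FOk F nb S bd) (k : HOk F S H M) (hc : (SE S).card = 6)
    (hn : ∀ v ∈ S.flatten, v ∉ H.flatten → ∃ p ∈ M, v = p.1 ∨ v = p.2) : IsB3Frag (D.frag h) :=
  ⟨D.pent h, hc, (D.norm h k hn).1, (D.norm h k hn).2⟩

theorem p1 (D : DOk F nb lk) (h : FOk F nb S bd) (hc : (SE S).card = 1) : IsPentagonFrag (D.frag h) :=
  ⟨D.pent h, hc⟩

end DOk
end FG

namespace FG
open Finset
set_option linter.unusedVariables false
set_option maxRecDepth 100000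

/-- facial cycles of the fullerene `A` on 60 vertices -/
def FA : List (List N60) := [
  [0, 1, 4, 6, 2],
  [0, 3, 8, 7, 2],
  [0, 3, 9, 11, 5, 1],
  [1, 5, 12, 10, 4],
  [4, 10, 17, 20, 13, 6],
  [2, 7, 14, 21, 13, 6],
  [7, 14, 22, 15, 8],
  [3, 9, 16, 23, 15, 8],
  [9, 16, 24, 18, 11],
  [5, 12, 19, 26, 18, 11],
  [10, 17, 25, 27, 19, 12],
  [17, 25, 33, 36, 28, 20],
  [13, 21, 29, 37, 28, 20],
  [14, 22, 30, 38, 29, 21],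
  [15, 23, 31, 39, 30, 22],
  [16, 24, 32, 40, 31, 23],
  [18, 26, 34, 41, 32, 24],
  [19, 27, 35, 43, 34, 26],
  [25, 33, 42, 35, 27],
  [33, 42, 50, 44, 36],
  [28, 37, 45, 52, 44, 36],
  [29, 38, 46, 53, 45, 37],
  [30, 39, 47, 54, 46, 38],
  [31, 40, 48, 47, 39],
  [32, 41, 49, 48, 40],
  [34, 43, 51, 55, 49, 41],
  [35, 42, 50, 56, 51, 43],
  [44, 52, 57, 56, 50],
  [45, 53, 58, 57, 52],
  [46, 54, 59, 58, 53],
  [47, 48, 49, 55, 59, 54],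
  [51, 56, 57, 58, 59, 55]]

def nbA (a : N60) : List N60 := [
  [1, 2, 3], [0, 4, 5], [0, 6, 7], [0, 8, 9], [1, 6, 10], [1, 11, 12],
  [2, 4, 13], [2, 8, 14], [3, 7, 15], [3, 11, 16], [4, 12, 17], [5, 9, 18],
  [5, 10, 19], [6, 20, 21], [7, 21, 22], [8, 22, 23], [9, 23, 24], [10, 20, 25],
  [11, 24, 26], [12, 26, 27], [13, 17, 28], [13, 14, 29], [14, 15, 30], [15, 16, 31],
  [16, 18, 32], [17, 27, 33], [18, 19, 34], [19, 25, 35], [20, 36, 37], [21, 37, 38],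
  [22, 38, 39], [23, 39, 40], [24, 40, 41], [25, 36, 42], [26, 41, 43], [27, 42, 43],
  [28, 33, 44], [28, 29, 45], [29, 30, 46], [30, 31, 47], [31, 32, 48], [32, 34, 49],
  [33, 35, 50], [34, 35, 51], [36, 50, 52], [37, 52, 53], [38, 53, 54], [39, 48, 54],
  [40, 47, 49], [41, 48, 55], [42, 44, 56], [43, 55, 56], [44, 45, 57], [45, 46, 58],
  [46, 47, 59], [49, 51, 59], [50, 51, 57], [52, 56, 58], [53, 57, 59], [54, 55, 58]].getD a.val []

def lkA (a : N60) : List N60 := [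
  [1, 4, 6, 2, 7, 8, 3, 9, 11, 5], [0, 2, 6, 4, 10, 12, 5, 11, 9, 3],
  [0, 1, 4, 6, 13, 21, 14, 7, 8, 3], [0, 1, 5, 11, 9, 16, 23, 15, 8, 7, 2],
  [0, 1, 5, 12, 10, 17, 20, 13, 6, 2], [0, 1, 4, 10, 12, 19, 26, 18, 11, 9, 3],
  [0, 1, 4, 10, 17, 20, 13, 21, 14, 7, 2], [0, 2, 6, 13, 21, 14, 22, 15, 8, 3],
  [0, 2, 7, 14, 22, 15, 23, 16, 9, 3], [0, 1, 5, 11, 18, 24, 16, 23, 15, 8, 3],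
  [1, 4, 6, 13, 20, 17, 25, 27, 19, 12, 5], [0, 1, 5, 12, 19, 26, 18, 24, 16, 9, 3],
  [1, 4, 10, 17, 25, 27, 19, 26, 18, 11, 5], [2, 6, 4, 10, 17, 20, 28, 37, 29, 21, 14, 7],
  [2, 6, 13, 21, 29, 38, 30, 22, 15, 8, 7], [3, 8, 7, 14, 22, 30, 39, 31, 23, 16, 9],
  [3, 8, 15, 23, 31, 40, 32, 24, 18, 11, 9], [4, 6, 13, 20, 28, 36, 33, 25, 27, 19, 12, 10],
  [5, 11, 9, 16, 24, 32, 41, 34, 26, 19, 12], [5, 11, 18, 26, 34, 43, 35, 27, 25, 17, 10, 12],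
  [4, 6, 13, 21, 29, 37, 28, 36, 33, 25, 17, 10], [2, 6, 13, 20, 28, 37, 29, 38, 30, 22, 14, 7],
  [7, 8, 15, 23, 31, 39, 30, 38, 29, 21, 14], [3, 8, 15, 22, 30, 39, 31, 40, 32, 24, 16, 9],
  [9, 11, 18, 26, 34, 41, 32, 40, 31, 23, 16], [10, 12, 19, 27, 35, 42, 33, 36, 28, 20, 17],
  [5, 11, 18, 24, 32, 41, 34, 43, 35, 27, 19, 12], [10, 12, 19, 26, 34, 43, 35, 42, 33, 25, 17],
  [13, 20, 17, 25, 33, 36, 44, 52, 45, 37, 29, 21], [13, 20, 28, 37, 45, 53, 46, 38, 30, 22, 14, 21],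
  [14, 21, 29, 38, 46, 54, 47, 39, 31, 23, 15, 22], [15, 22, 30, 39, 47, 48, 40, 32, 24, 16, 23],
  [16, 23, 31, 40, 48, 49, 41, 34, 26, 18, 24], [17, 20, 28, 36, 44, 50, 42, 35, 27, 25],
  [18, 24, 32, 41, 49, 55, 51, 43, 35, 27, 19, 26], [19, 26, 34, 43, 51, 56, 50, 42, 33, 25, 27],
  [17, 20, 28, 37, 45, 52, 44, 50, 42, 33, 25], [13, 20, 28, 36, 44, 52, 45, 53, 46, 38, 29, 21],
  [14, 21, 29, 37, 45, 53, 46, 54, 47, 39, 30, 22], [15, 22, 30, 38, 46, 54, 47, 48, 40, 31, 23],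
  [16, 23, 31, 39, 47, 48, 49, 41, 32, 24], [18, 24, 32, 40, 48, 49, 55, 51, 43, 34, 26],
  [25, 27, 35, 43, 51, 56, 50, 44, 36, 33], [19, 26, 34, 41, 49, 55, 51, 56, 50, 42, 35, 27],
  [28, 36, 33, 42, 50, 56, 57, 52, 45, 37], [28, 36, 44, 52, 57, 58, 53, 46, 38, 29, 37],
  [29, 37, 45, 53, 58, 59, 54, 47, 39, 30, 38], [30, 38, 46, 54, 59, 55, 49, 48, 40, 31, 39],
  [31, 39, 47, 54, 59, 55, 49, 41, 32, 40], [32, 40, 48, 47, 54, 59, 55, 51, 43, 34, 41],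
  [33, 36, 44, 52, 57, 56, 51, 43, 35, 42], [34, 41, 49, 55, 59, 58, 57, 56, 50, 42, 35, 43],
  [28, 36, 44, 50, 56, 57, 58, 53, 45, 37], [29, 37, 45, 52, 57, 58, 59, 54, 46, 38],
  [30, 38, 46, 53, 58, 59, 55, 49, 48, 47, 39], [34, 41, 49, 48, 47, 54, 59, 58, 57, 56, 51, 43],
  [35, 42, 50, 44, 52, 57, 58, 59, 55, 51, 43], [44, 50, 56, 51, 55, 59, 58, 53, 45, 52],
  [45, 52, 57, 56, 51, 55, 59, 54, 46, 53], [46, 53, 58, 57, 56, 51, 55, 49, 48, 47, 54]].getD a.val []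

theorem DA : DOk FA nbA lkA := by
  constructor <;> first | (refine forall_V ?_; decide +kernel) | decide +kernel

/-- facial cycles of the fullerene `B` on 60 vertices -/
def FB : List (List N60) := [
  [0, 1, 4, 6, 2],
  [0, 3, 8, 7, 2],
  [0, 3, 9, 11, 5, 1],
  [1, 5, 12, 10, 4],
  [4, 10, 17, 20, 13, 6],
  [2, 7, 14, 21, 13, 6],
  [7, 14, 22, 15, 8],
  [3, 9, 16, 23, 15, 8],
  [9, 16, 24, 26, 18, 11],
  [5, 12, 19, 27, 18, 11],
  [10, 17, 25, 19, 12],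
  [17, 25, 33, 36, 28, 20],
  [13, 21, 29, 37, 28, 20],
  [14, 22, 30, 38, 29, 21],
  [15, 23, 31, 30, 22],
  [16, 24, 32, 39, 31, 23],
  [24, 32, 40, 42, 34, 26],
  [18, 27, 35, 43, 34, 26],
  [19, 25, 33, 41, 35, 27],
  [33, 41, 49, 44, 36],
  [28, 37, 45, 52, 44, 36],
  [29, 38, 46, 53, 45, 37],
  [30, 31, 39, 47, 46, 38],
  [32, 40, 48, 47, 39],
  [40, 48, 54, 50, 42],
  [34, 43, 51, 56, 50, 42],
  [35, 41, 49, 55, 51, 43],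
  [44, 52, 57, 55, 49],
  [45, 53, 58, 59, 57, 52],
  [46, 47, 48, 54, 58, 53],
  [50, 56, 59, 58, 54],
  [51, 55, 57, 59, 56]]

def nbB (a : N60) : List N60 := [
  [1, 2, 3], [0, 4, 5], [0, 6, 7], [0, 8, 9], [1, 6, 10], [1, 11, 12],
  [2, 4, 13], [2, 8, 14], [3, 7, 15], [3, 11, 16], [4, 12, 17], [5, 9, 18],
  [5, 10, 19], [6, 20, 21], [7, 21, 22], [8, 22, 23], [9, 23, 24], [10, 20, 25],
  [11, 26, 27], [12, 25, 27], [13, 17, 28], [13, 14, 29], [14, 15, 30], [15, 16, 31],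
  [16, 26, 32], [17, 19, 33], [18, 24, 34], [18, 19, 35], [20, 36, 37], [21, 37, 38],
  [22, 31, 38], [23, 30, 39], [24, 39, 40], [25, 36, 41], [26, 42, 43], [27, 41, 43],
  [28, 33, 44], [28, 29, 45], [29, 30, 46], [31, 32, 47], [32, 42, 48], [33, 35, 49],
  [34, 40, 50], [34, 35, 51], [36, 49, 52], [37, 52, 53], [38, 47, 53], [39, 46, 48],
  [40, 47, 54], [41, 44, 55], [42, 54, 56], [43, 55, 56], [44, 45, 57], [45, 46, 58],
  [48, 50, 58], [49, 51, 57], [50, 51, 59], [52, 55, 59], [53, 54, 59], [56, 57, 58]].getD a.val []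

def lkB (a : N60) : List N60 := [
  [1, 4, 6, 2, 7, 8, 3, 9, 11, 5], [0, 2, 6, 4, 10, 12, 5, 11, 9, 3],
  [0, 1, 4, 6, 13, 21, 14, 7, 8, 3], [0, 1, 5, 11, 9, 16, 23, 15, 8, 7, 2],
  [0, 1, 5, 12, 10, 17, 20, 13, 6, 2], [0, 1, 4, 10, 12, 19, 27, 18, 11, 9, 3],
  [0, 1, 4, 10, 17, 20, 13, 21, 14, 7, 2], [0, 2, 6, 13, 21, 14, 22, 15, 8, 3],
  [0, 2, 7, 14, 22, 15, 23, 16, 9, 3], [0, 1, 5, 11, 18, 26, 24, 16, 23, 15, 8, 3],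
  [1, 4, 6, 13, 20, 17, 25, 19, 12, 5], [0, 1, 5, 12, 19, 27, 18, 26, 24, 16, 9, 3],
  [1, 4, 10, 17, 25, 19, 27, 18, 11, 5], [2, 6, 4, 10, 17, 20, 28, 37, 29, 21, 14, 7],
  [2, 6, 13, 21, 29, 38, 30, 22, 15, 8, 7], [3, 8, 7, 14, 22, 30, 31, 23, 16, 9],
  [3, 8, 15, 23, 31, 39, 32, 24, 26, 18, 11, 9], [4, 6, 13, 20, 28, 36, 33, 25, 19, 12, 10],
  [5, 11, 9, 16, 24, 26, 34, 43, 35, 27, 19, 12], [5, 11, 18, 27, 35, 41, 33, 25, 17, 10, 12],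
  [4, 6, 13, 21, 29, 37, 28, 36, 33, 25, 17, 10], [2, 6, 13, 20, 28, 37, 29, 38, 30, 22, 14, 7],
  [7, 8, 15, 23, 31, 30, 38, 29, 21, 14], [3, 8, 15, 22, 30, 31, 39, 32, 24, 16, 9],
  [9, 11, 18, 26, 34, 42, 40, 32, 39, 31, 23, 16], [10, 12, 19, 27, 35, 41, 33, 36, 28, 20, 17],
  [9, 11, 18, 27, 35, 43, 34, 42, 40, 32, 24, 16], [5, 11, 18, 26, 34, 43, 35, 41, 33, 25, 19, 12],
  [13, 20, 17, 25, 33, 36, 44, 52, 45, 37, 29, 21], [13, 20, 28, 37, 45, 53, 46, 38, 30, 22, 14, 21],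
  [14, 21, 29, 38, 46, 47, 39, 31, 23, 15, 22], [15, 22, 30, 38, 46, 47, 39, 32, 24, 16, 23],
  [16, 23, 31, 39, 47, 48, 40, 42, 34, 26, 24], [17, 20, 28, 36, 44, 49, 41, 35, 27, 19, 25],
  [18, 26, 24, 32, 40, 42, 50, 56, 51, 43, 35, 27], [18, 26, 34, 43, 51, 55, 49, 41, 33, 25, 19, 27],
  [17, 20, 28, 37, 45, 52, 44, 49, 41, 33, 25], [13, 20, 28, 36, 44, 52, 45, 53, 46, 38, 29, 21],
  [14, 21, 29, 37, 45, 53, 46, 47, 39, 31, 30, 22], [16, 23, 31, 30, 38, 46, 47, 48, 40, 32, 24],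
  [24, 26, 34, 42, 50, 54, 48, 47, 39, 32], [19, 25, 33, 36, 44, 49, 55, 51, 43, 35, 27],
  [24, 26, 34, 43, 51, 56, 50, 54, 48, 40, 32], [18, 26, 34, 42, 50, 56, 51, 55, 49, 41, 35, 27],
  [28, 36, 33, 41, 49, 55, 57, 52, 45, 37], [28, 36, 44, 52, 57, 59, 58, 53, 46, 38, 29, 37],
  [29, 37, 45, 53, 58, 54, 48, 47, 39, 31, 30, 38], [30, 31, 39, 32, 40, 48, 54, 58, 53, 46, 38],
  [32, 39, 47, 46, 53, 58, 54, 50, 42, 40], [33, 36, 44, 52, 57, 55, 51, 43, 35, 41],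
  [34, 42, 40, 48, 54, 58, 59, 56, 51, 43], [34, 42, 50, 56, 59, 57, 55, 49, 41, 35, 43],
  [28, 36, 44, 49, 55, 57, 59, 58, 53, 45, 37], [29, 37, 45, 52, 57, 59, 58, 54, 48, 47, 46, 38],
  [40, 42, 50, 56, 59, 58, 53, 46, 47, 48], [35, 41, 49, 44, 52, 57, 59, 56, 51, 43],
  [34, 42, 50, 54, 58, 59, 57, 55, 51, 43], [44, 49, 55, 51, 56, 59, 58, 53, 45, 52],
  [45, 52, 57, 59, 56, 50, 54, 48, 47, 46, 53], [45, 52, 57, 55, 51, 56, 50, 54, 58, 53]].getD a.val []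

theorem DB : DOk FB nbB lkB := by
  constructor <;> first | (refine forall_V ?_; decide +kernel) | decide +kernel

/-- facial cycles of the fullerene `C` on 60 vertices -/
def FC : List (List N60) := [
  [0, 1, 4, 6, 2],
  [0, 3, 8, 7, 2],
  [0, 3, 9, 5, 1],
  [1, 5, 11, 10, 4],
  [4, 10, 16, 18, 12, 6],
  [2, 7, 13, 19, 12, 6],
  [7, 13, 20, 14, 8],
  [3, 9, 15, 21, 14, 8],
  [5, 11, 17, 22, 15, 9],
  [10, 16, 23, 17, 11],
  [16, 23, 29, 30, 24, 18],
  [12, 19, 25, 31, 24, 18],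
  [13, 20, 26, 32, 25, 19],
  [14, 21, 27, 33, 26, 20],
  [15, 22, 28, 34, 27, 21],
  [17, 23, 29, 35, 28, 22],
  [29, 35, 41, 42, 36, 30],
  [24, 31, 37, 43, 36, 30],
  [25, 32, 38, 44, 37, 31],
  [26, 33, 39, 45, 38, 32],
  [27, 34, 40, 46, 39, 33],
  [28, 35, 41, 47, 40, 34],
  [41, 47, 53, 48, 42],
  [36, 43, 49, 54, 48, 42],
  [37, 44, 50, 55, 49, 43],
  [38, 45, 51, 50, 44],
  [39, 46, 52, 56, 51, 45],
  [40, 47, 53, 57, 52, 46],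
  [48, 54, 58, 57, 53],
  [49, 55, 59, 58, 54],
  [50, 51, 56, 59, 55],
  [52, 57, 58, 59, 56]]

def nbC (a : N60) : List N60 := [
  [1, 2, 3], [0, 4, 5], [0, 6, 7], [0, 8, 9], [1, 6, 10], [1, 9, 11],
  [2, 4, 12], [2, 8, 13], [3, 7, 14], [3, 5, 15], [4, 11, 16], [5, 10, 17],
  [6, 18, 19], [7, 19, 20], [8, 20, 21], [9, 21, 22], [10, 18, 23], [11, 22, 23],
  [12, 16, 24], [12, 13, 25], [13, 14, 26], [14, 15, 27], [15, 17, 28], [16, 17, 29],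
  [18, 30, 31], [19, 31, 32], [20, 32, 33], [21, 33, 34], [22, 34, 35], [23, 30, 35],
  [24, 29, 36], [24, 25, 37], [25, 26, 38], [26, 27, 39], [27, 28, 40], [28, 29, 41],
  [30, 42, 43], [31, 43, 44], [32, 44, 45], [33, 45, 46], [34, 46, 47], [35, 42, 47],
  [36, 41, 48], [36, 37, 49], [37, 38, 50], [38, 39, 51], [39, 40, 52], [40, 41, 53],
  [42, 53, 54], [43, 54, 55], [44, 51, 55], [45, 50, 56], [46, 56, 57], [47, 48, 57],
  [48, 49, 58], [49, 50, 59], [51, 52, 59], [52, 53, 58], [54, 57, 59], [55, 56, 58]].getD a.val []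

def lkC (a : N60) : List N60 := [
  [1, 4, 6, 2, 7, 8, 3, 9, 5], [0, 2, 6, 4, 10, 11, 5, 9, 3],
  [0, 1, 4, 6, 12, 19, 13, 7, 8, 3], [0, 1, 5, 9, 15, 21, 14, 8, 7, 2],
  [0, 1, 5, 11, 10, 16, 18, 12, 6, 2], [0, 1, 4, 10, 11, 17, 22, 15, 9, 3],
  [0, 1, 4, 10, 16, 18, 12, 19, 13, 7, 2], [0, 2, 6, 12, 19, 13, 20, 14, 8, 3],
  [0, 2, 7, 13, 20, 14, 21, 15, 9, 3], [0, 1, 5, 11, 17, 22, 15, 21, 14, 8, 3],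
  [1, 4, 6, 12, 18, 16, 23, 17, 11, 5], [1, 4, 10, 16, 23, 17, 22, 15, 9, 5],
  [2, 6, 4, 10, 16, 18, 24, 31, 25, 19, 13, 7], [2, 6, 12, 19, 25, 32, 26, 20, 14, 8, 7],
  [3, 8, 7, 13, 20, 26, 33, 27, 21, 15, 9], [3, 8, 14, 21, 27, 34, 28, 22, 17, 11, 5, 9],
  [4, 6, 12, 18, 24, 30, 29, 23, 17, 11, 10], [5, 9, 15, 22, 28, 35, 29, 23, 16, 10, 11],
  [4, 6, 12, 19, 25, 31, 24, 30, 29, 23, 16, 10], [2, 6, 12, 18, 24, 31, 25, 32, 26, 20, 13, 7],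
  [7, 8, 14, 21, 27, 33, 26, 32, 25, 19, 13], [3, 8, 14, 20, 26, 33, 27, 34, 28, 22, 15, 9],
  [5, 9, 15, 21, 27, 34, 28, 35, 29, 23, 17, 11], [10, 11, 17, 22, 28, 35, 29, 30, 24, 18, 16],
  [12, 18, 16, 23, 29, 30, 36, 43, 37, 31, 25, 19], [12, 18, 24, 31, 37, 44, 38, 32, 26, 20, 13, 19],
  [13, 19, 25, 32, 38, 45, 39, 33, 27, 21, 14, 20], [14, 20, 26, 33, 39, 46, 40, 34, 28, 22, 15, 21],
  [15, 21, 27, 34, 40, 47, 41, 35, 29, 23, 17, 22], [16, 18, 24, 30, 36, 42, 41, 35, 28, 22, 17, 23],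
  [16, 18, 24, 31, 37, 43, 36, 42, 41, 35, 29, 23], [12, 18, 24, 30, 36, 43, 37, 44, 38, 32, 25, 19],
  [13, 19, 25, 31, 37, 44, 38, 45, 39, 33, 26, 20], [14, 20, 26, 32, 38, 45, 39, 46, 40, 34, 27, 21],
  [15, 21, 27, 33, 39, 46, 40, 47, 41, 35, 28, 22], [17, 22, 28, 34, 40, 47, 41, 42, 36, 30, 29, 23],
  [24, 30, 29, 35, 41, 42, 48, 54, 49, 43, 37, 31], [24, 30, 36, 43, 49, 55, 50, 44, 38, 32, 25, 31],
  [25, 31, 37, 44, 50, 51, 45, 39, 33, 26, 32], [26, 32, 38, 45, 51, 56, 52, 46, 40, 34, 27, 33],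
  [27, 33, 39, 46, 52, 57, 53, 47, 41, 35, 28, 34], [28, 34, 40, 47, 53, 48, 42, 36, 30, 29, 35],
  [29, 30, 36, 43, 49, 54, 48, 53, 47, 41, 35], [24, 30, 36, 42, 48, 54, 49, 55, 50, 44, 37, 31],
  [25, 31, 37, 43, 49, 55, 50, 51, 45, 38, 32], [26, 32, 38, 44, 50, 51, 56, 52, 46, 39, 33],
  [27, 33, 39, 45, 51, 56, 52, 57, 53, 47, 40, 34], [28, 34, 40, 46, 52, 57, 53, 48, 42, 41, 35],
  [36, 42, 41, 47, 53, 57, 58, 54, 49, 43], [36, 42, 48, 54, 58, 59, 55, 50, 44, 37, 43],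
  [37, 43, 49, 55, 59, 56, 51, 45, 38, 44], [38, 44, 50, 55, 59, 56, 52, 46, 39, 45],
  [39, 45, 51, 56, 59, 58, 57, 53, 47, 40, 46], [40, 46, 52, 57, 58, 54, 48, 42, 41, 47],
  [36, 42, 48, 53, 57, 58, 59, 55, 49, 43], [37, 43, 49, 54, 58, 59, 56, 51, 50, 44],
  [39, 45, 51, 50, 55, 59, 58, 57, 52, 46], [40, 46, 52, 56, 59, 58, 54, 48, 53, 47],
  [48, 53, 57, 52, 56, 59, 55, 49, 54], [49, 54, 58, 57, 52, 56, 51, 50, 55]].getD a.val []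

theorem DC : DOk FC nbC lkC := by
  constructor <;> first | (refine forall_V ?_; decide +kernel) | decide +kernel

def Sp : List (List N60) := [[9, 16, 24, 18, 11]]

theorem fp : FOk FA nbA Sp [9, 11, 18, 24, 16] := by
  constructor <;> decide +kernel

theorem ex_p : ∃ (n : ℕ) (P : PlaneGraph (Fin n)), IsFullerene P ∧ 60 ≤ n ∧
    ∃ B : Fragment P, IsMaximalIn P B.edges ∧ Pasted P B ∧ IsPentagonFrag B := by
  have h := DA.p1 fp (by decide +kernel)
  exact ⟨60, DA.pg, DA.full, le_rfl, DA.frag fp, DA.maxi fp (by decide +kernel), .base _ (Or.inl h), h⟩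

def Sb2 : List (List N60) := [[0, 1, 4, 6, 2], [0, 3, 8, 7, 2], [1, 5, 12, 10, 4], [7, 14, 22, 15, 8]]

theorem fb2 : FOk FA nbA Sb2 [0, 1, 5, 12, 10, 4, 6, 2, 7, 14, 22, 15, 8, 3] := by
  constructor <;> decide +kernel

def Hb2 : List (List N60) := [[4, 10, 17, 20, 13, 6], [3, 9, 16, 23, 15, 8], [5, 12, 19, 26, 18, 11], [14, 22, 30, 38, 29, 21]]

theorem hb2 : HOk FA Sb2 Hb2 [(0, 1), (2, 7)] := by
  constructor <;> decide +kernel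

theorem ex_b2 : ∃ (n : ℕ) (P : PlaneGraph (Fin n)), IsFullerene P ∧ 60 ≤ n ∧
    ∃ B : Fragment P, IsMaximalIn P B.edges ∧ Pasted P B ∧ IsB2Frag B := by
  have h := DA.b2 fb2 hb2 (by decide +kernel) (by decide +kernel)
  exact ⟨60, DA.pg, DA.full, le_rfl, DA.frag fb2, DA.maxi fb2 (by decide +kernel), .base _ (Or.inr (Or.inl h)), h⟩

def Sb3 : List (List N60) := [[0, 1, 4, 6, 2], [0, 3, 8, 7, 2], [0, 3, 9, 5, 1], [1, 5, 11, 10, 4], [7, 13, 20, 14, 8], [10, 16, 23, 17, 11]]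

theorem fb3 : FOk FC nbC Sb3 [2, 6, 4, 10, 16, 23, 17, 11, 5, 9, 3, 8, 14, 20, 13, 7] := by
  constructor <;> decide +kernel

def Hb3 : List (List N60) := [[4, 10, 16, 18, 12, 6], [3, 9, 15, 21, 14, 8], [13, 20, 26, 32, 25, 19], [17, 23, 29, 35, 28, 22]]

theorem hb3 : HOk FC Sb3 Hb3 [(0, 1), (2, 7), (5, 11)] := by
  constructor <;> decide +kernel

theorem ex_b3 : ∃ (n : ℕ) (P : PlaneGraph (Fin n)), IsFullerene P ∧ 60 ≤ n ∧
    ∃ B : Fragment P, IsMaximalIn P B.edges ∧ Pasted P B ∧ IsB3Frag B := by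
  have h := DC.b3 fb3 hb3 (by decide +kernel) (by decide +kernel)
  exact ⟨60, DC.pg, DC.full, le_rfl, DC.frag fb3, DC.maxi fb3 (by decide +kernel), .base _ (Or.inr (Or.inr h)), h⟩

def Sppa : List (List N60) := [[31, 40, 48, 47, 39]]

theorem fppa : FOk FA nbA Sppa [31, 39, 47, 48, 40] := by
  constructor <;> decide +kernel

def Sppc : List (List N60) := [[32, 41, 49, 48, 40]]

theorem fppc : FOk FA nbA Sppc [32, 40, 48, 49, 41] := by
  constructor <;> decide +kernel

def Spp : List (List N60) := Sppa ++ Sppc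

theorem fpp : FOk FA nbA Spp [31, 39, 47, 48, 49, 41, 32, 40] := by
  constructor <;> decide +kernel

def Hppa : List (List N60) := [[16, 24, 32, 40, 31, 23], [47, 48, 49, 55, 59, 54]]

theorem hppa : HOk FA Sppa Hppa [] := by
  constructor <;> decide +kernel

def Hppc : List (List N60) := [[16, 24, 32, 40, 31, 23], [47, 48, 49, 55, 59, 54]]

theorem hppc : HOk FA Sppc Hppc [] := by
  constructor <;> decide +kernel

theorem ex_pp : ∃ (n : ℕ) (P : PlaneGraph (Fin n)), IsFullerene P ∧ 60 ≤ n ∧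
    ∃ B : Fragment P, IsMaximalIn P B.edges ∧ Pasted P B ∧ IsPPFrag B := by
  have h1 := DA.p1 fppa (by decide +kernel)
  have h2 := DA.p1 fppc (by decide +kernel)
  have h3 := DA.pasting fppa hppa fppc hppc fpp (fun l => List.mem_append)
    (a := 40) (b := 48) (by decide +kernel) (by decide +kernel) (by decide +kernel)
  exact ⟨60, DA.pg, DA.full, le_rfl, DA.frag fpp, DA.maxi fpp (by decide +kernel),
    .paste _ _ _ (.base _ (Or.inl h1)) (Or.inl h2) h3, _, _, h1, h2, h3⟩

def Spba : List (List N60) := [[25, 33, 42, 35, 27]]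

theorem fpba : FOk FA nbA Spba [25, 27, 35, 42, 33] := by
  constructor <;> decide +kernel

def Spbc : List (List N60) := [[33, 42, 50, 44, 36], [44, 52, 57, 56, 50], [45, 53, 58, 57, 52], [46, 54, 59, 58, 53]]

theorem fpbc : FOk FA nbA Spbc [33, 36, 44, 52, 45, 53, 46, 54, 59, 58, 57, 56, 50, 42] := by
  constructor <;> decide +kernel

def Spb : List (List N60) := Spba ++ Spbc

theorem fpb : FOk FA nbA Spb [25, 27, 35, 42, 50, 56, 57, 58, 59, 54, 46, 53, 45, 52, 44, 36, 33] := by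
  constructor <;> decide +kernel

def Hpba : List (List N60) := [[17, 25, 33, 36, 28, 20], [35, 42, 50, 56, 51, 43]]

theorem hpba : HOk FA Spba Hpba [] := by
  constructor <;> decide +kernel

def Hpbc : List (List N60) := [[17, 25, 33, 36, 28, 20], [29, 38, 46, 53, 45, 37], [35, 42, 50, 56, 51, 43], [47, 48, 49, 55, 59, 54]]

theorem hpbc : HOk FA Spbc Hpbc [(44, 52), (57, 58)] := by
  constructor <;> decide +kernel

def Hpbn : List (List N60) := [[17, 25, 33, 36, 28, 20], [29, 38, 46, 53, 45, 37], [35, 42, 50, 56, 51, 43], [47, 48, 49, 55, 59, 54]]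

theorem hpbn : HOk FA Spbc Hpbn [(44, 52), (57, 58)] := by
  constructor <;> decide +kernel

theorem ex_pb : ∃ (n : ℕ) (P : PlaneGraph (Fin n)), IsFullerene P ∧ 60 ≤ n ∧
    ∃ B : Fragment P, IsMaximalIn P B.edges ∧ Pasted P B ∧ IsPB2Frag B := by
  have h1 := DA.p1 fpba (by decide +kernel)
  have h2 := DA.b2 fpbc hpbn (by decide +kernel) (by decide +kernel)
  have h3 := DA.pasting fpba hpba fpbc hpbc fpb (fun l => List.mem_append)
    (a := 33) (b := 42) (by decide +kernel) (by decide +kernel) (by decide +kernel)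
  exact ⟨60, DA.pg, DA.full, le_rfl, DA.frag fpb, DA.maxi fpb (by decide +kernel),
    .paste _ _ _ (.base _ (Or.inl h1)) (Or.inr (Or.inl h2)) h3, _, _, h1, h2, h3⟩

def Sqa : List (List N60) := [[1, 5, 12, 10, 4]]

theorem fqa : FOk FB nbB Sqa [1, 4, 10, 12, 5] := by
  constructor <;> decide +kernel

def Sqc : List (List N60) := [[0, 1, 4, 6, 2], [0, 3, 8, 7, 2], [7, 14, 22, 15, 8], [15, 23, 31, 30, 22]]

theorem fqc : FOk FB nbB Sqc [0, 1, 4, 6, 2, 7, 14, 22, 30, 31, 23, 15, 8, 3] := by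
  constructor <;> decide +kernel

def Sqd : List (List N60) := [[10, 17, 25, 19, 12]]

theorem fqd : FOk FB nbB Sqd [10, 12, 19, 25, 17] := by
  constructor <;> decide +kernel

def Sqb : List (List N60) := Sqa ++ Sqc

theorem fqb : FOk FB nbB Sqb [0, 1, 5, 12, 10, 4, 6, 2, 7, 14, 22, 30, 31, 23, 15, 8, 3] := by
  constructor <;> decide +kernel

def Sq : List (List N60) := Sqb ++ Sqd

theorem fq : FOk FB nbB Sq [0, 1, 5, 12, 19, 25, 17, 10, 4, 6, 2, 7, 14, 22, 30, 31, 23, 15, 8, 3] := by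
  constructor <;> decide +kernel

def Hqa : List (List N60) := [[0, 3, 9, 11, 5, 1], [4, 10, 17, 20, 13, 6]]

theorem hqa : HOk FB Sqa Hqa [] := by
  constructor <;> decide +kernel

def Hqc : List (List N60) := [[0, 3, 9, 11, 5, 1], [4, 10, 17, 20, 13, 6], [14, 22, 30, 38, 29, 21], [16, 24, 32, 39, 31, 23]]

theorem hqc : HOk FB Sqc Hqc [(2, 7), (8, 15)] := by
  constructor <;> decide +kernel

def Hqn : List (List N60) := [[0, 3, 9, 11, 5, 1], [4, 10, 17, 20, 13, 6], [14, 22, 30, 38, 29, 21], [16, 24, 32, 39, 31, 23]]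

theorem hqn : HOk FB Sqc Hqn [(2, 7), (8, 15)] := by
  constructor <;> decide +kernel

def Hqb : List (List N60) := [[4, 10, 17, 20, 13, 6], [3, 9, 16, 23, 15, 8], [5, 12, 19, 27, 18, 11], [14, 22, 30, 38, 29, 21]]

theorem hqb : HOk FB Sqb Hqb [(0, 1), (2, 7)] := by
  constructor <;> decide +kernel

def Hqd : List (List N60) := [[4, 10, 17, 20, 13, 6], [5, 12, 19, 27, 18, 11]]

theorem hqd : HOk FB Sqd Hqd [] := by
  constructor <;> decide +kernel

theorem ex_q : ∃ (n : ℕ) (P : PlaneGraph (Fin n)), IsFullerene P ∧ 60 ≤ n ∧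
    ∃ B : Fragment P, IsMaximalIn P B.edges ∧ Pasted P B ∧ IsPB2PFrag B := by
  have h1 := DB.p1 fqa (by decide +kernel)
  have h2 := DB.b2 fqc hqn (by decide +kernel) (by decide +kernel)
  have h3 := DB.p1 fqd (by decide +kernel)
  have h4 := DB.pasting fqa hqa fqc hqc fqb (fun l => List.mem_append)
    (a := 1) (b := 4) (by decide +kernel) (by decide +kernel) (by decide +kernel)
  have h5 := DB.pasting fqb hqb fqd hqd fq (fun l => List.mem_append)
    (a := 10) (b := 12) (by decide +kernel) (by decide +kernel) (by decide +kernel)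
  exact ⟨60, DB.pg, DB.full, le_rfl, DB.frag fq, DB.maxi fq (by decide +kernel),
    .paste _ _ _ (.paste _ _ _ (.base _ (Or.inl h1)) (Or.inr (Or.inl h2)) h4) (Or.inl h3) h5,
    _, _, _, _, h1, h2, h3, h4, h5⟩

end FG

namespace FG

/-- Lemma 3.9.
`𝓑_{≥60} = {P, B_2, B_3, P∗P, P∗B_2, P∗B_2∗P}`: a maximal pentagonal fragment generated
by the pasting operation inside a fullerene graph with at least 60 vertices is one of
the six listed fragments, and each of the six occurs in some fullerene graph with at
least 60 vertices. -/
theorem statement_12 :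
    (∀ (V : Type) [Fintype V] [DecidableEq V] (P : PlaneGraph V), IsFullerene P →
      60 ≤ Fintype.card V → ∀ B : Fragment P, IsPentagonalFragment B →
      IsMaximalIn P B.edges → Pasted P B → SixShapes B) ∧
    (∃ (n : ℕ) (P : PlaneGraph (Fin n)), IsFullerene P ∧ 60 ≤ n ∧
      ∃ B : Fragment P, IsMaximalIn P B.edges ∧ Pasted P B ∧ IsPentagonFrag B) ∧
    (∃ (n : ℕ) (P : PlaneGraph (Fin n)), IsFullerene P ∧ 60 ≤ n ∧
      ∃ B : Fragment P, IsMaximalIn P B.edges ∧ Pasted P B ∧ IsB2Frag B) ∧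
    (∃ (n : ℕ) (P : PlaneGraph (Fin n)), IsFullerene P ∧ 60 ≤ n ∧
      ∃ B : Fragment P, IsMaximalIn P B.edges ∧ Pasted P B ∧ IsB3Frag B) ∧
    (∃ (n : ℕ) (P : PlaneGraph (Fin n)), IsFullerene P ∧ 60 ≤ n ∧
      ∃ B : Fragment P, IsMaximalIn P B.edges ∧ Pasted P B ∧ IsPPFrag B) ∧
    (∃ (n : ℕ) (P : PlaneGraph (Fin n)), IsFullerene P ∧ 60 ≤ n ∧
      ∃ B : Fragment P, IsMaximalIn P B.edges ∧ Pasted P B ∧ IsPB2Frag B) ∧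
    (∃ (n : ℕ) (P : PlaneGraph (Fin n)), IsFullerene P ∧ 60 ≤ n ∧
      ∃ B : Fragment P, IsMaximalIn P B.edges ∧ Pasted P B ∧ IsPB2PFrag B) := by
  refine ⟨?_, ex_p, ex_b2, ex_b3, ex_pp, ex_pb, ex_q⟩
  intro V _ _ P hP hn B h5 hm hp
  exact part_one hP hn B h5 hm hp

end FG
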